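/- arXiv:2312.02687 — 2 statements merged into one kernel-verified Lean document; each statement's English description precedes it below -/
import Mathlib

section
/- Let G be the graph on m + t vertices obtained from the complete graph K_m (m ≥ 1) by attaching t ≥ 0 pendant vertices (whiskers) to a single fixed vertex of K_m, i.e., adding t new vertices each adjacent only to that one vertex. Then J_G^s = J_G^(s) for every integer s ≥ 1. -/
open MvPolynomial

/-- The binomial edge ideal of a simple graph `G`, in the polynomial ring
`k[x_i, y_i : i ∈ V]` (variables indexed by `V ⊕ V`: `Sum.inl i ↦ x_i`, `Sum.inr i ↦ y_i`),
generated by the binomials `x_i y_j - x_j y_i` for edges `{i, j}` of `G`. -/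
noncomputable def binomialEdgeIdeal (k : Type) [Field k] {V : Type} (G : SimpleGraph V) :
    Ideal (MvPolynomial (V ⊕ V) k) :=
  Ideal.span {f | ∃ i j, G.Adj i j ∧
    f = X (Sum.inl i) * X (Sum.inr j) - X (Sum.inl j) * X (Sum.inr i)}

/-- The `t`-th symbolic power of an ideal `I`: the intersection, over all minimal primes `p`
of `I`, of the contraction to `S` of the extension of `I ^ t` to the localization `S_p`. -/
noncomputable def symbolicPower {S : Type*} [CommRing S] (I : Ideal S) (t : ℕ) : Ideal S :=
  ⨅ (p : Ideal S) (hp : p ∈ I.minimalPrimes),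
    haveI : p.IsPrime := hp.1.1
    (Ideal.map (algebraMap S (Localization.AtPrime p)) (I ^ t)).comap
      (algebraMap S (Localization.AtPrime p))

/-- The graph on `m + t` vertices obtained from the complete graph `K_m` (vertices `Sum.inl a`)
by attaching `t` pendant vertices (whiskers, vertices `Sum.inr w`), each adjacent only to the
fixed vertex `v` of `K_m`. -/
def completeWithWhiskers (m t : ℕ) (v : Fin m) : SimpleGraph (Fin m ⊕ Fin t) :=
  SimpleGraph.fromRel fun x y =>
    match x, y with
    | .inl _, .inl _ => True
    | .inr _, .inl a => a = v
    | _, _ => False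

section LeadingExponent

variable {k σ τ : Type} [Field k]

/-- The exponent `a` occurs in `p` with coefficient `1`, and every other exponent of `p` has
strictly smaller `W`-weight. -/
def HasLeadingExponent (W : (τ →₀ ℕ) →+ ℤ) (p : MvPolynomial τ k) (a : τ →₀ ℕ) : Prop :=
  coeff a p = 1 ∧ ∀ b, coeff b p ≠ 0 → b = a ∨ W b < W a

lemma HasLeadingExponent.mul {W : (τ →₀ ℕ) →+ ℤ} {p q : MvPolynomial τ k} {a b : τ →₀ ℕ}
    (hp : HasLeadingExponent W p a) (hq : HasLeadingExponent W q b) :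
    HasLeadingExponent W (p * q) (a + b) := by
  classical
  constructor
  · rw [coeff_mul, Finset.sum_eq_single (a, b)]
    · simp [hp.1, hq.1]
    · rintro ⟨c, d⟩ hcd hne
      by_contra h
      obtain ⟨hc, hd⟩ := mul_ne_zero_iff.1 h
      have hsum : c + d = a + b := by simpa using hcd
      have hW : W c + W d = W a + W b := by rw [← map_add, hsum, map_add]
      rcases hp.2 c hc with rfl | hlc
      · exact hne (by rw [add_left_cancel hsum])
      · rcases hq.2 d hd with rfl | hld <;> omega
    · simp
  · intro e he
    rw [coeff_mul] at he
    obtain ⟨⟨c, d⟩, hcd, hne⟩ := Finset.exists_ne_zero_of_sum_ne_zero he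
    obtain ⟨hc, hd⟩ := mul_ne_zero_iff.1 hne
    have hsum : c + d = e := by simpa using hcd
    subst hsum
    rw [map_add, map_add]
    rcases hp.2 c hc with rfl | hlc <;> rcases hq.2 d hd with rfl | hld
    · exact Or.inl rfl
    all_goals right; omega

lemma hasLeadingExponent_monomial (W : (τ →₀ ℕ) →+ ℤ) (a : τ →₀ ℕ) :
    HasLeadingExponent W (monomial a (1 : k)) a := by
  classical
  refine ⟨by simp, fun b hb => Or.inl ?_⟩
  by_contra h
  exact hb (by rw [coeff_monomial, if_neg (Ne.symm h)])

lemma HasLeadingExponent.add_of_lt {W : (τ →₀ ℕ) →+ ℤ} {p q : MvPolynomial τ k} {a : τ →₀ ℕ}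
    (hp : HasLeadingExponent W p a) (hq : ∀ b, coeff b q ≠ 0 → W b < W a) :
    HasLeadingExponent W (p + q) a := by
  have hqa : coeff a q = 0 := by
    by_contra h
    exact lt_irrefl _ (hq a h)
  refine ⟨by rw [coeff_add, hp.1, hqa, add_zero], fun b hb => ?_⟩
  by_cases h : coeff b q = 0
  · exact hp.2 b (by simpa [h] using hb)
  · exact Or.inr (hq b h)

lemma HasLeadingExponent.pow {W : (τ →₀ ℕ) →+ ℤ} {p : MvPolynomial τ k} {a : τ →₀ ℕ}
    (hp : HasLeadingExponent W p a) (n : ℕ) : HasLeadingExponent W (p ^ n) (n • a) := by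
  induction n with
  | zero => simpa using hasLeadingExponent_monomial (k := k) W 0
  | succ n ih => rw [pow_succ, succ_nsmul]; exact ih.mul hp

lemma hasLeadingExponent_aeval_monomial {W : (τ →₀ ℕ) →+ ℤ} {φ : σ → MvPolynomial τ k}
    {l : σ → τ →₀ ℕ} (hφ : ∀ i, HasLeadingExponent W (φ i) (l i)) (μ : σ →₀ ℕ) :
    HasLeadingExponent W (aeval φ (monomial μ (1 : k))) (Finsupp.weight l μ) := by
  induction μ using Finsupp.induction with
  | zero => simpa using hasLeadingExponent_monomial (k := k) W 0
  | single_add i n μ _ _ ih =>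
    have h : monomial (Finsupp.single i n + μ) (1 : k) = X i ^ n * monomial μ 1 := by
      rw [X_pow_eq_monomial, monomial_mul, one_mul]
    rw [h, map_mul, map_pow, aeval_X, map_add, Finsupp.weight_single]
    exact ((hφ i).pow n).mul ih

/-- An algebra map which sends variables to polynomials with leading exponents keeps the
coefficients of the exponents of maximal weight. -/
lemma coeff_weight_aeval_of_forall_le {W : (τ →₀ ℕ) →+ ℤ} {φ : σ → MvPolynomial τ k}
    {l : σ → τ →₀ ℕ} (hφ : ∀ i, HasLeadingExponent W (φ i) (l i))
    (hl : Function.Injective (Finsupp.weight l : (σ →₀ ℕ) →+ (τ →₀ ℕ)))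
    (f : MvPolynomial σ k) (μ : σ →₀ ℕ)
    (hμ : ∀ ν ∈ f.support, W (Finsupp.weight l ν) ≤ W (Finsupp.weight l μ)) :
    coeff (Finsupp.weight l μ) (aeval φ f) = coeff μ f := by
  classical
  have hmono : ∀ ν : σ →₀ ℕ, aeval φ (monomial ν (coeff ν f)) =
      coeff ν f • aeval φ (monomial ν (1 : k)) := by
    intro ν
    rw [← map_smul, smul_monomial, smul_eq_mul, mul_one]
  conv_lhs => rw [f.as_sum, map_sum, coeff_sum]
  simp only [hmono, coeff_smul, smul_eq_mul]
  have hlead := hasLeadingExponent_aeval_monomial hφ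
  rw [Finset.sum_eq_single μ]
  · rw [(hlead μ).1, mul_one]
  · intro ν hν hne
    by_contra h
    rcases (hlead ν).2 _ (right_ne_zero_of_mul h) with h' | h'
    · exact hne (hl h').symm
    · exact absurd (hμ ν hν) (not_le.2 h')
  · intro h
    rw [notMem_support_iff.1 h, zero_mul]

end LeadingExponent

section Symbolic

lemma pow_le_symbolicPower {S : Type*} [CommRing S] (I : Ideal S) (s : ℕ) :
    I ^ s ≤ symbolicPower I s :=
  le_iInf fun _ => le_iInf fun _ => Ideal.le_comap_map

lemma exists_notMem_mul_mem_pow_of_mem_symbolicPower {S : Type*} [CommRing S] {I p : Ideal S}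
    (hp : p ∈ I.minimalPrimes) {s : ℕ} {f : S} (hf : f ∈ symbolicPower I s) :
    ∃ u ∉ p, u * f ∈ I ^ s := by
  have : p.IsPrime := hp.1.1
  have h := (Ideal.mem_iInf.1 ((Ideal.mem_iInf.1 hf) p)) hp
  rw [Ideal.mem_comap,
    IsLocalization.algebraMap_mem_map_algebraMap_iff p.primeCompl] at h
  obtain ⟨u, hu, huf⟩ := h
  exact ⟨u, hu, huf⟩

variable {k : Type} [Field k]

/-- If the preimage of `(T)` under a map to `k[T, …]` is a minimal prime of `I`, then the map
sends the `s`-th symbolic power of `I` into `(T ^ s)`. -/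
lemma X_none_pow_dvd_of_mem_symbolicPower {S τ : Type} [CommRing S] {I : Ideal S}
    (Φ : S →+* MvPolynomial (Option τ) k)
    (hI : (Ideal.span {X none}).comap Φ ∈ I.minimalPrimes) {s : ℕ} {f : S}
    (hf : f ∈ symbolicPower I s) : X none ^ s ∣ Φ f := by
  obtain ⟨u, hu, huf⟩ := exists_notMem_mul_mem_pow_of_mem_symbolicPower hI hf
  have hmem : Φ (u * f) ∈ Ideal.span {(X none : MvPolynomial (Option τ) k)} ^ s := by
    refine Ideal.pow_right_mono (Ideal.map_le_iff_le_comap.2 hI.1.2) s ?_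
    rw [← Ideal.map_pow]
    exact Ideal.mem_map_of_mem Φ huf
  rw [Ideal.span_singleton_pow, Ideal.mem_span_singleton, map_mul] at hmem
  rw [Ideal.mem_comap, Ideal.mem_span_singleton] at hu
  exact (MvPolynomial.X_prime (i := none)).pow_dvd_of_dvd_mul_left s hu hmem

lemma le_apply_none_of_X_none_pow_dvd {τ : Type} {s : ℕ} {p : MvPolynomial (Option τ) k}
    (h : X none ^ s ∣ p) {a : Option τ →₀ ℕ} (ha : coeff a p ≠ 0) : s ≤ a none := by
  classical
  obtain ⟨q, rfl⟩ := h
  rw [X_pow_eq_monomial, coeff_monomial_mul'] at ha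
  have := (ite_ne_right_iff.1 ha).1 none
  simpa using this

end Symbolic

section EdgeBinomial

variable {k V : Type} [Field k]

variable (k) in
/-- The `2`-minor of the generic `2 × V` matrix on the columns `i` and `j`. -/
noncomputable def edgeBinomial (i j : V) : MvPolynomial (V ⊕ V) k :=
  X (Sum.inl i) * X (Sum.inr j) - X (Sum.inl j) * X (Sum.inr i)

lemma X_inl_mul_edgeBinomial (a i j : V) :
    X (Sum.inl a) * edgeBinomial k i j =
      X (Sum.inl i) * edgeBinomial k a j - X (Sum.inl j) * edgeBinomial k a i := by
  simp only [edgeBinomial]; ring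

lemma X_inr_mul_edgeBinomial (a i j : V) :
    X (Sum.inr a) * edgeBinomial k i j =
      X (Sum.inr i) * edgeBinomial k a j - X (Sum.inr j) * edgeBinomial k a i := by
  simp only [edgeBinomial]; ring

end EdgeBinomial

section VanishingMap

variable {k V : Type} [Field k] [DecidableEq V]

variable (k) in
/-- A map to `k[T, x, y]` (where `T = X none`) for which the preimage of `(T)` is the ideal of
polynomials vanishing whenever the columns in `Z` are zero and the columns in `B` are
proportional to the column `c`. The image of the variable `y_c` plays the role of the product of
`x_c` with the slope `y_c / x_c`, and `r` ranks the columns. -/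
noncomputable def vanishingMap (r : V → ℕ) (B Z : Finset V) (c : V) :
    V ⊕ V → MvPolynomial (Option (V ⊕ V)) k
  | Sum.inl j =>
    if j ∈ Z then X none * X (some (Sum.inl j))
    else if j ∈ B ∧ r j < r c then X none * X (some (Sum.inl j)) + X (some (Sum.inr j))
    else X (some (Sum.inl j))
  | Sum.inr j =>
    if j ∈ Z then X none * X (some (Sum.inr j))
    else if j = c then X (some (Sum.inr c)) * X (some (Sum.inl c))
    else if j ∈ B ∧ r j < r c then X (some (Sum.inr c)) * X (some (Sum.inr j))
    else if j ∈ B ∧ r c < r j then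
      X none * X (some (Sum.inr j)) + X (some (Sum.inr c)) * X (some (Sum.inl j))
    else X (some (Sum.inr j))

/-- The leading exponents of `vanishingMap`. -/
noncomputable def vanishingExponent (r : V → ℕ) (B Z : Finset V) (c : V) :
    V ⊕ V → Option (V ⊕ V) →₀ ℕ
  | Sum.inl j =>
    if j ∈ Z then .single none 1 + .single (some (Sum.inl j)) 1
    else if j ∈ B ∧ r j < r c then .single none 1 + .single (some (Sum.inl j)) 1
    else .single (some (Sum.inl j)) 1
  | Sum.inr j =>
    if j ∈ Z then .single none 1 + .single (some (Sum.inr j)) 1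
    else if j = c then .single (some (Sum.inr c)) 1 + .single (some (Sum.inl c)) 1
    else if j ∈ B ∧ r j < r c then .single (some (Sum.inr c)) 1 + .single (some (Sum.inr j)) 1
    else if j ∈ B ∧ r c < r j then .single none 1 + .single (some (Sum.inr j)) 1
    else .single (some (Sum.inr j)) 1

/-- A left inverse of `vanishingExponent`, on integral exponents. -/
noncomputable def vanishingExponentInv (r : V → ℕ) (B Z : Finset V) (c : V) :
    Option (V ⊕ V) → V ⊕ V →₀ ℤ
  | none => 0
  | some (Sum.inl j) => .single (Sum.inl j) 1
  | some (Sum.inr j) =>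
    if j ∈ Z then .single (Sum.inr j) 1
    else if j = c then .single (Sum.inr c) 1 - .single (Sum.inl c) 1
    else if j ∈ B ∧ r j < r c then
      .single (Sum.inr j) 1 - (.single (Sum.inr c) 1 - .single (Sum.inl c) 1)
    else .single (Sum.inr j) 1

/-- The weight of a variable: `0` for `x_j` and the rank of `j` for `y_j`. -/
def rankWeight (r : V → ℕ) : V ⊕ V → ℤ
  | Sum.inl _ => 0
  | Sum.inr j => r j

/-- The indicator of the variables whose leading exponent in `vanishingMap` involves `T`. -/
def vanishingOrder (r : V → ℕ) (B Z : Finset V) (c : V) : V ⊕ V → ℕ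
  | Sum.inl j => if j ∈ Z ∨ (j ∈ B ∧ r j < r c) then 1 else 0
  | Sum.inr j => if j ∈ Z ∨ (j ∈ B ∧ r c < r j) then 1 else 0

/-- The weight on the target of `vanishingMap` for which it preserves weights of leading terms. -/
noncomputable def vanishingWeight (r : V → ℕ) (B Z : Finset V) (c : V) :
    (Option (V ⊕ V) →₀ ℕ) →+ ℤ :=
  (Finsupp.weight (R := ℤ) (rankWeight r)).comp
    (Finsupp.weight (R := ℕ) (vanishingExponentInv r B Z c))

variable {r : V → ℕ} {B Z : Finset V} {c : V}

lemma weight_vanishingExponentInv (hc : c ∉ Z) (i : V ⊕ V) :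
    Finsupp.weight (R := ℕ) (vanishingExponentInv r B Z c) (vanishingExponent r B Z c i) =
      .single i 1 := by
  rcases i with j | j <;> simp only [vanishingExponent] <;> split_ifs <;>
    simp_all [Finsupp.weight_single, vanishingExponentInv]

lemma weight_vanishingExponentInv_weight (hc : c ∉ Z) (μ : V ⊕ V →₀ ℕ) :
    Finsupp.weight (R := ℕ) (vanishingExponentInv r B Z c)
      (Finsupp.weight (R := ℕ) (vanishingExponent r B Z c) μ) =
        μ.mapRange (Nat.castAddMonoidHom ℤ) (map_zero _) := by
  induction μ using Finsupp.induction_linear with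
  | zero => simp
  | add f g hf hg => rw [map_add, map_add, hf, hg, Finsupp.mapRange_add (by simp)]
  | single i n =>
    rw [Finsupp.weight_single, map_nsmul, weight_vanishingExponentInv hc, Finsupp.mapRange_single]
    simp

lemma weight_vanishingExponent_injective (hc : c ∉ Z) :
    Function.Injective (Finsupp.weight (R := ℕ) (vanishingExponent r B Z c)) := by
  intro μ ν h
  have := congrArg (Finsupp.weight (R := ℕ) (vanishingExponentInv r B Z c)) h
  rw [weight_vanishingExponentInv_weight hc, weight_vanishingExponentInv_weight hc] at this
  exact Finsupp.mapRange_injective _ _ Nat.cast_injective this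

lemma vanishingWeight_weight (hc : c ∉ Z) (μ : V ⊕ V →₀ ℕ) :
    vanishingWeight r B Z c (Finsupp.weight (R := ℕ) (vanishingExponent r B Z c) μ) =
      Finsupp.weight (rankWeight r) μ := by
  rw [vanishingWeight, AddMonoidHom.comp_apply, weight_vanishingExponentInv_weight hc]
  induction μ using Finsupp.induction_linear with
  | zero => simp
  | add f g hf hg => rw [Finsupp.mapRange_add (by simp), map_add, map_add, hf, hg]
  | single i n => simp [Finsupp.weight_single]

lemma weight_vanishingExponent_none (μ : V ⊕ V →₀ ℕ) :
    Finsupp.weight (R := ℕ) (vanishingExponent r B Z c) μ none =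
      Finsupp.weight (vanishingOrder r B Z c) μ := by
  induction μ using Finsupp.induction_linear with
  | zero => simp
  | add f g hf hg => rw [map_add, map_add, Finsupp.add_apply, hf, hg]
  | single i n =>
    rw [Finsupp.weight_single, Finsupp.weight_single, Finsupp.smul_apply]
    congr 1
    rcases i with j | j <;> simp only [vanishingExponent, vanishingOrder] <;> split_ifs <;>
      first | simp; done | grind

lemma hasLeadingExponent_X_mul_X {τ : Type} (W : (τ →₀ ℕ) →+ ℤ) (i j : τ) :
    HasLeadingExponent W (X i * X j : MvPolynomial τ k) (.single i 1 + .single j 1) :=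
  (hasLeadingExponent_monomial W _).mul (hasLeadingExponent_monomial W _)

lemma weight_lt_of_coeff_ne_zero {τ : Type} {W : (τ →₀ ℕ) →+ ℤ} {p : MvPolynomial τ k}
    {a b : τ →₀ ℕ} (hp : HasLeadingExponent W p a) {n : ℤ} (h : W a < n) (hb : coeff b p ≠ 0) :
    W b < n := by
  rcases hp.2 b hb with rfl | h'
  · exact h
  · exact h'.trans h

lemma hasLeadingExponent_vanishingMap (hc : c ∉ Z) (i : V ⊕ V) :
    HasLeadingExponent (vanishingWeight r B Z c) (vanishingMap k r B Z c i)
      (vanishingExponent r B Z c i) := by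
  rcases i with j | j <;> simp only [vanishingMap, vanishingExponent] <;> split_ifs with h₁ h₂
  any_goals exact hasLeadingExponent_X_mul_X _ _ _
  any_goals exact hasLeadingExponent_monomial _ _
  · refine (hasLeadingExponent_X_mul_X _ _ _).add_of_lt fun b hb =>
      weight_lt_of_coeff_ne_zero (hasLeadingExponent_monomial _ _) ?_ hb
    have hjc : j ≠ c := by rintro rfl; exact lt_irrefl _ h₂.2
    simp [vanishingWeight, Finsupp.weight_single, vanishingExponentInv, rankWeight, h₁, h₂, hjc]
  · refine (hasLeadingExponent_X_mul_X _ _ _).add_of_lt fun b hb =>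
      weight_lt_of_coeff_ne_zero (hasLeadingExponent_X_mul_X _ _ _) ?_ hb
    rename_i h₃
    simp [vanishingWeight, Finsupp.weight_single, vanishingExponentInv, rankWeight, h₁, h₂, h₃, hc,
      h₃.2.not_gt]

lemma le_weight_of_mem_symbolicPower (hc : c ∉ Z) {I : Ideal (MvPolynomial (V ⊕ V) k)}
    (hI : (Ideal.span {X none}).comap (aeval (vanishingMap k r B Z c)).toRingHom ∈ I.minimalPrimes)
    {s : ℕ} {f : MvPolynomial (V ⊕ V) k} (hf : f ∈ symbolicPower I s) {μ : V ⊕ V →₀ ℕ}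
    (hμ : coeff μ f ≠ 0) (htop : ∀ ν ∈ f.support,
      Finsupp.weight (rankWeight r) ν ≤ Finsupp.weight (rankWeight r) μ) :
    s ≤ Finsupp.weight (vanishingOrder r B Z c) μ := by
  rw [← weight_vanishingExponent_none]
  refine le_apply_none_of_X_none_pow_dvd (X_none_pow_dvd_of_mem_symbolicPower _ hI hf) ?_
  refine ne_of_eq_of_ne (coeff_weight_aeval_of_forall_le
    (W := vanishingWeight r B Z c) (hasLeadingExponent_vanishingMap hc)
    (weight_vanishingExponent_injective hc) f μ ?_) hμ
  simpa only [vanishingWeight_weight hc] using htop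

end VanishingMap

section MinimalPrime

variable {k V : Type} [Field k] [DecidableEq V] {r : V → ℕ} {B Z : Finset V} {c : V}

variable (k) in
/-- The ideal of polynomials which vanish whenever the columns in `Z` are zero and the columns
in `B` are proportional to the column `c`. -/
noncomputable def proportionalIdeal (r : V → ℕ) (B Z : Finset V) (c : V) :
    Ideal (MvPolynomial (V ⊕ V) k) :=
  (Ideal.span {X none}).comap (aeval (vanishingMap k r B Z c)).toRingHom

lemma mem_proportionalIdeal {f : MvPolynomial (V ⊕ V) k} :
    f ∈ proportionalIdeal k r B Z c ↔ X none ∣ aeval (vanishingMap k r B Z c) f := by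
  rw [proportionalIdeal, Ideal.mem_comap, Ideal.mem_span_singleton]
  rfl

instance : (proportionalIdeal k r B Z c).IsPrime :=
  have : (Ideal.span {(X none : MvPolynomial (Option (V ⊕ V)) k)}).IsPrime :=
    (Ideal.span_singleton_prime (X_ne_zero none)).2 X_prime
  Ideal.comap_isPrime _ _

lemma notMem_proportionalIdeal {f : MvPolynomial (V ⊕ V) k} (x : Option (V ⊕ V) → k)
    (hx : x none = 0) (hf : aeval (fun i => aeval x (vanishingMap k r B Z c i)) f ≠ 0) :
    f ∉ proportionalIdeal k r B Z c := by
  rw [mem_proportionalIdeal]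
  rintro ⟨q, hq⟩
  apply hf
  have := congrArg (aeval x) hq
  rw [← AlgHom.comp_apply, comp_aeval] at this
  rw [this, map_mul, aeval_X, hx, zero_mul]

lemma X_inl_notMem_proportionalIdeal {j : V} (hj : j ∉ Z) :
    X (Sum.inl j) ∉ proportionalIdeal k r B Z c := by
  refine notMem_proportionalIdeal (fun i => i.elim 0 fun _ => 1) rfl ?_
  rw [aeval_X]
  simp only [vanishingMap, hj, if_false]
  split_ifs <;> simp

lemma edgeBinomial_notMem_proportionalIdeal (hc : c ∉ Z) {w : V} (hwc : w ≠ c) (hwB : w ∉ B)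
    (hwZ : w ∉ Z) : edgeBinomial k c w ∉ proportionalIdeal k r B Z c := by
  refine notMem_proportionalIdeal
    (fun i => i.elim 0 (Sum.elim (fun _ => 1) fun j => if j = c then 0 else 1)) rfl ?_
  simp [edgeBinomial, vanishingMap, hc, hwc, hwB, hwZ]

lemma X_mem_proportionalIdeal {j : V} (hj : j ∈ Z) :
    X (Sum.inl j) ∈ proportionalIdeal k r B Z c ∧ X (Sum.inr j) ∈ proportionalIdeal k r B Z c := by
  constructor <;> rw [mem_proportionalIdeal, aeval_X] <;> simp [vanishingMap, hj]

lemma edgeBinomial_center_mem_proportionalIdeal (hr : Function.Injective r) (hc : c ∉ Z) {j : V}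
    (hB : j ∈ B) (hZ : j ∉ Z) : edgeBinomial k c j ∈ proportionalIdeal k r B Z c := by
  rw [mem_proportionalIdeal, edgeBinomial]
  simp only [map_sub, map_mul, aeval_X, vanishingMap, hc, hZ, if_false, lt_irrefl, and_false,
    hB, true_and, if_true]
  rcases lt_trichotomy (r j) (r c) with h | h | h
  · have hjc : j ≠ c := by rintro rfl; exact lt_irrefl _ h
    simp only [h, hjc, if_true, if_false]
    exact ⟨-(X (some (Sum.inl j)) * (X (some (Sum.inr c)) * X (some (Sum.inl c)))), by ring⟩
  · obtain rfl := hr h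
    simp
  · have hjc : j ≠ c := by rintro rfl; exact lt_irrefl _ h
    simp only [h, hjc, h.not_gt, if_true, if_false]
    exact ⟨X (some (Sum.inl c)) * X (some (Sum.inr j)), by ring⟩

lemma edgeBinomial_mem_proportionalIdeal (hr : Function.Injective r) (hBZ : Disjoint B Z)
    (hc : c ∈ B) {i j : V} (hi : i ∈ B) (hj : j ∈ B) :
    edgeBinomial k i j ∈ proportionalIdeal k r B Z c := by
  have hZ : ∀ u ∈ B, u ∉ Z := fun u hu => Finset.disjoint_left.1 hBZ hu
  refine (Ideal.IsPrime.mem_or_mem inferInstance ?_).resolve_left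
    (X_inl_notMem_proportionalIdeal (hZ c hc))
  rw [X_inl_mul_edgeBinomial]
  exact sub_mem
    (Ideal.mul_mem_left _ _ (edgeBinomial_center_mem_proportionalIdeal hr (hZ c hc) hj (hZ j hj)))
    (Ideal.mul_mem_left _ _ (edgeBinomial_center_mem_proportionalIdeal hr (hZ c hc) hi (hZ i hi)))

lemma proportionalIdeal_le (hc : c ∉ Z) {p : Ideal (MvPolynomial (V ⊕ V) k)} [p.IsPrime]
    (hp : p ≤ proportionalIdeal k r B Z c) (hB : ∀ j ∈ B, edgeBinomial k c j ∈ p)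
    (hZ : ∀ j ∈ Z, X (Sum.inl j) ∈ p ∧ X (Sum.inr j) ∈ p) :
    proportionalIdeal k r B Z c ≤ p := by
  let F := FractionRing (MvPolynomial (V ⊕ V) k ⧸ p)
  let ev : MvPolynomial (V ⊕ V) k →ₐ[k] F :=
    (IsScalarTower.toAlgHom k (MvPolynomial (V ⊕ V) k ⧸ p) F).comp (Ideal.Quotient.mkₐ k p)
  have hev : ∀ f, ev f = 0 ↔ f ∈ p := by
    intro f
    rw [← Ideal.Quotient.eq_zero_iff_mem]
    exact map_eq_zero_iff _ (IsFractionRing.injective (MvPolynomial (V ⊕ V) k ⧸ p) F)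
  have hx : ev (X (Sum.inl c)) ≠ 0 := fun h =>
    X_inl_notMem_proportionalIdeal hc (hp ((hev _).1 h))
  have hprop : ∀ j ∈ B, ev (X (Sum.inl c)) * ev (X (Sum.inr j)) =
      ev (X (Sum.inl j)) * ev (X (Sum.inr c)) := by
    intro j hj
    have := (hev _).2 (hB j hj)
    rw [edgeBinomial, map_sub, map_mul, map_mul] at this
    exact sub_eq_zero.1 this
  let x : Option (V ⊕ V) → F := fun i => i.elim 0 (Sum.elim (fun j => ev (X (Sum.inl j)))
    fun j => if j = c then ev (X (Sum.inr c)) / ev (X (Sum.inl c))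
      else if j ∈ B ∧ r j < r c then ev (X (Sum.inl j)) else ev (X (Sum.inr j)))
  have hcomp : (aeval x).comp (aeval (vanishingMap k r B Z c)) = ev := by
    refine algHom_ext fun i => ?_
    rw [AlgHom.comp_apply, aeval_X]
    rcases i with j | j <;> simp only [vanishingMap]
    · split_ifs with h₁ h₂
      · simpa [x] using ((hev _).2 (hZ j h₁).1).symm
      · have hjc : j ≠ c := by rintro rfl; exact lt_irrefl _ h₂.2
        simp [x, h₂, hjc]
      · simp [x]
    · split_ifs with h₁ h₂ h₃ h₄
      · simpa [x] using ((hev _).2 (hZ j h₁).2).symm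
      · simpa [x, h₂] using div_mul_cancel₀ _ hx
      · simp only [map_mul, aeval_X, x, Option.elim_some, Sum.elim_inr, if_true, h₂, h₃, if_false,
          and_self]
        rw [div_mul_eq_mul_div, div_eq_iff hx, mul_comm (ev (X (Sum.inr j))), hprop j h₃.1,
          mul_comm]
      · simp only [map_add, map_mul, aeval_X, x, Option.elim_some, Option.elim_none, Sum.elim_inr,
          Sum.elim_inl, if_true, zero_mul, zero_add]
        rw [div_mul_eq_mul_div, div_eq_iff hx, mul_comm (ev (X (Sum.inr j))), hprop j h₄.1,
          mul_comm]
      · simp [x, h₂, h₃]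
  intro f hf
  obtain ⟨q, hq⟩ := mem_proportionalIdeal.1 hf
  rw [← hev, ← hcomp, AlgHom.comp_apply, hq, map_mul, aeval_X]
  simp [x]

lemma proportionalIdeal_mem_minimalPrimes (hc : c ∉ Z) {I : Ideal (MvPolynomial (V ⊕ V) k)}
    (hI : I ≤ proportionalIdeal k r B Z c)
    (h : ∀ p : Ideal (MvPolynomial (V ⊕ V) k), p.IsPrime → I ≤ p →
      p ≤ proportionalIdeal k r B Z c → (∀ j ∈ B, edgeBinomial k c j ∈ p) ∧
        ∀ j ∈ Z, X (Sum.inl j) ∈ p ∧ X (Sum.inr j) ∈ p) :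
    proportionalIdeal k r B Z c ∈ I.minimalPrimes := by
  refine ⟨⟨inferInstance, hI⟩, fun p hp hle => ?_⟩
  have := hp.1
  obtain ⟨hB, hZ⟩ := h p hp.1 hp.2 hle
  exact proportionalIdeal_le hc hle hB hZ

end MinimalPrime

section Rank

variable {k V : Type} [Field k] {r : V → ℕ} {A : Finset V}

lemma hasLeadingExponent_edgeBinomial {i j : V} (hij : r i < r j) :
    HasLeadingExponent (Finsupp.weight (rankWeight r)) (edgeBinomial k i j)
      (.single (Sum.inl i) 1 + .single (Sum.inr j) 1) := by
  rw [edgeBinomial, sub_eq_add_neg]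
  refine (hasLeadingExponent_X_mul_X _ _ _).add_of_lt fun b hb => ?_
  rw [coeff_neg, neg_ne_zero] at hb
  refine weight_lt_of_coeff_ne_zero (hasLeadingExponent_X_mul_X _ _ _) ?_ hb
  simpa [Finsupp.weight_single, rankWeight] using hij

lemma exists_consecutive_pair (hA : A.Nonempty) (α β : V → ℕ)
    (h : ∀ c ∈ A, ∃ u ∈ A, (r u < r c ∧ α u ≠ 0) ∨ (r c < r u ∧ β u ≠ 0)) :
    ∃ i ∈ A, ∃ j ∈ A, r i < r j ∧ α i ≠ 0 ∧ β j ≠ 0 ∧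
      ∀ u ∈ A, r i < r u → r u < r j → β u = 0 := by
  have hα : (A.filter fun u => α u ≠ 0).Nonempty := by
    by_contra hne
    rw [Finset.not_nonempty_iff_eq_empty, Finset.filter_eq_empty_iff] at hne
    obtain ⟨c, hc, hmax⟩ := A.exists_max_image r hA
    obtain ⟨u, hu, h' | h'⟩ := h c hc
    · exact hne hu h'.2
    · exact absurd (hmax u hu) (not_le.2 h'.1)
  obtain ⟨i, hi, hmin⟩ := Finset.exists_min_image _ r hα
  rw [Finset.mem_filter] at hi
  have hβ : (A.filter fun u => r i < r u ∧ β u ≠ 0).Nonempty := by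
    obtain ⟨u, hu, h' | h'⟩ := h i hi.1
    · exact absurd (hmin u (Finset.mem_filter.2 ⟨hu, h'.2⟩)) (not_le.2 h'.1)
    · exact ⟨u, Finset.mem_filter.2 ⟨hu, h'⟩⟩
  obtain ⟨j, hj, hjmin⟩ := Finset.exists_min_image _ r hβ
  rw [Finset.mem_filter] at hj
  refine ⟨i, hi.1, j, hj.1, hj.2.1, hi.2, hj.2.2, fun u hu h₁ h₂ => ?_⟩
  by_contra h₃
  exact absurd (hjmin u (Finset.mem_filter.2 ⟨hu, h₁, h₃⟩)) (not_le.2 h₂)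

lemma exists_eq_add_single_add_single {i j : V} {μ : V ⊕ V →₀ ℕ} (hi : μ (Sum.inl i) ≠ 0)
    (hj : μ (Sum.inr j) ≠ 0) :
    ∃ ν, μ = ν + (.single (Sum.inl i) 1 + .single (Sum.inr j) 1) := by
  refine ⟨μ - .single (Sum.inr j) 1 - .single (Sum.inl i) 1, ?_⟩
  rw [← add_assoc, Finsupp.sub_add_single_one_cancel (by simpa using hi),
    Finsupp.sub_add_single_one_cancel hj]

end Rank

section Matching

variable {k V : Type} [Field k] [DecidableEq V] [Fintype V] {r : V → ℕ} {v : V}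

lemma weight_vanishingOrder_add_le {B Z : Finset V} {c i : V} {μ : V ⊕ V →₀ ℕ} (hi : i ∈ B)
    (hiZ : i ∉ Z) (hic : r i < r c)
    (hμ : ∀ u ∈ B, r i < r u → r u ≤ r c → μ (Sum.inr u) = 0) :
    Finsupp.weight (vanishingOrder r B Z i) μ + μ (Sum.inl i) ≤
      Finsupp.weight (vanishingOrder r B Z c) μ := by
  rw [← Finsupp.weight_single_one_apply (Sum.inl i) μ]
  simp only [Finsupp.weight_eq_sum, smul_eq_mul]
  rw [← Finset.sum_add_distrib]
  refine Finset.sum_le_sum fun t _ => ?_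
  rw [← mul_add]
  rcases t with u | u
  · refine Nat.mul_le_mul_left _ ?_
    simp only [vanishingOrder, Pi.single_apply, Sum.inl.injEq]
    grind
  · by_cases h : u ∈ B ∧ r i < r u ∧ r u ≤ r c
    · simp [hμ u h.1 h.2.1 h.2.2]
    · refine Nat.mul_le_mul_left _ ?_
      simp only [vanishingOrder, Pi.single_apply, reduceCtorEq]
      grind

lemma le_weight_vanishingOrder_of_add {B Z : Finset V} {c i j : V} {μ : V ⊕ V →₀ ℕ} {s : ℕ}
    (hi : i ∈ B) (hiZ : i ∉ Z) (hjZ : j ∉ Z)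
    (hμ : ∀ u ∈ B, r i < r u → r u < r j →
      (μ + (.single (Sum.inl i) 1 + .single (Sum.inr j) 1)) (Sum.inr u) = 0)
    (hsi : s + 1 ≤ Finsupp.weight (vanishingOrder r B Z i)
      (μ + (.single (Sum.inl i) 1 + .single (Sum.inr j) 1)))
    (hsc : s + 1 ≤ Finsupp.weight (vanishingOrder r B Z c)
      (μ + (.single (Sum.inl i) 1 + .single (Sum.inr j) 1))) :
    s ≤ Finsupp.weight (vanishingOrder r B Z c) μ := by
  by_cases h : r i < r c ∧ r c < r j
  · have hle := weight_vanishingOrder_add_le (Z := Z) hi hiZ h.1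
      fun u hu h₁ h₂ => hμ u hu h₁ (h₂.trans_lt h.2)
    simp only [map_add, Finsupp.weight_single, Finsupp.add_apply, Finsupp.single_eq_same,
      smul_eq_mul, one_mul] at hle hsi hsc
    have h₁ : vanishingOrder r B Z c (Sum.inl i) ≤ 1 := by
      simp only [vanishingOrder]; split_ifs <;> omega
    have h₂ : vanishingOrder r B Z c (Sum.inr j) ≤ 1 := by
      simp only [vanishingOrder]; split_ifs <;> omega
    omega
  · simp only [map_add, Finsupp.weight_single, smul_eq_mul, one_mul, vanishingOrder, hiZ, hjZ,
      false_or] at hsc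
    split_ifs at hsc <;> grind

lemma exists_ne_zero_of_one_le_weight {B Z : Finset V} {c : V} {μ : V ⊕ V →₀ ℕ}
    (h : 1 ≤ Finsupp.weight (vanishingOrder r B Z c) μ) :
    ∃ u, ((u ∈ Z ∨ (u ∈ B ∧ r u < r c)) ∧ μ (Sum.inl u) ≠ 0) ∨
      ((u ∈ Z ∨ (u ∈ B ∧ r c < r u)) ∧ μ (Sum.inr u) ≠ 0) := by
  rw [Finsupp.weight_eq_sum] at h
  obtain ⟨t, -, ht⟩ := Finset.exists_ne_zero_of_sum_ne_zero (Nat.one_le_iff_ne_zero.1 h)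
  rw [smul_eq_mul] at ht
  rcases t with u | u
  · refine ⟨u, Or.inl ⟨?_, left_ne_zero_of_mul ht⟩⟩
    by_contra h'
    exact right_ne_zero_of_mul ht (if_neg h')
  · refine ⟨u, Or.inr ⟨?_, left_ne_zero_of_mul ht⟩⟩
    by_contra h'
    exact right_ne_zero_of_mul ht (if_neg h')

lemma add_le_weight_vanishingOrder {B : Finset V} {c : V} (μ : V ⊕ V →₀ ℕ) :
    μ (Sum.inl v) + μ (Sum.inr v) ≤ Finsupp.weight (vanishingOrder r B {v} c) μ := by
  rw [← Finsupp.weight_single_one_apply (Sum.inl v) μ,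
    ← Finsupp.weight_single_one_apply (Sum.inr v) μ]
  simp only [Finsupp.weight_eq_sum, smul_eq_mul]
  rw [← Finset.sum_add_distrib]
  refine Finset.sum_le_sum fun t _ => ?_
  rw [← mul_add]
  refine Nat.mul_le_mul_left _ ?_
  rcases t with u | u <;> simp only [vanishingOrder, Pi.single_apply, Finset.mem_singleton] <;>
    grind

lemma weight_vanishingOrder_le_add {B : Finset V} {c : V} (μ : V ⊕ V →₀ ℕ)
    (h : ∀ u ∈ B, (r u < r c → μ (Sum.inl u) = 0) ∧ (r c < r u → μ (Sum.inr u) = 0)) :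
    Finsupp.weight (vanishingOrder r B {v} c) μ ≤ μ (Sum.inl v) + μ (Sum.inr v) := by
  rw [← Finsupp.weight_single_one_apply (Sum.inl v) μ,
    ← Finsupp.weight_single_one_apply (Sum.inr v) μ]
  simp only [Finsupp.weight_eq_sum, smul_eq_mul]
  rw [← Finset.sum_add_distrib]
  refine Finset.sum_le_sum fun t _ => ?_
  rw [← mul_add]
  rcases t with u | u <;> simp only [vanishingOrder, Pi.single_apply, Finset.mem_singleton]
  · by_cases hu : u ∈ B ∧ r u < r c
    · simp [(h u hu.1).1 hu.2]
    · refine Nat.mul_le_mul_left _ ?_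
      grind
  · by_cases hu : u ∈ B ∧ r c < r u
    · simp [(h u hu.1).2 hu.2]
    · refine Nat.mul_le_mul_left _ ?_
      grind

lemma exists_mem_pow_hasLeadingExponent {A : Finset V} (hv : r v = 0)
    (hvA : v ∉ A) (hdown : ∀ j ∈ A, ∀ u, u ≠ v → r u < r j → u ∈ A)
    (hA : ∀ w, w ≠ v → A.Nonempty) {I : Ideal (MvPolynomial (V ⊕ V) k)}
    (hIv : ∀ j, edgeBinomial k v j ∈ I) (hIA : ∀ i ∈ A, ∀ j ∈ A, edgeBinomial k i j ∈ I)
    (s : ℕ) (μ : V ⊕ V →₀ ℕ)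
    (hC : ∀ c, s ≤ Finsupp.weight (vanishingOrder r Finset.univ ∅ c) μ)
    (hD : ∀ c ∈ A, s ≤ Finsupp.weight (vanishingOrder r A {v} c) μ) :
    ∃ h ∈ I ^ s, HasLeadingExponent (Finsupp.weight (rankWeight r)) h μ := by
  induction s generalizing μ with
  | zero => exact ⟨monomial μ 1, by simp, hasLeadingExponent_monomial _ _⟩
  | succ s ih =>
    have hne : ∀ u, r v < r u → u ≠ v := by rintro u h rfl; exact lt_irrefl _ h
    obtain ⟨w, hw, hwμ⟩ : ∃ w, r v < r w ∧ μ (Sum.inr w) ≠ 0 := by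
      obtain ⟨w, h | h⟩ := exists_ne_zero_of_one_le_weight ((Nat.le_add_left 1 s).trans (hC v))
      · simp [hv] at h
      · exact ⟨w, by simpa using h.1, h.2⟩
    by_cases hd : μ (Sum.inl v) + μ (Sum.inr v) < s + 1
    · obtain ⟨i, hi, j, hj, hij, hαi, hβj, hβ⟩ := exists_consecutive_pair (hA w (hne w hw))
        (fun u => μ (Sum.inl u)) (fun u => μ (Sum.inr u)) (r := r) (by
          intro c hc
          by_contra! hcon
          have := weight_vanishingOrder_le_add (r := r) (v := v) (B := A) (c := c) μ hcon
          have := hD c hc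
          omega)
      obtain ⟨ν, rfl⟩ := exists_eq_add_single_add_single hαi hβj
      have hnv : ∀ u ∈ A, u ∉ ({v} : Finset V) := by
        intro u hu h
        exact hvA (Finset.mem_singleton.1 h ▸ hu)
      obtain ⟨h, hh, hlead⟩ := ih ν
        (fun c => le_weight_vanishingOrder_of_add (Finset.mem_univ i) (Finset.notMem_empty i)
          (Finset.notMem_empty j)
          (fun u _ h₁ h₂ => hβ u (hdown j hj u (hne u (by omega)) h₂) h₁ h₂) (hC i) (hC c))
        (fun c hc => le_weight_vanishingOrder_of_add hi (hnv i hi) (hnv j hj) hβ (hD i hi) (hD c hc))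
      exact ⟨h * edgeBinomial k i j, by rw [pow_succ]; exact Ideal.mul_mem_mul hh (hIA i hi j hj),
        hlead.mul (hasLeadingExponent_edgeBinomial hij)⟩
    · by_cases hα : μ (Sum.inl v) = 0
      · obtain ⟨i, hi, j, hj, hij, hαi, hβj, hβ⟩ := exists_consecutive_pair
          (A := Finset.univ.erase v) ⟨w, by simpa using hne w hw⟩
          (fun u => μ (Sum.inl u)) (fun u => μ (Sum.inr u)) (r := r) (by
            intro c _
            obtain ⟨u, h | h⟩ :=
              exists_ne_zero_of_one_le_weight ((Nat.le_add_left 1 s).trans (hC c))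
            · refine ⟨u, ?_, Or.inl ⟨by simpa using h.1, h.2⟩⟩
              simpa using fun h' : u = v => h.2 (h' ▸ hα)
            · have hcu : r c < r u := by simpa using h.1
              exact ⟨u, by simpa using hne u (by omega), Or.inr ⟨hcu, h.2⟩⟩)
        have hiv : i ≠ v := (Finset.mem_erase.1 hi).1
        have hjv : j ≠ v := (Finset.mem_erase.1 hj).1
        obtain ⟨ν', rfl⟩ := exists_eq_add_single_add_single hαi hβj
        have hνv : ν' (Sum.inr v) ≠ 0 := by
          simp [hjv] at hd hα
          omega
        obtain ⟨ν, rfl⟩ : ∃ ν, ν' = ν + .single (Sum.inr v) 1 :=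
          ⟨ν' - .single (Sum.inr v) 1, (Finsupp.sub_add_single_one_cancel hνv).symm⟩
        obtain ⟨h, hh, hlead⟩ := ih ν
          (fun c => by
            have := le_weight_vanishingOrder_of_add (Finset.mem_univ i) (Finset.notMem_empty i)
              (Finset.notMem_empty j)
              (fun u _ h₁ h₂ => hβ u (by simpa using hne u (by omega)) h₁ h₂) (hC i) (hC c)
            rw [map_add, Finsupp.weight_single] at this
            simpa [vanishingOrder, hv] using this)
          (fun c _ => by
            refine le_trans ?_ (add_le_weight_vanishingOrder ν)
            simp [hiv, hjv] at hd
            omega)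
        refine ⟨h * (X (Sum.inr v) * edgeBinomial k i j), ?_, ?_⟩
        · rw [X_inr_mul_edgeBinomial, pow_succ]
          exact Ideal.mul_mem_mul hh <| sub_mem (Ideal.mul_mem_left _ _ (hIv j)) (Ideal.mul_mem_left _ _ (hIv i))
        · rw [add_assoc]
          exact hlead.mul ((hasLeadingExponent_monomial _ _).mul
            (hasLeadingExponent_edgeBinomial hij))
      · obtain ⟨j, hj, hjmin⟩ := Finset.exists_min_image
          (Finset.univ.filter fun u => r v < r u ∧ μ (Sum.inr u) ≠ 0) r
          ⟨w, Finset.mem_filter.2 ⟨Finset.mem_univ w, hw, hwμ⟩⟩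
        obtain ⟨-, hvj, hβj⟩ := Finset.mem_filter.1 hj
        have hβ : ∀ u ∈ Finset.univ, r v < r u → r u < r j → μ (Sum.inr u) = 0 := by
          intro u hu h₁ h₂
          by_contra h₃
          exact absurd (hjmin u (Finset.mem_filter.2 ⟨hu, h₁, h₃⟩)) (not_le.2 h₂)
        obtain ⟨ν, rfl⟩ := exists_eq_add_single_add_single hα hβj
        obtain ⟨h, hh, hlead⟩ := ih ν
          (fun c => le_weight_vanishingOrder_of_add (Finset.mem_univ v) (Finset.notMem_empty v)
            (Finset.notMem_empty j) hβ (hC v) (hC c))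
          (fun c _ => by
            refine le_trans ?_ (add_le_weight_vanishingOrder ν)
            simp [hne j hvj] at hd
            omega)
        exact ⟨h * edgeBinomial k v j, by rw [pow_succ]; exact Ideal.mul_mem_mul hh (hIv j),
          hlead.mul (hasLeadingExponent_edgeBinomial hvj)⟩

end Matching

section SymbolicPower

lemma weight_rankWeight_nonneg {V : Type} [Fintype V] {r : V → ℕ} (μ : V ⊕ V →₀ ℕ) :
    0 ≤ Finsupp.weight (rankWeight r) μ := by
  rw [Finsupp.weight_eq_sum]
  refine Finset.sum_nonneg fun t _ => nsmul_nonneg ?_ _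
  rcases t with u | u <;> simp [rankWeight]

variable {k V : Type} [Field k] [DecidableEq V] {r : V → ℕ} {v : V} {A : Finset V}
  {I : Ideal (MvPolynomial (V ⊕ V) k)}

lemma edgeBinomial_mem_binomialEdgeIdeal {G : SimpleGraph V} {i j : V} (h : i ≠ j → G.Adj i j) :
    edgeBinomial k i j ∈ binomialEdgeIdeal k G := by
  by_cases hij : i = j
  · subst hij
    simp [edgeBinomial]
  · exact Ideal.subset_span ⟨i, j, h hij, rfl⟩

lemma proportionalIdeal_singleton_mem_minimalPrimes (hr : Function.Injective r) (hvA : v ∉ A)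
    (hIv : ∀ j, edgeBinomial k v j ∈ I) (hIA : ∀ i ∈ A, ∀ j ∈ A, edgeBinomial k i j ∈ I)
    (hI : I ≤ Ideal.span {f | ∃ i j, f = edgeBinomial k i j ∧
      (i = v ∨ j = v ∨ (i ∈ A ∧ j ∈ A))}) {c w : V} (hc : c ∈ A) (hwv : w ≠ v) (hwA : w ∉ A) :
    proportionalIdeal k r A {v} c ∈ I.minimalPrimes := by
  have hcv : c ∉ ({v} : Finset V) := by
    rw [Finset.mem_singleton]; rintro rfl; exact hvA hc
  have hv := X_mem_proportionalIdeal (k := k) (r := r) (B := A) (c := c)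
    (Finset.mem_singleton_self v)
  refine proportionalIdeal_mem_minimalPrimes hcv (hI.trans ?_) ?_
  · rw [Ideal.span_le]
    rintro _ ⟨i, j, rfl, rfl | rfl | ⟨hi, hj⟩⟩
    · exact sub_mem (Ideal.mul_mem_right _ _ hv.1) (Ideal.mul_mem_left _ _ hv.2)
    · exact sub_mem (Ideal.mul_mem_left _ _ hv.2) (Ideal.mul_mem_right _ _ hv.1)
    · exact edgeBinomial_mem_proportionalIdeal hr (Finset.disjoint_singleton_right.2 hvA) hc hi hj
  · refine fun p hp hIp hle => ⟨fun j hj => hIp (hIA c hc j hj), fun j hj => ?_⟩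
    obtain rfl := Finset.mem_singleton.1 hj
    have hcw : edgeBinomial k c w ∉ p := fun h =>
      edgeBinomial_notMem_proportionalIdeal hcv (by rintro rfl; exact hwA hc) hwA
        (by simpa using hwv) (hle h)
    refine ⟨(hp.mem_or_mem ?_).resolve_right hcw, (hp.mem_or_mem ?_).resolve_right hcw⟩
    · rw [X_inl_mul_edgeBinomial]
      exact sub_mem (Ideal.mul_mem_left _ _ (hIp (hIv w))) (Ideal.mul_mem_left _ _ (hIp (hIv c)))
    · rw [X_inr_mul_edgeBinomial]
      exact sub_mem (Ideal.mul_mem_left _ _ (hIp (hIv w))) (Ideal.mul_mem_left _ _ (hIp (hIv c)))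

variable [Fintype V]

lemma weight_vanishingOrder_univ_le {c : V} (hA : ∀ w, w ≠ v → w ∈ A) (μ : V ⊕ V →₀ ℕ) :
    Finsupp.weight (vanishingOrder r Finset.univ ∅ c) μ ≤
      Finsupp.weight (vanishingOrder r A {v} c) μ := by
  simp only [Finsupp.weight_eq_sum]
  refine Finset.sum_le_sum fun t _ => Nat.mul_le_mul_left _ ?_
  rcases t with u | u <;> simp only [vanishingOrder] <;> grind

lemma proportionalIdeal_univ_mem_minimalPrimes (hr : Function.Injective r)
    (hIv : ∀ j, edgeBinomial k v j ∈ I)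
    (hI : I ≤ Ideal.span (Set.range fun e : V × V => edgeBinomial k e.1 e.2)) (c : V) :
    proportionalIdeal k r Finset.univ ∅ c ∈ I.minimalPrimes := by
  refine proportionalIdeal_mem_minimalPrimes (Finset.notMem_empty c) (hI.trans ?_) ?_
  · rw [Ideal.span_le]
    rintro _ ⟨⟨i, j⟩, rfl⟩
    exact edgeBinomial_mem_proportionalIdeal hr (Finset.disjoint_empty_right _)
      (Finset.mem_univ c) (Finset.mem_univ i) (Finset.mem_univ j)
  · refine fun p hp hIp hle => ⟨fun j _ => ?_, fun j hj => absurd hj (Finset.notMem_empty j)⟩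
    refine (hp.mem_or_mem ?_).resolve_left fun h =>
      X_inl_notMem_proportionalIdeal (Finset.notMem_empty v) (hle h)
    rw [X_inl_mul_edgeBinomial]
    exact sub_mem (Ideal.mul_mem_left _ _ (hIp (hIv j))) (Ideal.mul_mem_left _ _ (hIp (hIv c)))

lemma mem_of_forall_exists_hasLeadingExponent {I J : Ideal (MvPolynomial (V ⊕ V) k)}
    (hIJ : I ≤ J)
    (h : ∀ f ∈ J, ∀ μ, coeff μ f ≠ 0 → (∀ ν ∈ f.support,
      Finsupp.weight (rankWeight r) ν ≤ Finsupp.weight (rankWeight r) μ) →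
        ∃ g ∈ I, HasLeadingExponent (Finsupp.weight (rankWeight r)) g μ) : J ≤ I := by
  suffices H : ∀ (N : ℕ), ∀ f ∈ J,
      (∀ ν ∈ f.support, Finsupp.weight (rankWeight r) ν < N) → f ∈ I by
    intro f hf
    refine H (f.support.sup fun ν => (Finsupp.weight (rankWeight r) ν + 1).toNat) f hf
      fun ν hν => ?_
    have : (Finsupp.weight (rankWeight r) ν + 1).toNat ≤
        f.support.sup fun ν => (Finsupp.weight (rankWeight r) ν + 1).toNat :=
      Finset.le_sup (f := fun ν => (Finsupp.weight (rankWeight r) ν + 1).toNat) hν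
    omega
  intro N
  induction N with
  | zero =>
    intro f _ hlt
    have : f = 0 := by
      rw [← support_eq_empty, Finset.eq_empty_iff_forall_notMem]
      exact fun ν hν => absurd (weight_rankWeight_nonneg ν) (not_le.2 (hlt ν hν))
    exact this ▸ zero_mem I
  | succ N ih =>
    intro f hf hlt
    let T := f.support.filter fun ν => Finsupp.weight (rankWeight r) ν = N
    have hT : ∀ μ, ∃ g ∈ I, μ ∈ T → HasLeadingExponent (Finsupp.weight (rankWeight r)) g μ := by
      intro μ
      by_cases hμ : μ ∈ T
      · obtain ⟨hμf, hμN⟩ := Finset.mem_filter.1 hμ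
        obtain ⟨g, hg, hlead⟩ := h f hf μ (mem_support_iff.1 hμf) fun ν hν => by
          have := hlt ν hν
          push_cast at this
          omega
        exact ⟨g, hg, fun _ => hlead⟩
      · exact ⟨0, zero_mem I, fun h => absurd h hμ⟩
    choose g hgI hg using hT
    have hsum : ∑ μ ∈ T, C (coeff μ f) * g μ ∈ I :=
      sum_mem fun μ _ => Ideal.mul_mem_left _ _ (hgI μ)
    refine (Submodule.sub_mem_iff_left I hsum).1 (ih _ (sub_mem hf (hIJ hsum)) fun ν hν => ?_)
    by_contra! hN
    have hgν : ∀ μ ∈ T, coeff ν (g μ) = if μ = ν then 1 else 0 := by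
      intro μ hμ
      split_ifs with hμν
      · exact hμν ▸ (hg μ hμ).1
      · by_contra hne
        rcases (hg μ hμ).2 ν hne with rfl | hlt'
        · exact hμν rfl
        · rw [(Finset.mem_filter.1 hμ).2] at hlt'
          omega
    refine mem_support_iff.1 hν ?_
    rw [coeff_sub, coeff_sum, Finset.sum_congr rfl fun μ hμ => by rw [coeff_C_mul, hgν μ hμ]]
    simp only [mul_ite, mul_one, mul_zero, Finset.sum_ite_eq']
    split_ifs with hνT
    · exact sub_self _
    · rw [sub_zero]
      by_contra hne
      have hνf := mem_support_iff.2 hne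
      refine hνT (Finset.mem_filter.2 ⟨hνf, ?_⟩)
      have := hlt ν hνf
      push_cast at this
      omega

theorem pow_binomialEdgeIdeal_eq_symbolicPower {G : SimpleGraph V} (hr : Function.Injective r)
    (hv : r v = 0) (hvA : v ∉ A) (hdown : ∀ j ∈ A, ∀ u, u ≠ v → r u < r j → u ∈ A)
    (hA : ∀ w, w ≠ v → A.Nonempty)
    (hG : ∀ i j, G.Adj i j ↔ i ≠ j ∧ (i = v ∨ j = v ∨ (i ∈ A ∧ j ∈ A))) (s : ℕ) :
    binomialEdgeIdeal k G ^ s = symbolicPower (binomialEdgeIdeal k G) s := by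
  have hIv : ∀ j, edgeBinomial k v j ∈ binomialEdgeIdeal k G := fun j =>
    edgeBinomial_mem_binomialEdgeIdeal fun h => (hG v j).2 ⟨h, Or.inl rfl⟩
  have hIA : ∀ i ∈ A, ∀ j ∈ A, edgeBinomial k i j ∈ binomialEdgeIdeal k G := fun i hi j hj =>
    edgeBinomial_mem_binomialEdgeIdeal fun h => (hG i j).2 ⟨h, Or.inr (Or.inr ⟨hi, hj⟩)⟩
  refine le_antisymm (pow_le_symbolicPower _ s)
    (mem_of_forall_exists_hasLeadingExponent (r := r) (pow_le_symbolicPower _ s)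
      fun f hf μ hμ htop => ?_)
  have hC : ∀ c, s ≤ Finsupp.weight (vanishingOrder r Finset.univ ∅ c) μ := fun c =>
    le_weight_of_mem_symbolicPower (Finset.notMem_empty c)
      (proportionalIdeal_univ_mem_minimalPrimes hr hIv (Ideal.span_mono (by
        rintro _ ⟨i, j, -, rfl⟩; exact ⟨(i, j), rfl⟩)) c) hf hμ htop
  refine exists_mem_pow_hasLeadingExponent hv hvA hdown hA hIv hIA s μ hC fun c hc => ?_
  by_cases hw : ∀ w, w ≠ v → w ∈ A
  · exact (hC c).trans (weight_vanishingOrder_univ_le hw μ)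
  · push Not at hw
    obtain ⟨w, hwv, hwA⟩ := hw
    refine le_weight_of_mem_symbolicPower (by simpa using fun h : c = v => hvA (h ▸ hc))
      (proportionalIdeal_singleton_mem_minimalPrimes hr hvA hIv hIA (Ideal.span_mono ?_) hc hwv hwA)
      hf hμ htop
    rintro _ ⟨i, j, h, rfl⟩
    exact ⟨i, j, rfl, ((hG i j).1 h).2⟩

end SymbolicPower

/-- A ranking of the vertices of `completeWithWhiskers m t v`: first the vertex `v`, then the rest
of the complete graph, then the whiskers. -/
def whiskerRank {m t : ℕ} (v : Fin m) : Fin m ⊕ Fin t → ℕ :=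
  Sum.elim (fun a => if a = v then 0 else a + 1) fun w => m + 1 + w

lemma whiskerRank_injective {m t : ℕ} (v : Fin m) :
    Function.Injective (whiskerRank (t := t) v) := by
  rintro (a | a) (b | b) h <;> simp only [whiskerRank, Sum.elim_inl, Sum.elim_inr] at h
  · split_ifs at h with h₁ h₂ h₂
    · rw [h₁, h₂]
    · rw [Fin.ext (Nat.succ_injective h)]
  · split_ifs at h <;> omega
  · split_ifs at h <;> omega
  · rw [Fin.ext (Nat.add_left_cancel h)]

/-- Let `G` be obtained from the complete graph `K_m` (`m ≥ 1`) by attaching `t ≥ 0` whiskers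
to a single fixed vertex of `K_m`. Then `J_G ^ s = J_G ^ (s)` for every `s ≥ 1`. -/
theorem ordinary_eq_symbolic_of_completeWithWhiskers (k : Type) [Field k]
    (m t : ℕ) (hm : 1 ≤ m) (v : Fin m) :
    ∀ s : ℕ, 1 ≤ s →
      binomialEdgeIdeal k (completeWithWhiskers m t v) ^ s =
        symbolicPower (binomialEdgeIdeal k (completeWithWhiskers m t v)) s := by
  intro s _
  refine pow_binomialEdgeIdeal_eq_symbolicPower (r := whiskerRank v) (v := Sum.inl v)
    (A := Finset.univ.filter fun u => u ≠ Sum.inl v ∧ whiskerRank v u ≤ max m 2)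
    (whiskerRank_injective v) (by simp [whiskerRank]) (by simp) ?_ ?_ ?_ s
  · intro j hj u hu hlt
    simp only [Finset.mem_filter, Finset.mem_univ, true_and] at hj ⊢
    exact ⟨hu, hlt.le.trans hj.2⟩
  · rintro (a | w) hw
    · exact ⟨Sum.inl a, by simp_all [whiskerRank]⟩
    · by_cases hm2 : m = 1
      · subst hm2
        exact ⟨Sum.inr ⟨0, w.pos⟩, by simp [whiskerRank]⟩
      · obtain ⟨a, ha⟩ : ∃ a : Fin m, a ≠ v := by
          have : Nontrivial (Fin m) := Fin.nontrivial_iff_two_le.2 (by omega)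
          exact exists_ne v
        exact ⟨Sum.inl a, by simp [whiskerRank, ha]⟩
  · rintro (a | a) (b | b) <;>
      simp [completeWithWhiskers, whiskerRank]
    · intro _
      by_cases ha : a = v
      · exact Or.inl ha
      · by_cases hb : b = v
        · exact Or.inr (Or.inl hb)
        · simp [ha, hb]
    · intro h₁ _ h₂
      have := Fin.val_ne_of_ne h₁
      omega
    · intro h₁ h₂ _
      have := Fin.val_ne_of_ne h₂
      omega
    · intro h₁ h₂
      have := Fin.val_ne_of_ne h₁
      omega
end

section
/- Let G be a generalized caterpillar graph that is net-free. Then J_G^i = J_G^(i) for every integer i ≥ 1. -/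
open MvPolynomial

/-- A graph `G` is weakly closed if its vertices admit a labelling by `1, …, n` such that
for all `i < j < k`, if `{i, k}` is an edge then `{i, j}` or `{j, k}` is an edge. -/
def WeaklyClosed {V : Type} [Fintype V] (G : SimpleGraph V) : Prop :=
  ∃ f : V ≃ Fin (Fintype.card V), ∀ a b c : V,
    f a < f b → f b < f c → G.Adj a c → G.Adj a b ∨ G.Adj b c

/-- The net: the graph on six vertices obtained from the triangle `{0, 1, 2}` by attaching
the pendant vertices `3, 4, 5` to `0, 1, 2` respectively. -/
def netGraph : SimpleGraph (Fin 6) :=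
  SimpleGraph.fromRel fun a b =>
    (a = 0 ∧ b = 1) ∨ (a = 1 ∧ b = 2) ∨ (a = 0 ∧ b = 2) ∨
    (a = 0 ∧ b = 3) ∨ (a = 1 ∧ b = 4) ∨ (a = 2 ∧ b = 5)

/-- A graph is net-free if it has no induced subgraph isomorphic to the net, i.e. there is
no graph embedding (induced subgraph embedding) of the net into it. -/
def NetFree {V : Type} (G : SimpleGraph V) : Prop := IsEmpty (netGraph ↪g G)

/-- Auxiliary relation for the construction of a generalized caterpillar graph from a
caterpillar tree `H` with central path `p`: the clique vertices `c : C` are attached to the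
edge `{p.getVert (g c), p.getVert (g c + 1)}` of the path (clique joins via pairwise distinct
edges of `p` correspond to the fibers of `g`), and the whisker vertices `w : W` are pendant
vertices attached to `f w`. -/
def genCatRel {V₀ C W : Type} (H : SimpleGraph V₀) {u v : V₀} (p : H.Walk u v)
    (g : C → ℕ) (f : W → V₀ ⊕ C) : (V₀ ⊕ C) ⊕ W → (V₀ ⊕ C) ⊕ W → Prop
  | .inl (.inl a), .inl (.inl b) => H.Adj a b
  | .inl (.inl a), .inl (.inr c) => a = p.getVert (g c) ∨ a = p.getVert (g c + 1)
  | .inl (.inr c), .inl (.inr c') => g c = g c'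
  | .inr w, .inl z => z = f w
  | _, _ => False

/-- The graph obtained from a caterpillar tree `H` with central path `p` by clique joins of
complete graphs via (pairwise distinct) edges of `p` and adding whiskers: two vertices are
adjacent iff they are distinct and related by `genCatRel`. -/
def genCatGraph {V₀ C W : Type} (H : SimpleGraph V₀) {u v : V₀} (p : H.Walk u v)
    (g : C → ℕ) (f : W → V₀ ⊕ C) : SimpleGraph ((V₀ ⊕ C) ⊕ W) :=
  SimpleGraph.fromRel (genCatRel H p g f)

/-- A generalized caterpillar graph: a graph obtained from a caterpillar tree `H` with a
central path `p` (a path such that every vertex of `H` is on `p` or adjacent to a vertex of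
`p`) by successively performing clique joins of complete graphs via pairwise distinct edges
of `p` (encoded by `g : C → ℕ` sending each new clique vertex to the index of its path edge),
and finally possibly adding whiskers to some vertices (encoded by `f : W → V₀ ⊕ C`). -/
def IsGeneralizedCaterpillar {V : Type} (G : SimpleGraph V) : Prop :=
  ∃ (V₀ C W : Type) (_ : Fintype V₀) (_ : Fintype C) (_ : Fintype W)
    (H : SimpleGraph V₀) (u v : V₀) (p : H.Walk u v)
    (g : C → ℕ) (f : W → V₀ ⊕ C),
    H.IsTree ∧ p.IsPath ∧
    (∀ z : V₀, z ∈ p.support ∨ ∃ y ∈ p.support, H.Adj z y) ∧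
    (∀ c, g c < p.length) ∧
    Nonempty (G ≃g genCatGraph H p g f)

namespace BinomialEdge

set_option linter.unusedSectionVars false
set_option linter.unusedSimpArgs false

section

variable {V K : Type} [Field K]

/-- The coordinate `x_v`. -/
noncomputable def xv (K : Type) [Field K] (v : V) : MvPolynomial (V ⊕ V) K := X (Sum.inl v)

/-- The coordinate `y_v`. -/
noncomputable def yv (K : Type) [Field K] (v : V) : MvPolynomial (V ⊕ V) K := X (Sum.inr v)

/-- The linear form `x_v - c y_v`, cutting out the direction `(c : 1)` at the vertex `v`. -/
noncomputable def lin (c : K) (v : V) : MvPolynomial (V ⊕ V) K := xv K v - C c * yv K v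

/-- The binomial edge ideal of the subgraph induced on `W`. -/
noncomputable def edgeIdeal (K : Type) [Field K] (G : SimpleGraph V) (W : Finset V) :
    Ideal (MvPolynomial (V ⊕ V) K) :=
  Ideal.span {f | ∃ i ∈ W, ∃ j ∈ W, G.Adj i j ∧ f = xv K i * yv K j - xv K j * yv K i}

/-- The ideal generated by the forms `x_v - c y_v` for `v ∈ B`, where `e = (B, c)`. -/
noncomputable def linIdeal (e : Finset V × K) : Ideal (MvPolynomial (V ⊕ V) K) :=
  Ideal.span {f | ∃ v ∈ e.1, f = lin e.2 v}

/-- The sum of all products of distinct members of the list `linIdeal e`, `e ∈ L`, with the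
complementary power of the edge ideal, of total order `n`. -/
noncomputable def mixedPower (G : SimpleGraph V) (W : Finset V) :
    ℕ → List (Finset V × K) → Ideal (MvPolynomial (V ⊕ V) K)
  | n, [] => edgeIdeal K G W ^ n
  | n, e :: L => mixedPower G W n L ⊔ linIdeal e * mixedPower G W (n - 1) L

open Classical in
/-- The substitution along an arc `ε ↦ p + ε q` through a point of the stratum given by the
labelling `κ`: vertices of `W` labelled `none` start at the origin, those labelled `some c` start
at a point of the line of direction `(c : 1)`; vertices outside `W` stay put. -/
noncomputable def arc (W : Finset V) (κ : V → Option K) :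
    MvPolynomial (V ⊕ V) K →+* Polynomial (MvPolynomial (V ⊕ V) K) :=
  eval₂Hom (Polynomial.C.comp C) (Sum.elim
    (fun v => if v ∈ W then
        (match κ v with
          | none => Polynomial.X * Polynomial.C (xv K v)
          | some c => Polynomial.C (C c * yv K v) + Polynomial.X * Polynomial.C (xv K v))
      else Polynomial.C (xv K v))
    (fun v => if v ∈ W then
        (match κ v with
          | none => Polynomial.X * Polynomial.C (yv K v)
          | some _ => Polynomial.C (yv K v))
      else Polynomial.C (yv K v)))

lemma arc_xv_none {W : Finset V} {κ : V → Option K} {v : V} (hv : v ∈ W) (h : κ v = none) :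
    arc W κ (xv K v) = Polynomial.X * Polynomial.C (xv K v) := by
  rw [arc, xv, eval₂Hom_X']; simp [hv, h, xv]

lemma arc_yv_none {W : Finset V} {κ : V → Option K} {v : V} (hv : v ∈ W) (h : κ v = none) :
    arc W κ (yv K v) = Polynomial.X * Polynomial.C (yv K v) := by
  rw [arc, yv, eval₂Hom_X']; simp [hv, h, yv]

lemma arc_xv_some {W : Finset V} {κ : V → Option K} {v : V} {c : K} (hv : v ∈ W)
    (h : κ v = some c) :
    arc W κ (xv K v) =
      Polynomial.C (C c * yv K v) + Polynomial.X * Polynomial.C (xv K v) := by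
  rw [arc, xv, eval₂Hom_X']; simp [hv, h, xv]

lemma arc_yv_some {W : Finset V} {κ : V → Option K} {v : V} {c : K} (hv : v ∈ W)
    (h : κ v = some c) :
    arc W κ (yv K v) = Polynomial.C (yv K v) := by
  rw [arc, yv, eval₂Hom_X']; simp [hv, h, yv]

lemma arc_xv_of_notMem {W : Finset V} {κ : V → Option K} {v : V} (hv : v ∉ W) :
    arc W κ (xv K v) = Polynomial.C (xv K v) := by
  rw [arc, xv, eval₂Hom_X']; simp [hv, xv]

lemma arc_yv_of_notMem {W : Finset V} {κ : V → Option K} {v : V} (hv : v ∉ W) :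
    arc W κ (yv K v) = Polynomial.C (yv K v) := by
  rw [arc, yv, eval₂Hom_X']; simp [hv, yv]

lemma arc_C (W : Finset V) (κ : V → Option K) (c : K) :
    arc W κ (C c) = Polynomial.C (C c) := by
  rw [arc, eval₂Hom_C]; rfl

lemma arc_lin_some {W : Finset V} {κ : V → Option K} {v : V} {c d : K} (hv : v ∈ W)
    (h : κ v = some c) :
    arc W κ (lin d v) =
      Polynomial.C (C (c - d) * yv K v) + Polynomial.X * Polynomial.C (xv K v) := by
  rw [lin, map_sub, map_mul, arc_C, arc_xv_some hv h, arc_yv_some hv h]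
  simp only [map_mul, map_sub]; ring

lemma arc_lin_none {W : Finset V} {κ : V → Option K} {v : V} {d : K} (hv : v ∈ W)
    (h : κ v = none) :
    arc W κ (lin d v) = Polynomial.X * Polynomial.C (lin d v) := by
  rw [lin, map_sub, map_mul, arc_C, arc_xv_none hv h, arc_yv_none hv h]
  simp only [map_mul, map_sub]; ring

lemma ringHom_ext_vertex {R : Type} [Semiring R] {φ ψ : MvPolynomial (V ⊕ V) K →+* R}
    (hC : ∀ c, φ (C c) = ψ (C c)) (hx : ∀ v, φ (xv K v) = ψ (xv K v))
    (hy : ∀ v, φ (yv K v) = ψ (yv K v)) : φ = ψ := by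
  apply MvPolynomial.ringHom_ext hC
  rintro (v | v)
  · exact hx v
  · exact hy v

/-- A labelling is admissible when adjacent vertices of `W` off the origin share a direction. -/
def Admissible (G : SimpleGraph V) (W : Finset V) (κ : V → Option K) : Prop :=
  ∀ u ∈ W, ∀ v ∈ W, G.Adj u v → ∀ c d, κ u = some c → κ v = some d → c = d

/-- `(B, c)` is counted by `κ` when some vertex of `B` has a direction other than `c`. -/
def Counted (κ : V → Option K) (e : Finset V × K) : Prop :=
  ∃ v ∈ e.1, ∃ c, κ v = some c ∧ c ≠ e.2

open Classical in
/-- The number of members of `L` counted by `κ`. -/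
noncomputable def cnt (κ : V → Option K) (L : List (Finset V × K)) : ℕ :=
  L.countP (fun e => decide (Counted κ e))

/-- The order conditions satisfied by the elements of `mixedPower G W n L`. -/
def OrderCond (G : SimpleGraph V) (W : Finset V) (n : ℕ) (L : List (Finset V × K))
    (f : MvPolynomial (V ⊕ V) K) : Prop :=
  ∀ κ : V → Option K, Admissible G W κ →
    (Polynomial.X : Polynomial (MvPolynomial (V ⊕ V) K)) ^ n ∣ Polynomial.X ^ cnt κ L * arc W κ f

lemma cnt_cons_pos {κ : V → Option K} {e : Finset V × K} {L : List (Finset V × K)}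
    (h : Counted κ e) : cnt κ (e :: L) = cnt κ L + 1 := by
  simp [cnt, h]

lemma cnt_cons_neg {κ : V → Option K} {e : Finset V × K} {L : List (Finset V × K)}
    (h : ¬ Counted κ e) : cnt κ (e :: L) = cnt κ L := by
  simp [cnt, h]

lemma cnt_congr {κ κ' : V → Option K} {L : List (Finset V × K)}
    (h : ∀ e ∈ L, Counted κ e ↔ Counted κ' e) : cnt κ L = cnt κ' L := by
  classical
  exact List.countP_congr (fun e he => by simpa using h e he)

lemma cnt_perm (κ : V → Option K) {L L' : List (Finset V × K)} (h : L.Perm L') :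
    cnt κ L = cnt κ L' := h.countP_eq _

lemma mixedPower_zero (G : SimpleGraph V) (W : Finset V) (L : List (Finset V × K)) :
    mixedPower G W 0 L = ⊤ := by
  induction L with
  | nil => simp [mixedPower]
  | cons e L ih => simp [mixedPower, ih]

lemma mixedPower_perm (G : SimpleGraph V) (W : Finset V) {L L' : List (Finset V × K)}
    (h : L.Perm L') (n : ℕ) : mixedPower G W n L = mixedPower G W n L' := by
  induction h generalizing n with
  | nil => rfl
  | cons e _ ih => simp only [mixedPower, ih]
  | swap e e' L =>
    simp only [mixedPower, Ideal.mul_sup, ← mul_assoc, mul_comm (linIdeal e') (linIdeal e)]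
    rw [sup_assoc, sup_assoc, sup_left_comm (linIdeal e' * _)]
  | trans _ _ ih₁ ih₂ => rw [ih₁, ih₂]

lemma mul_mem_mixedPower {G : SimpleGraph V} {W : Finset V} {L L' : List (Finset V × K)}
    {e : Finset V × K} {n : ℕ} (h : L.Perm (e :: L')) {a : V} (ha : a ∈ e.1)
    {f : MvPolynomial (V ⊕ V) K} (hf : f ∈ mixedPower G W (n - 1) L') :
    lin e.2 a * f ∈ mixedPower G W n L := by
  rw [mixedPower_perm G W h]
  exact Ideal.mem_sup_right (Ideal.mul_mem_mul (Ideal.subset_span ⟨a, ha, rfl⟩) hf)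

lemma arc_edge_dvd {G : SimpleGraph V} {W : Finset V} {κ : V → Option K}
    (hκ : Admissible G W κ) :
    (edgeIdeal K G W).map (arc W κ) ≤ Ideal.span {Polynomial.X} := by
  rw [edgeIdeal, Ideal.map_span, Ideal.span_le]
  rintro _ ⟨_, ⟨i, hi, j, hj, hij, rfl⟩, rfl⟩
  rw [SetLike.mem_coe, Ideal.mem_span_singleton, Polynomial.X_dvd_iff]
  rcases hki : κ i with _ | c
  · simp [arc_xv_none hi hki, arc_yv_none hi hki]
  · rcases hkj : κ j with _ | d
    · simp [arc_xv_none hj hkj, arc_yv_none hj hkj]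
    · obtain rfl := hκ i hi j hj hij c d hki hkj
      simp [arc_xv_some hi hki, arc_yv_some hi hki, arc_xv_some hj hkj, arc_yv_some hj hkj]
      ring

lemma arc_lin_dvd {W : Finset V} {κ : V → Option K}
    {e : Finset V × K} (he : e.1 ⊆ W) (h : ¬ Counted κ e) :
    (linIdeal e).map (arc W κ) ≤ Ideal.span {Polynomial.X} := by
  rw [linIdeal, Ideal.map_span, Ideal.span_le]
  rintro _ ⟨_, ⟨v, hv, rfl⟩, rfl⟩
  rw [SetLike.mem_coe, Ideal.mem_span_singleton, Polynomial.X_dvd_iff]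
  rcases hkv : κ v with _ | c
  · simp [arc_lin_none (he hv) hkv]
  · have : c = e.2 := by
      by_contra hc
      exact h ⟨v, hv, c, hkv, hc⟩
    simp [arc_lin_some (he hv) hkv, this]

lemma mem_mixedPower_cons {G : SimpleGraph V} {W : Finset V} {L : List (Finset V × K)}
    {e : Finset V × K} {n : ℕ} {f : MvPolynomial (V ⊕ V) K} :
    f ∈ mixedPower G W n (e :: L) ↔ ∃ p ∈ mixedPower G W n L,
      ∃ q ∈ linIdeal e * mixedPower G W (n - 1) L, p + q = f :=
  Submodule.mem_sup

lemma orderCond_of_mem {G : SimpleGraph V} {W : Finset V} {L : List (Finset V × K)}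
    (hL : ∀ e ∈ L, e.1 ⊆ W) {n : ℕ} {f : MvPolynomial (V ⊕ V) K}
    (hf : f ∈ mixedPower G W n L) : OrderCond G W n L f := by
  intro κ hκ
  induction L generalizing n f with
  | nil =>
    have h := Ideal.mem_map_of_mem (arc W κ) hf
    rw [mixedPower, Ideal.map_pow] at h
    have h' := Ideal.pow_right_mono (arc_edge_dvd hκ) n h
    rw [Ideal.span_singleton_pow, Ideal.mem_span_singleton] at h'
    exact h'.mul_left _
  | cons e L ih =>
    have ih' := @ih (fun e' he' => hL e' (List.mem_cons_of_mem _ he'))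
    obtain ⟨p, hp, q, hq, rfl⟩ := mem_mixedPower_cons.1 hf
    rw [map_add, mul_add]
    refine dvd_add ((ih' hp).trans (mul_dvd_mul_right (pow_dvd_pow _ ?_) _)) ?_
    · by_cases h : Counted κ e
      · rw [cnt_cons_pos h]; omega
      · rw [cnt_cons_neg h]
    · refine Submodule.mul_induction_on hq (fun r hr s hs => ?_) (fun r s hr hs => ?_)
      · refine (pow_dvd_pow _ (by omega : n ≤ n - 1 + 1)).trans ?_
        rw [map_mul, pow_succ']
        by_cases h : Counted κ e
        · rw [cnt_cons_pos h, pow_succ', mul_assoc]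
          refine mul_dvd_mul_left _ ((ih' hs).trans ?_)
          exact mul_dvd_mul_left _ (dvd_mul_left _ _)
        · rw [cnt_cons_neg h, mul_left_comm]
          exact mul_dvd_mul (Ideal.mem_span_singleton.1
            (arc_lin_dvd (hL e List.mem_cons_self) h (Ideal.mem_map_of_mem _ hr))) (ih' hs)
      · rw [map_add, mul_add]
        exact dvd_add hr hs

lemma OrderCond.sub {G : SimpleGraph V} {W : Finset V} {L : List (Finset V × K)} {n : ℕ}
    {f g : MvPolynomial (V ⊕ V) K} (hf : OrderCond G W n L f) (hg : OrderCond G W n L g) :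
    OrderCond G W n L (f - g) := fun κ hκ => by
  rw [map_sub, mul_sub]
  exact dvd_sub (hf κ hκ) (hg κ hκ)

end

section

variable {V K : Type} [Field K]

/-- Evaluation of polynomials at `t` along `φ`. -/
noncomputable def evalAt {R A : Type} [CommRing R] [CommRing A] (φ : R →+* A) (t : A) :
    Polynomial R →+* A :=
  Polynomial.eval₂RingHom φ t

lemma evalAt_C {R A : Type} [CommRing R] [CommRing A] (φ : R →+* A) (t : A) (r : R) :
    evalAt φ t (Polynomial.C r) = φ r := Polynomial.eval₂_C _ _

lemma evalAt_X {R A : Type} [CommRing R] [CommRing A] (φ : R →+* A) (t : A) :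
    evalAt φ t Polynomial.X = t := Polynomial.eval₂_X _ _

/-- The grading by the degree in the two variables at `a`, as a coaction. -/
noncomputable def grade (K : Type) [Field K] (a : V) :
    MvPolynomial (V ⊕ V) K →+* Polynomial (MvPolynomial (V ⊕ V) K) :=
  arc {a} (fun _ => none)

lemma grade_C (a : V) (c : K) : grade K a (C c) = Polynomial.C (C c) := arc_C _ _ _

lemma grade_xv_self (a : V) : grade K a (xv K a) = Polynomial.X * Polynomial.C (xv K a) :=
  arc_xv_none (by simp) rfl

lemma grade_yv_self (a : V) : grade K a (yv K a) = Polynomial.X * Polynomial.C (yv K a) :=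
  arc_yv_none (by simp) rfl

lemma grade_xv_ne {a v : V} (h : v ≠ a) : grade K a (xv K v) = Polynomial.C (xv K v) :=
  arc_xv_of_notMem (by simpa using h)

lemma grade_yv_ne {a v : V} (h : v ≠ a) : grade K a (yv K v) = Polynomial.C (yv K v) :=
  arc_yv_of_notMem (by simpa using h)

lemma grade_lin_self (a : V) (c : K) :
    grade K a (lin c a) = Polynomial.X * Polynomial.C (lin c a) :=
  arc_lin_none (by simp) rfl

lemma grade_lin_ne {a v : V} (h : v ≠ a) (c : K) :
    grade K a (lin c v) = Polynomial.C (lin c v) := by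
  rw [lin, map_sub, map_mul, grade_C, grade_xv_ne h, grade_yv_ne h, ← map_mul, ← map_sub]

/-- The homogeneous component of degree `d` in the variables at `a`. -/
noncomputable def comp (a : V) (d : ℕ) (f : MvPolynomial (V ⊕ V) K) : MvPolynomial (V ⊕ V) K :=
  (grade K a f).coeff d

/-- Homogeneity of degree `d` in the variables at `a`. -/
def IsHom (a : V) (d : ℕ) (f : MvPolynomial (V ⊕ V) K) : Prop :=
  grade K a f = Polynomial.C f * Polynomial.X ^ d

lemma IsHom.comp_eq {a : V} {d : ℕ} {f : MvPolynomial (V ⊕ V) K} (h : IsHom a d f) :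
    comp a d f = f := by
  rw [comp, h]; simp

lemma comp_sub (a : V) (d : ℕ) (f g : MvPolynomial (V ⊕ V) K) :
    comp a d (f - g) = comp a d f - comp a d g := by simp [comp]

lemma eval_one_grade (a : V) (f : MvPolynomial (V ⊕ V) K) : (grade K a f).eval 1 = f := by
  have : (Polynomial.evalRingHom 1).comp (grade K a) =
      RingHom.id (MvPolynomial (V ⊕ V) K) := by
    apply ringHom_ext_vertex
    · intro c; simp [grade_C]
    · intro v
      by_cases h : v = a
      · subst h; simp [grade_xv_self]
      · simp [grade_xv_ne h]
    · intro v
      by_cases h : v = a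
      · subst h; simp [grade_yv_self]
      · simp [grade_yv_ne h]
  exact congrArg (fun φ => φ f) this

lemma mem_of_comp_mem {a : V} {I : Ideal (MvPolynomial (V ⊕ V) K)} {f : MvPolynomial (V ⊕ V) K}
    (h : ∀ d, comp a d f ∈ I) : f ∈ I := by
  rw [← eval_one_grade a f, Polynomial.eval_eq_sum_range]
  exact Ideal.sum_mem _ (fun d _ => Ideal.mul_mem_right _ _ (h d))

lemma coeff_eval₂_C_X_mul_X {R : Type} [CommRing R] (p : Polynomial R) (d : ℕ) :
    (p.eval₂ (Polynomial.C.comp Polynomial.C)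
      (Polynomial.C Polynomial.X * Polynomial.X : Polynomial (Polynomial R))).coeff d =
      Polynomial.C (p.coeff d) * Polynomial.X ^ d := by
  induction p using Polynomial.induction_on' with
  | add p q hp hq => simp only [Polynomial.eval₂_add, Polynomial.coeff_add, hp, hq, map_add, add_mul]
  | monomial n r =>
    rw [Polynomial.eval₂_monomial, mul_pow, RingHom.comp_apply, ← mul_assoc, ← Polynomial.C_pow,
      ← Polynomial.C_mul, Polynomial.coeff_C_mul_X_pow, Polynomial.coeff_monomial]
    by_cases h : d = n
    · subst h; simp
    · rw [if_neg h, if_neg (Ne.symm h)]; simp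

lemma isHom_comp (a : V) (d : ℕ) (f : MvPolynomial (V ⊕ V) K) : IsHom a d (comp a d f) := by
  have : (Polynomial.mapRingHom (grade K a)).comp (grade K a) =
      (Polynomial.eval₂RingHom (Polynomial.C.comp Polynomial.C)
        (Polynomial.C Polynomial.X * Polynomial.X :
          Polynomial (Polynomial (MvPolynomial (V ⊕ V) K)))).comp (grade K a) := by
    apply ringHom_ext_vertex
    · intro c; simp [grade_C]
    · intro v
      by_cases h : v = a
      · subst h; simp [grade_xv_self]; ring
      · simp [grade_xv_ne h]
    · intro v
      by_cases h : v = a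
      · subst h; simp [grade_yv_self]; ring
      · simp [grade_yv_ne h]
  have h := congrArg (fun φ => (φ f).coeff d) this
  simp only [RingHom.comp_apply, Polynomial.coe_mapRingHom, Polynomial.coeff_map,
    Polynomial.coe_eval₂RingHom, coeff_eval₂_C_X_mul_X] at h
  exact h

lemma IsHom.sub {a : V} {d : ℕ} {f g : MvPolynomial (V ⊕ V) K} (hf : IsHom a d f)
    (hg : IsHom a d g) : IsHom a d (f - g) := by
  rw [IsHom, map_sub, hf, hg, map_sub, sub_mul]

lemma lin_ne_zero (c : K) (v : V) : lin c v ≠ 0 := by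
  intro h
  have h' := congrArg (MvPolynomial.eval (Sum.elim (fun _ => (1 : K)) (fun _ => 0))) h
  simp [lin, xv, yv] at h'

lemma IsHom.of_lin_mul {a : V} {d : ℕ} {c : K} {f : MvPolynomial (V ⊕ V) K}
    (h : IsHom a d (lin c a * f)) : f = 0 ∨ ∃ d', d = d' + 1 ∧ IsHom a d' f := by
  rw [IsHom, map_mul, grade_lin_self, map_mul, mul_assoc, mul_assoc, mul_left_comm] at h
  have h0 : (Polynomial.C (lin c a) : Polynomial (MvPolynomial (V ⊕ V) K)) ≠ 0 := by
    simpa using lin_ne_zero c a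
  have h1 := mul_left_cancel₀ h0 h
  rcases d with _ | d
  · left
    have h2 := congrArg (Polynomial.coeff · 0) h1
    simpa using h2.symm
  · right
    refine ⟨d, rfl, ?_⟩
    rw [pow_succ', mul_left_comm] at h1
    exact mul_left_cancel₀ Polynomial.X_ne_zero h1

lemma OrderCond.comp {G : SimpleGraph V} {W : Finset V} {L : List (Finset V × K)} {n : ℕ}
    {f : MvPolynomial (V ⊕ V) K} (hf : OrderCond G W n L f) (a : V) (d : ℕ) :
    OrderCond G W n L (comp a d f) := by
  intro κ hκ
  have : (Polynomial.mapRingHom (arc W κ)).comp (grade K a) =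
      (evalAt ((Polynomial.mapRingHom Polynomial.C).comp (grade K a))
        (Polynomial.C Polynomial.X :
          Polynomial (Polynomial (MvPolynomial (V ⊕ V) K)))).comp (arc W κ) := by
    apply ringHom_ext_vertex
    · intro c; simp [evalAt_C, evalAt_X, grade_C, arc_C]
    · intro v
      by_cases hv : v ∈ W
      · rcases hk : κ v with _ | c
        · by_cases h : v = a
          · subst h; simp [evalAt_C, evalAt_X, grade_xv_self, arc_xv_none hv hk]; ring
          · simp [evalAt_C, evalAt_X, grade_xv_ne h, arc_xv_none hv hk]
        · by_cases h : v = a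
          · subst h; simp [evalAt_C, evalAt_X, grade_xv_self, grade_yv_self, grade_C, arc_xv_some hv hk]; ring
          · simp [evalAt_C, evalAt_X, grade_xv_ne h, grade_yv_ne h, grade_C, arc_xv_some hv hk]
      · by_cases h : v = a
        · subst h; simp [evalAt_C, evalAt_X, grade_xv_self, arc_xv_of_notMem hv]
        · simp [evalAt_C, evalAt_X, grade_xv_ne h, arc_xv_of_notMem hv]
    · intro v
      by_cases hv : v ∈ W
      · rcases hk : κ v with _ | c
        · by_cases h : v = a
          · subst h; simp [evalAt_C, evalAt_X, grade_yv_self, arc_yv_none hv hk]; ring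
          · simp [evalAt_C, evalAt_X, grade_yv_ne h, arc_yv_none hv hk]
        · by_cases h : v = a
          · subst h; simp [evalAt_C, evalAt_X, grade_yv_self, arc_yv_some hv hk]
          · simp [evalAt_C, evalAt_X, grade_yv_ne h, arc_yv_some hv hk]
      · by_cases h : v = a
        · subst h; simp [evalAt_C, evalAt_X, grade_yv_self, arc_yv_of_notMem hv]
        · simp [evalAt_C, evalAt_X, grade_yv_ne h, arc_yv_of_notMem hv]
  have h := map_dvd (evalAt
    ((Polynomial.mapRingHom Polynomial.C).comp (grade K a))
    (Polynomial.C Polynomial.X : Polynomial (Polynomial (MvPolynomial (V ⊕ V) K)))) (hf κ hκ)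
  rw [map_mul, map_pow, map_pow, ← RingHom.comp_apply _ (arc W κ), ← this] at h
  simp only [evalAt_X, ← Polynomial.C_pow] at h
  have h' := Polynomial.C_dvd_iff_dvd_coeff _ _ |>.1 h d
  rw [Polynomial.coeff_C_mul] at h'
  simpa [BinomialEdge.comp] using h'

/-- An ideal stable under taking homogeneous components at `a`. -/
def Graded (a : V) (I : Ideal (MvPolynomial (V ⊕ V) K)) : Prop :=
  I.map (grade K a) ≤ I.map Polynomial.C

lemma Graded.sup {a : V} {I J : Ideal (MvPolynomial (V ⊕ V) K)} (hI : Graded a I)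
    (hJ : Graded a J) : Graded a (I ⊔ J) := by
  rw [Graded, Ideal.map_sup, Ideal.map_sup]
  exact sup_le_sup hI hJ

lemma Graded.mul {a : V} {I J : Ideal (MvPolynomial (V ⊕ V) K)} (hI : Graded a I)
    (hJ : Graded a J) : Graded a (I * J) := by
  rw [Graded, Ideal.map_mul, Ideal.map_mul]
  exact Ideal.mul_mono hI hJ

lemma Graded.pow {a : V} {I : Ideal (MvPolynomial (V ⊕ V) K)} (hI : Graded a I) (n : ℕ) :
    Graded a (I ^ n) := by
  rw [Graded, Ideal.map_pow, Ideal.map_pow]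
  exact Ideal.pow_right_mono hI n

lemma graded_span {a : V} {s : Set (MvPolynomial (V ⊕ V) K)}
    (h : ∀ f ∈ s, ∃ p, grade K a f = p * Polynomial.C f) : Graded a (Ideal.span s) := by
  rw [Graded, Ideal.map_span, Ideal.span_le]
  rintro _ ⟨f, hf, rfl⟩
  obtain ⟨p, hp⟩ := h f hf
  rw [hp]
  exact Ideal.mul_mem_left _ _ (Ideal.mem_map_of_mem _ (Ideal.subset_span hf))

lemma Graded.comp_mem {a : V} {I : Ideal (MvPolynomial (V ⊕ V) K)} (hI : Graded a I)
    {f : MvPolynomial (V ⊕ V) K} (hf : f ∈ I) (d : ℕ) : comp a d f ∈ I :=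
  Ideal.mem_map_C_iff.1 (hI (Ideal.mem_map_of_mem _ hf)) d

lemma graded_edgeIdeal (G : SimpleGraph V) (W : Finset V) (a : V) :
    Graded a (edgeIdeal K G W) := by
  apply graded_span
  rintro _ ⟨i, hi, j, hj, hij, rfl⟩
  by_cases h : i = a
  · have h' : j ≠ a := fun e => hij.ne (h.trans e.symm)
    subst h
    refine ⟨Polynomial.X, ?_⟩
    simp only [map_sub, map_mul, grade_xv_self, grade_yv_self, grade_xv_ne h', grade_yv_ne h']
    ring
  · by_cases h' : j = a
    · subst h'
      refine ⟨Polynomial.X, ?_⟩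
      simp only [map_sub, map_mul, grade_xv_self, grade_yv_self, grade_xv_ne h, grade_yv_ne h]
      ring
    · refine ⟨1, ?_⟩
      simp only [map_sub, map_mul, grade_xv_ne h', grade_yv_ne h', grade_xv_ne h, grade_yv_ne h]
      ring

lemma graded_linIdeal (e : Finset V × K) (a : V) : Graded a (linIdeal e) := by
  apply graded_span
  rintro _ ⟨v, hv, rfl⟩
  by_cases h : v = a
  · subst h
    exact ⟨Polynomial.X, grade_lin_self _ _⟩
  · exact ⟨1, by rw [grade_lin_ne h, one_mul]⟩

lemma graded_mixedPower (G : SimpleGraph V) (W : Finset V) (L : List (Finset V × K)) (n : ℕ)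
    (a : V) : Graded a (mixedPower G W n L) := by
  induction L generalizing n with
  | nil => exact (graded_edgeIdeal G W a).pow n
  | cons e L ih => exact (ih n).sup ((graded_linIdeal e a).mul (ih (n - 1)))

open Classical in
/-- The substitution `x_a ↦ p`, `y_a ↦ q`. -/
noncomputable def subst (a : V) (p q : MvPolynomial (V ⊕ V) K) :
    MvPolynomial (V ⊕ V) K →+* MvPolynomial (V ⊕ V) K :=
  eval₂Hom C (Sum.elim (fun v => if v = a then p else xv K v)
    (fun v => if v = a then q else yv K v))

section
variable (a : V) (p q : MvPolynomial (V ⊕ V) K)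

lemma subst_C (c : K) : subst a p q (C c) = C c := by rw [subst, eval₂Hom_C]

lemma subst_xv_self : subst a p q (xv K a) = p := by rw [subst, xv, eval₂Hom_X']; simp

lemma subst_yv_self : subst a p q (yv K a) = q := by rw [subst, yv, eval₂Hom_X']; simp

variable {a}

lemma subst_xv_ne {v : V} (h : v ≠ a) : subst a p q (xv K v) = xv K v := by
  rw [subst, xv, eval₂Hom_X']; simp [evalAt_C, evalAt_X, h, xv]

lemma subst_yv_ne {v : V} (h : v ≠ a) : subst a p q (yv K v) = yv K v := by
  rw [subst, yv, eval₂Hom_X']; simp [evalAt_C, evalAt_X, h, yv]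

end

lemma IsHom.sub_mem_span_lin {a : V} {d : ℕ} {f : MvPolynomial (V ⊕ V) K} (hf : IsHom a d f)
    (c : K) : f - yv K a ^ d * subst a (C c) 1 f ∈ Ideal.span {lin c a} := by
  have h₁ : (evalAt (subst a (C c) 1) (yv K a)).comp (grade K a) =
      subst a (C c * yv K a) (yv K a) := by
    apply ringHom_ext_vertex
    · intro c; simp [evalAt_C, evalAt_X, grade_C, subst_C]
    · intro v
      by_cases h : v = a
      · subst h; simp [evalAt_C, evalAt_X, grade_xv_self, subst_xv_self]
      · simp [evalAt_C, evalAt_X, grade_xv_ne h, subst_xv_ne _ _ h]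
    · intro v
      by_cases h : v = a
      · subst h; simp [evalAt_C, evalAt_X, grade_yv_self, subst_yv_self]
      · simp [evalAt_C, evalAt_X, grade_yv_ne h, subst_yv_ne _ _ h]
  have h₂ : (Ideal.Quotient.mk (Ideal.span {lin c a})).comp
      (subst a (C c * yv K a) (yv K a)) = Ideal.Quotient.mk (Ideal.span {lin c a}) := by
    apply ringHom_ext_vertex
    · intro c; simp [subst_C]
    · intro v
      by_cases h : v = a
      · subst h
        rw [RingHom.comp_apply, subst_xv_self, eq_comm, Ideal.Quotient.mk_eq_mk_iff_sub_mem]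
        exact Ideal.mem_span_singleton_self _
      · simp [evalAt_C, evalAt_X, subst_xv_ne _ _ h]
    · intro v
      by_cases h : v = a
      · subst h; simp [evalAt_C, evalAt_X, subst_yv_self]
      · simp [evalAt_C, evalAt_X, subst_yv_ne _ _ h]
  have h₃ := congrArg (fun φ => φ f) h₁
  rw [IsHom] at hf
  simp only [RingHom.comp_apply, hf, map_mul, map_pow, evalAt_C, evalAt_X] at h₃
  rw [mul_comm, h₃, ← Ideal.Quotient.mk_eq_mk_iff_sub_mem]
  exact (congrArg (fun φ => φ f) h₂).symm

end

section

variable {V K : Type} [Field K] [DecidableEq V]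

/-- The members of `L` at `a` with a direction other than `c`. -/
def Dropped (a : V) (c : K) (e : Finset V × K) : Prop := a ∈ e.1 ∧ e.2 ≠ c

open Classical in
/-- The members of `L` that are not dropped, with the vertex `a` removed. -/
noncomputable def kept (a : V) (c : K) (L : List (Finset V × K)) : List (Finset V × K) :=
  (L.filter (fun e => decide (¬ Dropped a c e))).map (fun e => (e.1.erase a, e.2))

open Classical in
/-- The number of dropped members of `L`. -/
noncomputable def dropCount (a : V) (c : K) (L : List (Finset V × K)) : ℕ :=
  L.countP (fun e => decide (Dropped a c e))

lemma kept_cons_pos {a : V} {c : K} {e : Finset V × K} {L : List (Finset V × K)}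
    (h : Dropped a c e) : kept a c (e :: L) = kept a c L := by
  simp [kept, h]

lemma kept_cons_neg {a : V} {c : K} {e : Finset V × K} {L : List (Finset V × K)}
    (h : ¬ Dropped a c e) : kept a c (e :: L) = (e.1.erase a, e.2) :: kept a c L := by
  simp [kept, h]

lemma dropCount_cons_pos {a : V} {c : K} {e : Finset V × K} {L : List (Finset V × K)}
    (h : Dropped a c e) : dropCount a c (e :: L) = dropCount a c L + 1 := by
  simp [dropCount, h]

lemma dropCount_cons_neg {a : V} {c : K} {e : Finset V × K} {L : List (Finset V × K)}
    (h : ¬ Dropped a c e) : dropCount a c (e :: L) = dropCount a c L := by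
  simp [dropCount, h]

/-- The list of conditions left after restricting to the hyperplane `x_a = c y_a`
a form of degree `d` at `a`. -/
noncomputable def restricted (G : SimpleGraph V) [DecidableRel G.Adj] (W : Finset V) (a : V)
    (c : K) (d : ℕ) (L : List (Finset V × K)) : List (Finset V × K) :=
  kept a c L ++ List.replicate (d - min (dropCount a c L) d) ((W.erase a).filter (G.Adj a), c)

lemma cnt_append (κ : V → Option K) (L L' : List (Finset V × K)) :
    cnt κ (L ++ L') = cnt κ L + cnt κ L' := by
  classical
  exact List.countP_append

lemma cnt_replicate_pos {κ : V → Option K} {e : Finset V × K} (h : Counted κ e) (m : ℕ) :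
    cnt κ (List.replicate m e) = m := by
  simp [cnt, List.countP_replicate, h]

lemma cnt_replicate_neg {κ : V → Option K} {e : Finset V × K} (h : ¬ Counted κ e) (m : ℕ) :
    cnt κ (List.replicate m e) = 0 := by
  simp [cnt, List.countP_replicate, h]

lemma cnt_update_none_le {a : V} {c : K} (κ : V → Option K) {L : List (Finset V × K)}
    (hL : ∀ e ∈ L, Dropped a c e → e.1 = {a}) :
    cnt (Function.update κ a none) L ≤ cnt κ (kept a c L) := by
  induction L with
  | nil => simp [kept, cnt]
  | cons e L ih =>
    have ih' := ih (fun e' he' => hL e' (List.mem_cons_of_mem _ he'))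
    by_cases h : Dropped a c e
    · rw [kept_cons_pos h, cnt_cons_neg]
      · exact ih'
      · rintro ⟨v, hv, c', hc', -⟩
        rw [hL e List.mem_cons_self h, Finset.mem_singleton] at hv
        simp [hv] at hc'
    · rw [kept_cons_neg h]
      by_cases h' : Counted (Function.update κ a none) e
      · rw [cnt_cons_pos h', cnt_cons_pos]
        · omega
        · obtain ⟨v, hv, c', hc', hne⟩ := h'
          have hva : v ≠ a := by rintro rfl; simp at hc'
          exact ⟨v, Finset.mem_erase.2 ⟨hva, hv⟩, c', by simpa [hva] using hc', hne⟩
      · rw [cnt_cons_neg h']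
        exact ih'.trans (by simp [cnt, List.countP_cons])

lemma cnt_update_some_le {a : V} {c : K} (κ : V → Option K) (L : List (Finset V × K)) :
    cnt (Function.update κ a (some c)) L ≤ cnt κ (kept a c L) + dropCount a c L := by
  induction L with
  | nil => simp [kept, cnt]
  | cons e L ih =>
    by_cases h : Dropped a c e
    · rw [kept_cons_pos h, dropCount_cons_pos h]
      refine le_trans (b := cnt (Function.update κ a (some c)) L + 1) ?_ (by omega)
      by_cases h' : Counted (Function.update κ a (some c)) e
      · rw [cnt_cons_pos h']
      · rw [cnt_cons_neg h']; omega
    · rw [kept_cons_neg h, dropCount_cons_neg h]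
      by_cases h' : Counted (Function.update κ a (some c)) e
      · rw [cnt_cons_pos h', cnt_cons_pos]
        · omega
        · obtain ⟨v, hv, c', hc', hne⟩ := h'
          have hva : v ≠ a := by
            rintro rfl
            simp only [Function.update_self, Option.some.injEq] at hc'
            exact h ⟨hv, fun e => hne (hc' ▸ e.symm)⟩
          exact ⟨v, Finset.mem_erase.2 ⟨hva, hv⟩, c', by simpa [hva] using hc', hne⟩
      · rw [cnt_cons_neg h']
        exact ih.trans (Nat.add_le_add_right (by simp [cnt, List.countP_cons]) _)

lemma arc_update_none {W : Finset V} {a : V} (ha : a ∈ W) (κ : V → Option K) {d : ℕ}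
    {f : MvPolynomial (V ⊕ V) K} (hf : IsHom a d f) :
    arc W (Function.update κ a none) f = Polynomial.X ^ d * arc (W.erase a) κ f := by
  have : arc W (Function.update κ a none) =
      (evalAt (arc (W.erase a) κ) Polynomial.X).comp (grade K a) := by
    apply ringHom_ext_vertex
    · intro c; simp [grade_C, arc_C, evalAt_C]
    · intro v
      by_cases h : v = a
      · subst h
        rw [arc_xv_none ha (by simp), RingHom.comp_apply, grade_xv_self, map_mul, evalAt_X,
          evalAt_C, arc_xv_of_notMem (by simp)]
      · rw [RingHom.comp_apply, grade_xv_ne h, evalAt_C]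
        by_cases hv : v ∈ W
        · rcases hk : κ v with _ | c
          · rw [arc_xv_none hv (by simpa [h] using hk), arc_xv_none (by simp [h, hv]) hk]
          · rw [arc_xv_some (c := c) hv (by simpa [h] using hk), arc_xv_some (by simp [h, hv]) hk]
        · rw [arc_xv_of_notMem hv, arc_xv_of_notMem (by simp [hv])]
    · intro v
      by_cases h : v = a
      · subst h
        rw [arc_yv_none ha (by simp), RingHom.comp_apply, grade_yv_self, map_mul, evalAt_X,
          evalAt_C, arc_yv_of_notMem (by simp)]
      · rw [RingHom.comp_apply, grade_yv_ne h, evalAt_C]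
        by_cases hv : v ∈ W
        · rcases hk : κ v with _ | c
          · rw [arc_yv_none hv (by simpa [h] using hk), arc_yv_none (by simp [h, hv]) hk]
          · rw [arc_yv_some (c := c) hv (by simpa [h] using hk), arc_yv_some (by simp [h, hv]) hk]
        · rw [arc_yv_of_notMem hv, arc_yv_of_notMem (by simp [hv])]
  rw [this, RingHom.comp_apply, hf, map_mul, map_pow, evalAt_X, evalAt_C, mul_comm]

lemma map_subst_arc_erase (W : Finset V) (a : V) (κ : V → Option K) (c : K)
    (f : MvPolynomial (V ⊕ V) K) :
    (arc (W.erase a) κ f).map (subst a (C c) 1) = arc (W.erase a) κ (subst a (C c) 1 f) := by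
  have : (Polynomial.mapRingHom (subst a (C c) 1)).comp (arc (W.erase a) κ) =
      (arc (W.erase a) κ).comp (subst a (C c) 1) := by
    apply ringHom_ext_vertex
    · intro c; simp [subst_C, arc_C]
    · intro v
      by_cases h : v = a
      · subst h
        simp [arc_xv_of_notMem, subst_xv_self, arc_C]
      · by_cases hv : v ∈ W
        · rcases hk : κ v with _ | c
          · simp [arc_xv_none (W := W.erase a) (by simp [h, hv]) hk, subst_xv_ne _ _ h]
          · simp [arc_xv_some (W := W.erase a) (by simp [h, hv]) hk, subst_xv_ne _ _ h,
              subst_yv_ne _ _ h, subst_C]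
        · simp [arc_xv_of_notMem (W := W.erase a) (v := v) (by simp [hv]), subst_xv_ne _ _ h]
    · intro v
      by_cases h : v = a
      · subst h
        simp [arc_yv_of_notMem, subst_yv_self]
      · by_cases hv : v ∈ W
        · rcases hk : κ v with _ | c
          · simp [arc_yv_none (W := W.erase a) (by simp [h, hv]) hk, subst_yv_ne _ _ h]
          · simp [arc_yv_some (W := W.erase a) (by simp [h, hv]) hk, subst_yv_ne _ _ h]
        · simp [arc_yv_of_notMem (W := W.erase a) (v := v) (by simp [hv]), subst_yv_ne _ _ h]
  exact congrArg (fun φ => φ f) this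

lemma map_subst_arc_update {W : Finset V} {a : V} (ha : a ∈ W) (κ : V → Option K) (c : K)
    (f : MvPolynomial (V ⊕ V) K) :
    (arc W (Function.update κ a (some c)) f).map (subst a 0 1) =
      arc (W.erase a) κ (subst a (C c) 1 f) := by
  have : (Polynomial.mapRingHom (subst a 0 1)).comp (arc W (Function.update κ a (some c))) =
      (arc (W.erase a) κ).comp (subst a (C c) 1) := by
    apply ringHom_ext_vertex
    · intro c; simp [subst_C, arc_C]
    · intro v
      by_cases h : v = a
      · subst h
        rw [RingHom.comp_apply, arc_xv_some (c := c) ha (by simp)]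
        simp [subst_xv_self, subst_yv_self, arc_C, subst_C]
      · rw [RingHom.comp_apply, RingHom.comp_apply, subst_xv_ne _ _ h]
        by_cases hv : v ∈ W
        · rcases hk : κ v with _ | c
          · rw [arc_xv_none (W := W) hv (by simpa [h] using hk),
              arc_xv_none (W := W.erase a) (by simp [h, hv]) hk]
            simp [subst_xv_ne _ _ h]
          · rw [arc_xv_some (c := c) (W := W) hv (by simpa [h] using hk),
              arc_xv_some (W := W.erase a) (by simp [h, hv]) hk]
            simp [subst_xv_ne _ _ h, subst_yv_ne _ _ h, subst_C]
        · rw [arc_xv_of_notMem hv, arc_xv_of_notMem (by simp [hv])]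
          simp [subst_xv_ne _ _ h]
    · intro v
      by_cases h : v = a
      · subst h
        rw [RingHom.comp_apply, arc_yv_some (c := c) ha (by simp)]
        simp [subst_yv_self]
      · rw [RingHom.comp_apply, RingHom.comp_apply, subst_yv_ne _ _ h]
        by_cases hv : v ∈ W
        · rcases hk : κ v with _ | c
          · rw [arc_yv_none (W := W) hv (by simpa [h] using hk),
              arc_yv_none (W := W.erase a) (by simp [h, hv]) hk]
            simp [subst_yv_ne _ _ h]
          · rw [arc_yv_some (c := c) (W := W) hv (by simpa [h] using hk),
              arc_yv_some (W := W.erase a) (by simp [h, hv]) hk]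
            simp [subst_yv_ne _ _ h]
        · rw [arc_yv_of_notMem hv, arc_yv_of_notMem (by simp [hv])]
          simp [subst_yv_ne _ _ h]
  exact congrArg (fun φ => φ f) this

lemma X_pow_sub_dvd {R : Type} [CommRing R] {n m e : ℕ} {p : Polynomial R}
    (h : Polynomial.X ^ n ∣ Polynomial.X ^ (m + e) * p) :
    Polynomial.X ^ (n - e) ∣ Polynomial.X ^ m * p := by
  rw [Polynomial.X_pow_dvd_iff] at h ⊢
  intro d hd
  have := h (d + e) (by omega)
  rw [pow_add, mul_comm (_ ^ m), mul_assoc, Polynomial.coeff_X_pow_mul] at this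
  exact this

lemma Admissible.update {G : SimpleGraph V} {W : Finset V} {a : V} {κ : V → Option K} {c : K}
    (hκ : Admissible G (W.erase a) κ)
    (h : ∀ v ∈ W, G.Adj a v → ∀ c', κ v = some c' → c' = c) :
    Admissible G W (Function.update κ a (some c)) := by
  intro u hu v hv huv c₁ c₂ h₁ h₂
  by_cases hua : u = a
  · subst hua
    simp only [Function.update_self, Option.some.injEq] at h₁
    rw [Function.update_of_ne huv.ne.symm] at h₂
    rw [← h₁, h v hv huv _ h₂]
  · rw [Function.update_of_ne hua] at h₁
    by_cases hva : v = a
    · subst hva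
      simp only [Function.update_self, Option.some.injEq] at h₂
      rw [← h₂, h u hu huv.symm _ h₁]
    · rw [Function.update_of_ne hva] at h₂
      exact hκ u (by simp [hua, hu]) v (by simp [hva, hv]) huv _ _ h₁ h₂

/-- Restricting to the hyperplane `x_a = c y_a` preserves the order conditions. -/
lemma OrderCond.restrict {G : SimpleGraph V} [DecidableRel G.Adj] {W : Finset V} {a : V}
    (ha : a ∈ W) {c : K} {L : List (Finset V × K)} (hL : ∀ e ∈ L, Dropped a c e → e.1 = {a})
    {n d : ℕ} {f : MvPolynomial (V ⊕ V) K} (hd : IsHom a d f) (hf : OrderCond G W n L f) :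
    OrderCond G (W.erase a) (n - min (dropCount a c L) d) (restricted G W a c d L)
      (subst a (C c) 1 f) := by
  intro κ hκ
  have h₁ : Polynomial.X ^ n ∣ Polynomial.X ^ (cnt κ (kept a c L) + d) *
      arc (W.erase a) κ (subst a (C c) 1 f) := by
    have h := hf (Function.update κ a none) (by
      intro u hu v hv huv c d hc hd
      have hua : u ≠ a := by rintro rfl; simp at hc
      have hva : v ≠ a := by rintro rfl; simp at hd
      exact hκ u (by simp [hua, hu]) v (by simp [hva, hv]) huv c d (by simpa [hua] using hc)
        (by simpa [hva] using hd))
    have h := map_dvd (Polynomial.mapRingHom (subst a (C c) 1)) h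
    rw [arc_update_none ha κ hd] at h
    simp only [map_mul, map_pow, Polynomial.coe_mapRingHom, Polynomial.map_X,
      map_subst_arc_erase] at h
    rw [pow_add, mul_assoc]
    exact h.trans (mul_dvd_mul_right (pow_dvd_pow _ (cnt_update_none_le κ hL)) _)
  rw [restricted, cnt_append]
  by_cases hN : Counted κ ((W.erase a).filter (G.Adj a), c)
  · rw [cnt_replicate_pos hN]
    apply X_pow_sub_dvd
    rwa [add_assoc, Nat.sub_add_cancel (min_le_right _ _)]
  · rw [cnt_replicate_neg hN]
    apply X_pow_sub_dvd
    rw [add_zero]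
    rcases le_total (dropCount a c L) d with hle | hle
    · rw [min_eq_left hle]
      have h := hf (Function.update κ a (some c)) (hκ.update (fun v hv hav c' hc' => by
        by_contra hne
        exact hN ⟨v, by simp [hv, hav, hav.ne.symm], c', hc', hne⟩))
      have h := map_dvd (Polynomial.mapRingHom (subst a 0 1)) h
      simp only [map_mul, map_pow, Polynomial.coe_mapRingHom, Polynomial.map_X,
        map_subst_arc_update ha] at h
      exact h.trans (mul_dvd_mul_right (pow_dvd_pow _ (cnt_update_some_le κ L)) _)
    · rwa [min_eq_right hle]

lemma mem_sup_of_le {R : Type} [CommRing R] {I J P : Ideal R} (h : I ≤ J) {r : R}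
    (hr : r ∈ I ⊔ P) : r ∈ J ⊔ P := (sup_le_sup_right h P) hr

lemma mul_mem_mul_sup {R : Type} [CommRing R] {I J P : Ideal R} {r s : R} (hr : r ∈ I ⊔ P)
    (hs : s ∈ J ⊔ P) : r * s ∈ I * J ⊔ P := by
  obtain ⟨i, hi, p, hp, rfl⟩ := Submodule.mem_sup.1 hr
  obtain ⟨j, hj, q, hq, rfl⟩ := Submodule.mem_sup.1 hs
  have : (i + p) * (j + q) = i * j + (i * q + p * (j + q)) := by ring
  rw [this]
  exact Submodule.add_mem_sup (Ideal.mul_mem_mul hi hj)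
    (P.add_mem (P.mul_mem_left _ hq) (P.mul_mem_right _ hp))

lemma yv_pow_mul_mem_replicate {G : SimpleGraph V} [DecidableRel G.Adj] {W : Finset V} {a : V}
    (ha : a ∈ W) (c : K) (d n : ℕ) {f : MvPolynomial (V ⊕ V) K}
    (hf : f ∈ mixedPower G (W.erase a) n
      (List.replicate d ((W.erase a).filter (G.Adj a), c))) :
    yv K a ^ d * f ∈ edgeIdeal K G W ^ n ⊔ Ideal.span {lin c a} := by
  induction d generalizing n f with
  | zero =>
    rw [pow_zero, one_mul]
    refine Ideal.mem_sup_left (Ideal.pow_right_mono (Ideal.span_mono ?_) n hf)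
    rintro _ ⟨i, hi, j, hj, h⟩
    exact ⟨i, Finset.mem_of_mem_erase hi, j, Finset.mem_of_mem_erase hj, h⟩
  | succ d ih =>
    rw [List.replicate_succ] at hf
    obtain ⟨p, hp, q, hq, rfl⟩ := mem_mixedPower_cons.1 hf
    rw [mul_add]
    refine Ideal.add_mem _ ?_ ?_
    · rw [pow_succ', mul_assoc]
      exact Ideal.mul_mem_left _ _ (ih n hp)
    · refine Submodule.mul_induction_on hq (fun r hr s hs => ?_) (fun r s hr hs => ?_)
      · have h₁ : yv K a * r ∈ edgeIdeal K G W ⊔ Ideal.span {lin c a} := by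
          refine Submodule.span_induction ?_ (by simp) ?_ ?_ hr
          · rintro _ ⟨u, hu, rfl⟩
            simp only [Finset.mem_filter, Finset.mem_erase] at hu
            have : yv K a * lin c u = (xv K u * yv K a - xv K a * yv K u) + yv K u * lin c a := by
              simp only [lin]; ring
            rw [this]
            exact Submodule.add_mem_sup
              (Ideal.subset_span ⟨u, hu.1.2, a, ha, hu.2.symm, rfl⟩)
              (Ideal.mul_mem_left _ _ (Ideal.mem_span_singleton_self _))
          · intro x y _ _ hx hy
            rw [mul_add]
            exact Ideal.add_mem _ hx hy
          · intro t x _ hx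
            rw [smul_eq_mul, mul_left_comm]
            exact Ideal.mul_mem_left _ _ hx
        have h₂ := mul_mem_mul_sup h₁ (ih (n - 1) hs)
        rw [pow_succ', show yv K a * yv K a ^ d * (r * s) = yv K a * r * (yv K a ^ d * s) by ring]
        refine mem_sup_of_le ?_ h₂
        rw [← pow_succ']
        exact Ideal.pow_le_pow_right (by omega)
      · rw [mul_add]
        exact Ideal.add_mem _ hr hs

/-- Elements of the restricted mixed power lift modulo `x_a - c y_a`. -/
lemma yv_pow_mul_mem {G : SimpleGraph V} [DecidableRel G.Adj] {W : Finset V} {a : V}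
    (ha : a ∈ W) {c : K} {L : List (Finset V × K)} (d n : ℕ) {f : MvPolynomial (V ⊕ V) K}
    (hf : f ∈ mixedPower G (W.erase a) (n - min (dropCount a c L) d)
      (restricted G W a c d L)) :
    yv K a ^ d * f ∈ mixedPower G W n L ⊔ Ideal.span {lin c a} := by
  induction L generalizing n d f with
  | nil =>
    simp only [restricted, kept, dropCount, List.filter_nil, List.map_nil, List.countP_nil,
      Nat.zero_min, Nat.sub_zero, List.nil_append] at hf
    exact yv_pow_mul_mem_replicate ha c d n hf
  | cons e L ih =>
    by_cases h : Dropped a c e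
    · rw [restricted, kept_cons_pos h, dropCount_cons_pos h] at hf
      rcases d with _ | d
      · have := @ih 0 n f (by simpa [restricted] using hf)
        exact mem_sup_of_le le_sup_left this
      · have h₁ := @ih d (n - 1) f (by
          rw [restricted]
          rw [← Nat.succ_eq_add_one, ← Nat.succ_eq_add_one, Nat.succ_min_succ,
            Nat.succ_sub_succ] at hf
          convert hf using 2
          omega)
        have h₂ : yv K a ∈ linIdeal e ⊔ Ideal.span {lin c a} := by
          have hne : c - e.2 ≠ 0 := sub_ne_zero.2 (Ne.symm h.2)
          have : yv K a = C (c - e.2)⁻¹ * lin e.2 a + -(C (c - e.2)⁻¹) * lin c a := by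
            have hc : C (c - e.2)⁻¹ * (C c - C e.2) = (1 : MvPolynomial (V ⊕ V) K) := by
              rw [← C_sub, ← C_mul, inv_mul_cancel₀ hne, C_1]
            simp only [lin]
            linear_combination (-(yv K a)) * hc
          rw [this]
          exact Submodule.add_mem_sup (Ideal.mul_mem_left _ _ (Ideal.subset_span ⟨a, h.1, rfl⟩))
            (Ideal.mul_mem_left _ _ (Ideal.mem_span_singleton_self _))
        rw [pow_succ', mul_assoc]
        exact mem_sup_of_le le_sup_right (mul_mem_mul_sup h₂ h₁)
    · rw [restricted, kept_cons_neg h, dropCount_cons_neg h, List.cons_append] at hf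
      obtain ⟨p, hp, q, hq, rfl⟩ := mem_mixedPower_cons.1 hf
      rw [mul_add]
      refine Ideal.add_mem _ (mem_sup_of_le le_sup_left (ih d n hp)) ?_
      rw [Nat.sub_right_comm] at hq
      refine Submodule.mul_induction_on hq (fun r hr s hs => ?_) (fun r s hr hs => ?_)
      · have h₁ : r ∈ linIdeal e ⊔ Ideal.span {lin c a} := by
          refine Ideal.mem_sup_left (Ideal.span_mono ?_ hr)
          rintro _ ⟨v, hv, rfl⟩
          exact ⟨v, Finset.mem_of_mem_erase hv, rfl⟩
        rw [mul_left_comm]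
        exact mem_sup_of_le le_sup_right (mul_mem_mul_sup h₁ (ih d (n - 1) hs))
      · rw [mul_add]
        exact Ideal.add_mem _ hr hs

end

section

variable {V K : Type} [Field K]

open Classical in
/-- The substitution along an arc with labels and coordinates in an arbitrary ring. -/
noncomputable def genArc {k A : Type} [Field k] [CommRing A] (φ : k →+* A) (x y : V → A)
    (W : Finset V) (κ : V → Option A) : MvPolynomial (V ⊕ V) k →+* Polynomial A :=
  eval₂Hom (Polynomial.C.comp φ) (Sum.elim
    (fun v => if v ∈ W then
        (match κ v with
          | none => Polynomial.X * Polynomial.C (x v)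
          | some c => Polynomial.C (c * y v) + Polynomial.X * Polynomial.C (x v))
      else Polynomial.C (x v))
    (fun v => if v ∈ W then
        (match κ v with
          | none => Polynomial.X * Polynomial.C (y v)
          | some _ => Polynomial.C (y v))
      else Polynomial.C (y v)))

lemma map_genArc {k A B : Type} [Field k] [CommRing A] [CommRing B] (φ : k →+* A) (x y : V → A)
    (W : Finset V) (κ : V → Option A) (ψ : A →+* B) (f : MvPolynomial (V ⊕ V) k) :
    (genArc φ x y W κ f).map ψ =
      genArc (ψ.comp φ) (ψ ∘ x) (ψ ∘ y) W (fun v => (κ v).map ψ) f := by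
  have : (Polynomial.mapRingHom ψ).comp (genArc φ x y W κ) =
      genArc (ψ.comp φ) (ψ ∘ x) (ψ ∘ y) W (fun v => (κ v).map ψ) := by
    apply MvPolynomial.ringHom_ext
    · intro c
      simp [genArc]
    · rintro (v | v)
      · simp only [RingHom.comp_apply, genArc, eval₂Hom_X', Sum.elim_inl]
        by_cases hv : v ∈ W
        · rcases hk : κ v with _ | c <;> simp [hv]
        · simp [hv]
      · simp only [RingHom.comp_apply, genArc, eval₂Hom_X', Sum.elim_inr]
        by_cases hv : v ∈ W
        · rcases hk : κ v with _ | c <;> simp [hv]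
        · simp [hv]
  exact congrArg (fun θ => θ f) this

lemma arc_eq_genArc (W : Finset V) (κ : V → Option K) (f : MvPolynomial (V ⊕ V) K) :
    arc W κ f = genArc C (xv K) (yv K) W (fun v => (κ v).map C) f := by
  have : arc W κ = genArc C (xv K) (yv K) W (fun v => (κ v).map C) := by
    apply MvPolynomial.ringHom_ext
    · intro c
      simp [genArc, arc]
    · rintro (v | v)
      · simp only [genArc, arc, eval₂Hom_X', Sum.elim_inl]
        by_cases hv : v ∈ W
        · rcases hk : κ v with _ | c <;> simp [hv]
        · simp [hv]
      · simp only [genArc, arc, eval₂Hom_X', Sum.elim_inr]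
        by_cases hv : v ∈ W
        · rcases hk : κ v with _ | c <;> simp [hv]
        · simp [hv]
  exact congrArg (fun θ => θ f) this

open Classical in
/-- The labelling `κ` with the label `l` replaced by `c`. -/
noncomputable def relabel (κ : V → Option K) (l c : K) : V → Option K :=
  fun v => (κ v).map (fun m => if m = l then c else m)

lemma relabel_self (κ : V → Option K) (l : K) : relabel κ l l = κ := by
  funext v
  rw [relabel]
  rcases κ v with _ | m
  · rfl
  · by_cases h : m = l <;> simp [h]

/-- Order conditions holding for almost all values of a label hold for all of them. -/
lemma dvd_arc_of_relabel [Infinite K] {W : Finset V} {κ : V → Option K} {l : K} {D : Finset K}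
    {n m : ℕ} {f : MvPolynomial (V ⊕ V) K}
    (h : ∀ c ∉ D, Polynomial.X ^ n ∣ Polynomial.X ^ m * arc W (relabel κ l c) f) :
    Polynomial.X ^ n ∣ Polynomial.X ^ m * arc W κ f := by
  classical
  let F : Polynomial (Polynomial (MvPolynomial (V ⊕ V) K)) :=
    Polynomial.X ^ m * genArc (Polynomial.C.comp C) (Polynomial.C ∘ xv K) (Polynomial.C ∘ yv K) W
      (fun v => (κ v).map (fun μ => if μ = l then Polynomial.X else Polynomial.C (C μ))) f
  have hF : ∀ c : K, F.map (Polynomial.evalRingHom (C c)) =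
      Polynomial.X ^ m * arc W (relabel κ l c) f := by
    intro c
    simp only [F, Polynomial.map_mul, Polynomial.map_pow, Polynomial.map_X, map_genArc]
    rw [arc_eq_genArc]
    congr 3
    · exact RingHom.ext fun _ => by simp
    · funext v; simp
    · funext v; simp
    · funext v
      rw [relabel]
      rcases κ v with _ | μ
      · rfl
      · by_cases hμ : μ = l <;> simp [hμ]
  rw [← relabel_self κ l, ← hF, Polynomial.X_pow_dvd_iff]
  intro i hi
  have h0 : F.coeff i = 0 := by
    apply Polynomial.eq_zero_of_infinite_isRoot
    have hinf : ((fun c : K => (C c : MvPolynomial (V ⊕ V) K)) '' (D : Set K)ᶜ).Infinite :=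
      (Set.Finite.infinite_compl D.finite_toSet).image (C_injective _ _).injOn
    refine hinf.mono ?_
    rintro _ ⟨c, hc, rfl⟩
    have := h c (by simpa using hc)
    rw [← hF, Polynomial.X_pow_dvd_iff] at this
    have := this i hi
    rwa [Polynomial.coeff_map] at this
  rw [Polynomial.coeff_map, h0, map_zero]

variable [DecidableEq V]

/-- Order conditions at a labelled vertex imply those at the origin. -/
lemma dvd_arc_of_update {W : Finset V} {κ : V → Option K} {a : V} (ha : a ∈ W) (hκ : κ a = none)
    {c : K} {n m : ℕ} {f : MvPolynomial (V ⊕ V) K}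
    (h : Polynomial.X ^ n ∣ Polynomial.X ^ m * arc W (Function.update κ a (some c)) f) :
    Polynomial.X ^ n ∣ Polynomial.X ^ m * arc W κ f := by
  let η : MvPolynomial (V ⊕ V) K →+* Polynomial (MvPolynomial (V ⊕ V) K) :=
    eval₂Hom (Polynomial.C.comp C) (Sum.elim
      (fun v => if v = a then Polynomial.C (lin c a) else Polynomial.C (xv K v))
      (fun v => if v = a then Polynomial.X * Polynomial.C (yv K a) else Polynomial.C (yv K v)))
  have ηC : ∀ r : K, η (C r) = Polynomial.C (C r) := fun r => by simp [η]
  have ηxa : η (xv K a) = Polynomial.C (lin c a) := by simp only [η, xv, eval₂Hom_X']; simp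
  have ηya : η (yv K a) = Polynomial.X * Polynomial.C (yv K a) := by
    simp only [η, yv, eval₂Hom_X']; simp
  have ηx : ∀ v, v ≠ a → η (xv K v) = Polynomial.C (xv K v) := fun v hv => by
    simp only [η, xv, eval₂Hom_X']; simp [hv]
  have ηy : ∀ v, v ≠ a → η (yv K v) = Polynomial.C (yv K v) := fun v hv => by
    simp only [η, yv, eval₂Hom_X']; simp [hv]
  have : (evalAt η Polynomial.X).comp (arc W (Function.update κ a (some c))) = arc W κ := by
    apply ringHom_ext_vertex
    · intro r; simp [arc_C, evalAt_C, ηC]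
    · intro v
      rw [RingHom.comp_apply]
      by_cases hv : v = a
      · subst hv
        rw [arc_xv_some (c := c) ha (by simp), arc_xv_none ha hκ]
        simp only [map_add, map_mul, evalAt_C, evalAt_X, ηC, ηxa, ηya, lin, map_sub]
        ring
      · by_cases hW : v ∈ W
        · rcases hk : κ v with _ | c'
          · rw [arc_xv_none hW (by simpa [hv] using hk), arc_xv_none hW hk]
            simp [evalAt_C, evalAt_X, ηx v hv]
          · rw [arc_xv_some (c := c') hW (by simpa [hv] using hk), arc_xv_some hW hk]
            simp [evalAt_C, evalAt_X, ηx v hv, ηy v hv, ηC]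
        · rw [arc_xv_of_notMem hW, arc_xv_of_notMem hW, evalAt_C, ηx v hv]
    · intro v
      rw [RingHom.comp_apply]
      by_cases hv : v = a
      · subst hv
        rw [arc_yv_some (c := c) ha (by simp), arc_yv_none ha hκ, evalAt_C, ηya]
      · by_cases hW : v ∈ W
        · rcases hk : κ v with _ | c'
          · rw [arc_yv_none hW (by simpa [hv] using hk), arc_yv_none hW hk]
            simp [evalAt_C, evalAt_X, ηy v hv]
          · rw [arc_yv_some (c := c') hW (by simpa [hv] using hk), arc_yv_some hW hk]
            simp [evalAt_C, evalAt_X, ηy v hv]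
        · rw [arc_yv_of_notMem hW, arc_yv_of_notMem hW, evalAt_C, ηy v hv]
  have h' := map_dvd (evalAt η Polynomial.X) h
  rw [map_mul, map_pow, map_pow, evalAt_X, ← RingHom.comp_apply, this] at h'
  exact h'

lemma X_pow_dvd_of_not_dvd {R : Type} [CommRing R] [IsDomain R] {n m : ℕ} {p q : Polynomial R}
    (hp : p.coeff 0 ≠ 0) (h : Polynomial.X ^ n ∣ Polynomial.X ^ m * (p * q)) :
    Polynomial.X ^ n ∣ Polynomial.X ^ m * q := by
  rw [mul_left_comm] at h
  exact Polynomial.prime_X.pow_dvd_of_dvd_mul_left n (fun h => hp (Polynomial.X_dvd_iff.1 h)) h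

lemma yv_ne_zero (v : V) : yv K v ≠ 0 := X_ne_zero _

lemma xv_ne_zero (v : V) : xv K v ≠ 0 := X_ne_zero _

lemma arc_lin_coeff_zero_ne {W : Finset V} {κ : V → Option K} {a : V} {c l : K} (ha : a ∈ W)
    (h : κ a = some c) (hne : c ≠ l) : (arc W κ (lin l a)).coeff 0 ≠ 0 := by
  rw [arc_lin_some ha h]
  rw [Polynomial.coeff_add, Polynomial.coeff_C_zero, Polynomial.coeff_X_mul_zero, add_zero]
  exact mul_ne_zero (C_ne_zero.2 (sub_ne_zero.2 hne)) (yv_ne_zero a)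

lemma Admissible.mono {G : SimpleGraph V} {W W' : Finset V} {κ : V → Option K}
    (hκ : Admissible G W κ) (h : W' ⊆ W) : Admissible G W' κ :=
  fun u hu v hv => hκ u (h hu) v (h hv)

/-- Dividing by `x_a - c y_a` uses up one condition `(A, c)` with `a ∈ A`. -/
lemma OrderCond.of_lin_mul {G : SimpleGraph V} {W : Finset V} {a : V} (ha : a ∈ W)
    (hcl : ∀ u ∈ W, ∀ v ∈ W, G.Adj a u → G.Adj a v → u ≠ v → G.Adj u v)
    {L L' : List (Finset V × K)} {e : Finset V × K} (hL : L.Perm (e :: L')) (hae : a ∈ e.1)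
    (heW : ∀ v ∈ e.1, v ∈ W) (hadj : ∀ v ∈ e.1, v ≠ a → G.Adj a v)
    (he : e.1 = {a} ∨ ∀ e' ∈ L, a ∈ e'.1 → e' = e) {n : ℕ} {f : MvPolynomial (V ⊕ V) K}
    (hf : OrderCond G W n L (lin e.2 a * f)) : OrderCond G W (n - 1) L' f := by
  have main : ∀ κ : V → Option K, Admissible G W κ → ∀ c, κ a = some c → c ≠ e.2 →
      Polynomial.X ^ (n - 1) ∣ Polynomial.X ^ cnt κ L' * arc W κ f := by
    intro κ hκ c hc hne
    have h := hf κ hκ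
    rw [cnt_perm κ hL, cnt_cons_pos ⟨a, hae, c, hc, hne⟩, map_mul] at h
    exact X_pow_sub_dvd (X_pow_dvd_of_not_dvd (arc_lin_coeff_zero_ne ha hc hne) h)
  intro κ hκ
  have uncounted : ∀ p : MvPolynomial (V ⊕ V) K, p ≠ 0 → ¬ Counted κ e →
      arc W κ (lin e.2 a) = Polynomial.X * Polynomial.C p →
      Polynomial.X ^ (n - 1) ∣ Polynomial.X ^ cnt κ L' * arc W κ f := by
    intro p hp hcnt harc
    have h := hf κ hκ
    rw [cnt_perm κ hL, cnt_cons_neg hcnt, map_mul, harc, mul_assoc, ← mul_assoc (_ ^ _),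
      ← pow_succ] at h
    exact X_pow_sub_dvd (X_pow_dvd_of_not_dvd (by simpa using hp) h)
  rcases hk : κ a with _ | c
  · by_cases hcnt : Counted κ e
    · obtain ⟨v, hv, c, hvc, hne⟩ := hcnt
      have hva : v ≠ a := by rintro rfl; simp [hk] at hvc
      have hadm : Admissible G W (Function.update κ a (some c)) := by
        refine (hκ.mono (Finset.erase_subset a W)).update (fun u hu hau c' hc' => ?_)
        by_cases huv : u = v
        · subst huv; rw [hvc] at hc'; exact (Option.some.inj hc').symm
        · exact hκ u hu v (heW v hv)
            (hcl u hu v (heW v hv) hau (hadj v hv hva) huv) c' c hc' hvc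
      have h := main _ hadm c (by simp) hne
      refine dvd_arc_of_update ha hk (c := c) (h.trans (mul_dvd_mul_right (pow_dvd_pow _ ?_) _))
      refine (cnt_congr (fun e' he' => ⟨?_, ?_⟩)).le
      · rintro ⟨u, hu, c', hc', hne'⟩
        by_cases hua : u = a
        · subst hua
          have : e' = e := by
            rcases he with he | he
            · rw [he, Finset.mem_singleton] at hv
              exact absurd hv hva
            · exact he e' (hL.symm.subset (List.mem_cons_of_mem _ he')) hu
          subst this
          exact ⟨v, hv, c, hvc, hne⟩
        · exact ⟨u, hu, c', by simpa [hua] using hc', hne'⟩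
      · rintro ⟨u, hu, c', hc', hne'⟩
        have hua : u ≠ a := by rintro rfl; simp [hk] at hc'
        exact ⟨u, hu, c', by simpa [hua] using hc', hne'⟩
    · exact uncounted _ (lin_ne_zero e.2 a) hcnt (arc_lin_none ha hk)
  · by_cases hne : c = e.2
    · subst hne
      refine uncounted (xv K a) (xv_ne_zero a) ?_ (by simp [arc_lin_some ha hk])
      rintro ⟨v, hv, c, hc, hne⟩
      by_cases hva : v = a
      · subst hva; rw [hk] at hc; exact hne (Option.some.inj hc).symm
      · exact hne (hκ a ha v (heW v hv) (hadj v hv hva) _ _ hk hc).symm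
    · exact main κ hκ c hk hne

/-- Dividing by `x_a - l y_a` preserves the order conditions when none of them involves `a`
or the direction `l`. -/
lemma OrderCond.of_lin_mul_of_fresh [Infinite K] {G : SimpleGraph V} {W : Finset V} {a : V}
    (ha : a ∈ W) (hcl : ∀ u ∈ W, ∀ v ∈ W, G.Adj a u → G.Adj a v → u ≠ v → G.Adj u v)
    {L : List (Finset V × K)} {l : K} (haL : ∀ e ∈ L, a ∉ e.1) (hl : ∀ e ∈ L, e.2 ≠ l) {n : ℕ}
    {f : MvPolynomial (V ⊕ V) K} (hf : OrderCond G W n L (lin l a * f)) :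
    OrderCond G W n L f := by
  classical
  have main : ∀ κ : V → Option K, Admissible G W κ → ∀ c, κ a = some c → c ≠ l →
      Polynomial.X ^ n ∣ Polynomial.X ^ cnt κ L * arc W κ f := by
    intro κ hκ c hc hne
    have h := hf κ hκ
    rw [map_mul] at h
    exact X_pow_dvd_of_not_dvd (arc_lin_coeff_zero_ne ha hc hne) h
  have labelled : ∀ κ : V → Option K, Admissible G W κ → ∀ c, κ a = some c →
      Polynomial.X ^ n ∣ Polynomial.X ^ cnt κ L * arc W κ f := by
    intro κ hκ c hc
    by_cases hne : c = l
    · subst hne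
      refine dvd_arc_of_relabel (l := c) (D := insert c (L.map Prod.snd).toFinset) ?_
      intro c' hc'
      simp only [Finset.mem_insert, List.mem_toFinset, List.mem_map, not_or, not_exists,
        not_and] at hc'
      have hadm : Admissible G W (relabel κ c c') := by
        intro u hu v hv huv c₁ c₂ h₁ h₂
        simp only [relabel, Option.map_eq_some_iff] at h₁ h₂
        obtain ⟨m₁, hm₁, rfl⟩ := h₁
        obtain ⟨m₂, hm₂, rfl⟩ := h₂
        rw [hκ u hu v hv huv _ _ hm₁ hm₂]
      have h := main _ hadm c' (by simp [relabel, hc]) hc'.1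
      rwa [cnt_congr (κ' := κ)] at h
      intro e he
      constructor
      · rintro ⟨v, hv, m, hm, hne⟩
        simp only [relabel, Option.map_eq_some_iff] at hm
        obtain ⟨m₁, hm₁, rfl⟩ := hm
        refine ⟨v, hv, m₁, hm₁, ?_⟩
        by_cases h₁ : m₁ = c
        · rw [h₁]; exact (hl e he).symm
        · simpa [h₁] using hne
      · rintro ⟨v, hv, m, hm, hne⟩
        refine ⟨v, hv, if m = c then c' else m, by simp [relabel, hm], ?_⟩
        split_ifs
        · exact fun h => hc'.2 e he h.symm
        · exact hne
    · exact main κ hκ c hc hne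
  intro κ hκ
  rcases hk : κ a with _ | c
  · obtain ⟨c, hc⟩ : ∃ c, ∀ v ∈ W, G.Adj a v → ∀ c', κ v = some c' → c' = c := by
      by_cases h : ∃ v ∈ W, G.Adj a v ∧ ∃ c, κ v = some c
      · obtain ⟨v, hv, hav, c, hc⟩ := h
        refine ⟨c, fun u hu hau c' hc' => ?_⟩
        by_cases huv : u = v
        · subst huv; rw [hc] at hc'; exact (Option.some.inj hc').symm
        · exact hκ u hu v hv (hcl u hu v hv hau hav huv) c' c hc' hc
      · exact ⟨0, fun v hv hav c' hc' => absurd ⟨v, hv, hav, c', hc'⟩ h⟩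
    have h := labelled _ ((hκ.mono (Finset.erase_subset a W)).update hc) c (by simp)
    refine dvd_arc_of_update ha hk (c := c) ?_
    rwa [cnt_congr (κ' := κ)] at h
    intro e he
    have hne : ∀ v ∈ e.1, v ≠ a := by rintro v hv rfl; exact haL e he hv
    constructor
    · rintro ⟨v, hv, m, hm, hm'⟩
      exact ⟨v, hv, m, by simpa [hne v hv] using hm, hm'⟩
    · rintro ⟨v, hv, m, hm, hm'⟩
      exact ⟨v, hv, m, by simpa [hne v hv] using hm, hm'⟩
  · exact labelled κ hκ c hk

end

section

/-- A vertex ordering along which the binomial edge ideal can be analysed one vertex at a time. -/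
structure GoodOrder {V : Type} (G : SimpleGraph V) (ord : V → ℕ) : Prop where
  inj : Function.Injective ord
  clique : ∀ {a u w}, ord a < ord u → ord a < ord w → G.Adj a u → G.Adj a w → u ≠ w → G.Adj u w
  uniform : ∀ a, (∀ b, ord b < ord a → G.Adj b a → ∀ w, ord a < ord w → ¬ G.Adj b w) ∨
    (∀ b, ord b < ord a → G.Adj b a → ∀ w, ord a < ord w → G.Adj a w → G.Adj b w)
  adj : ∀ {b a w₁ w₂}, ord b < ord a → ord a < ord w₁ → ord a < ord w₂ → w₁ ≠ w₂ →
    G.Adj a w₁ → G.Adj a w₂ → G.Adj b w₁ → G.Adj b w₂ → G.Adj a b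

variable {V K : Type} [Field K] [DecidableEq V]

/-- The conditions `L` on the vertices `W` come from neighbourhoods of earlier vertices. -/
structure Compatible (G : SimpleGraph V) [DecidableRel G.Adj] (ord : V → ℕ) (W : Finset V)
    (L : List (Finset V × K)) : Prop where
  upper : ∀ v ∈ W, ∀ w, ord v < ord w → w ∈ W
  nbhd : ∀ e ∈ L, ∃ b ∉ W, e.1 = W.filter (G.Adj b)
  direction : ∀ e ∈ L, ∀ e' ∈ L, e.1 = e'.1 → 1 < e.1.card → e.2 = e'.2

lemma mem_kept {a : V} {c : K} {L : List (Finset V × K)} {e : Finset V × K}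
    (h : e ∈ kept a c L) : ∃ e' ∈ L, ¬ Dropped a c e' ∧ e = (e'.1.erase a, e'.2) := by
  simp only [kept, List.mem_map, List.mem_filter, decide_eq_true_eq] at h
  obtain ⟨e', ⟨h₁, h₂⟩, rfl⟩ := h
  exact ⟨e', h₁, h₂, rfl⟩

section
variable {G : SimpleGraph V} [DecidableRel G.Adj] {ord : V → ℕ} {W : Finset V}
  {L : List (Finset V × K)} {a : V}

lemma Compatible.lt_of_notMem (hc : Compatible G ord W L) (ho : GoodOrder G ord) (ha : a ∈ W)
    {b : V} (hb : b ∉ W) : ord b < ord a := by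
  by_contra h
  rcases (not_lt.1 h).lt_or_eq with h | h
  · exact hb (hc.upper a ha b h)
  · exact hb (ho.inj h ▸ ha)

lemma Compatible.of_subset (hc : Compatible G ord W L) {L' : List (Finset V × K)} (h : L' ⊆ L) :
    Compatible G ord W L' :=
  ⟨hc.upper, fun e he => hc.nbhd e (h he),
    fun e he e' he' => hc.direction e (h he) e' (h he')⟩

lemma Compatible.restricted (hc : Compatible G ord W L) (ho : GoodOrder G ord) (ha : a ∈ W)
    (hmin : ∀ w ∈ W, w ≠ a → ord a < ord w) (c : K) (d : ℕ) :
    Compatible G ord (W.erase a) (restricted G W a c d L) := by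
  have hsplit : ∀ e ∈ BinomialEdge.restricted G W a c d L,
      (∃ e' ∈ L, ¬ Dropped a c e' ∧ e = (e'.1.erase a, e'.2)) ∨
        e = ((W.erase a).filter (G.Adj a), c) := by
    intro e he
    rcases List.mem_append.1 he with h | h
    · exact Or.inl (mem_kept h)
    · exact Or.inr (List.eq_of_mem_replicate h)
  have herase : ∀ b, (W.filter (G.Adj b)).erase a = (W.erase a).filter (G.Adj b) := by
    intro b; ext v; simp only [Finset.mem_erase, Finset.mem_filter]; tauto
  -- two earlier vertices with the same later neighbours have the same adjacency to `a`
  have key : ∀ b₁ b₂, ord b₁ < ord a → ord b₂ < ord a → G.Adj b₁ a →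
      (W.erase a).filter (G.Adj b₁) = (W.erase a).filter (G.Adj b₂) →
      1 < ((W.erase a).filter (G.Adj b₁)).card → G.Adj b₂ a := by
    intro b₁ b₂ h₁ h₂ hadj heq hcard
    obtain ⟨w₁, hw₁, w₂, hw₂, hne⟩ := Finset.one_lt_card.1 hcard
    have hw₁' := heq ▸ hw₁
    have hw₂' := heq ▸ hw₂
    simp only [Finset.mem_filter, Finset.mem_erase] at hw₁ hw₂ hw₁' hw₂'
    have l₁ := hmin w₁ hw₁.1.2 hw₁.1.1
    have l₂ := hmin w₂ hw₂.1.2 hw₂.1.1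
    rcases lt_trichotomy (ord b₁) (ord b₂) with h | h | h
    · have := ho.adj h (h₂.trans l₁) (h₂.trans l₂) hne hw₁'.2 hw₂'.2 hw₁.2 hw₂.2
      exact ho.clique h h₁ this.symm hadj (by rintro rfl; exact lt_irrefl _ h₂)
    · rw [← ho.inj h]; exact hadj
    · have hb := ho.adj h (h₁.trans l₁) (h₁.trans l₂) hne hw₁.2 hw₂.2 hw₁'.2 hw₂'.2
      rcases ho.uniform b₁ with hu | hu
      · exact absurd hw₁'.2 (hu b₂ h hb.symm w₁ (h₁.trans l₁))
      · exact hu b₂ h hb.symm a h₁ hadj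
  have key' : ∀ e ∈ L, ¬ Dropped a c e → e.1.erase a = (W.erase a).filter (G.Adj a) →
      1 < (e.1.erase a).card → e.2 = c := by
    intro e he hd heq hcard
    obtain ⟨b, hb, hbe⟩ := hc.nbhd e he
    by_contra hne
    refine hd ⟨?_, hne⟩
    obtain ⟨w₁, hw₁, w₂, hw₂, hne⟩ := Finset.one_lt_card.1 hcard
    have hw₁' := heq ▸ hw₁
    have hw₂' := heq ▸ hw₂
    rw [hbe] at hw₁ hw₂
    simp only [Finset.mem_filter, Finset.mem_erase] at hw₁ hw₂ hw₁' hw₂'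
    have := ho.adj (hc.lt_of_notMem ho ha hb) (hmin w₁ hw₁.2.1 hw₁.1) (hmin w₂ hw₂.2.1 hw₂.1)
      hne hw₁'.2 hw₂'.2 hw₁.2.2 hw₂.2.2
    rw [hbe]
    exact Finset.mem_filter.2 ⟨ha, this.symm⟩
  have key'' : ∀ e ∈ L, ∀ e' ∈ L, e.1.erase a = e'.1.erase a → 1 < (e.1.erase a).card →
      a ∈ e.1 → a ∈ e'.1 := by
    intro e he e' he' heq hcard hae
    obtain ⟨b, hb, hbe⟩ := hc.nbhd e he
    obtain ⟨b', hb', hbe'⟩ := hc.nbhd e' he'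
    rw [hbe] at hae
    rw [hbe, hbe', herase, herase] at heq
    rw [hbe, herase] at hcard
    rw [hbe']
    exact Finset.mem_filter.2 ⟨ha, key b b' (hc.lt_of_notMem ho ha hb) (hc.lt_of_notMem ho ha hb')
      (Finset.mem_filter.1 hae).2 heq hcard⟩
  refine ⟨?_, ?_, ?_⟩
  · intro v hv w hw
    rw [Finset.mem_erase] at hv ⊢
    refine ⟨?_, hc.upper v hv.2 w hw⟩
    rintro rfl
    exact lt_asymm hw (hmin v hv.2 hv.1)
  · intro e he
    rcases hsplit e he with ⟨e', he', -, rfl⟩ | rfl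
    · obtain ⟨b, hb, hbe⟩ := hc.nbhd e' he'
      exact ⟨b, fun h => hb (Finset.mem_of_mem_erase h), by rw [hbe, herase]⟩
    · exact ⟨a, by simp, rfl⟩
  · intro e he e' he' heq hcard
    rcases hsplit e he with ⟨e₁, he₁, hd₁, rfl⟩ | rfl <;>
      rcases hsplit e' he' with ⟨e₂, he₂, hd₂, rfl⟩ | rfl
    · by_cases h₁ : a ∈ e₁.1
      · have h₂ := key'' e₁ he₁ e₂ he₂ heq hcard h₁
        have h₃ : e₁.2 = c := by_contra fun h => hd₁ ⟨h₁, h⟩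
        have h₄ : e₂.2 = c := by_contra fun h => hd₂ ⟨h₂, h⟩
        exact h₃.trans h₄.symm
      · have h₂ : a ∉ e₂.1 := fun h => h₁ (key'' e₂ he₂ e₁ he₁ heq.symm (hcard.trans_eq (congrArg Finset.card heq)) h)
        simp only [Finset.erase_eq_of_notMem h₁, Finset.erase_eq_of_notMem h₂] at heq hcard
        exact hc.direction e₁ he₁ e₂ he₂ heq hcard
    · exact key' e₁ he₁ hd₁ heq hcard
    · exact (key' e₂ he₂ hd₂ heq.symm (hcard.trans_eq (congrArg Finset.card heq))).symm
    · rfl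

lemma Compatible.eq_or_singleton (hc : Compatible G ord W L) (ho : GoodOrder G ord) (ha : a ∈ W)
    (hmin : ∀ w ∈ W, w ≠ a → ord a < ord w) {e : Finset V × K} (he : e ∈ L) (hae : a ∈ e.1) :
    (∀ e' ∈ L, a ∈ e'.1 → e'.1 = {a}) ∨ ∀ e' ∈ L, a ∈ e'.1 → e' = e := by
  have hb : ∀ e' ∈ L, a ∈ e'.1 → ∃ b, ord b < ord a ∧ G.Adj b a ∧ e'.1 = W.filter (G.Adj b) := by
    intro e' he' hae'
    obtain ⟨b, hb, hbe⟩ := hc.nbhd e' he'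
    rw [hbe] at hae'
    exact ⟨b, hc.lt_of_notMem ho ha hb, (Finset.mem_filter.1 hae').2, hbe⟩
  rcases ho.uniform a with hu | hu
  · left
    intro e' he' hae'
    obtain ⟨b, hlt, hadj, hbe⟩ := hb e' he' hae'
    rw [Finset.eq_singleton_iff_unique_mem]
    refine ⟨hae', fun w hw => ?_⟩
    rw [hbe, Finset.mem_filter] at hw
    by_contra hne
    exact hu b hlt hadj w (hmin w hw.1 hne) hw.2
  · have hval : ∀ e' ∈ L, a ∈ e'.1 → e'.1 = insert a (W.filter (G.Adj a)) := by
      intro e' he' hae'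
      obtain ⟨b, hlt, hadj, hbe⟩ := hb e' he' hae'
      ext w
      by_cases hwa : w = a
      · subst hwa; simp [hae']
      · rw [hbe]
        simp only [Finset.mem_filter, Finset.mem_insert, hwa, false_or]
        refine and_congr_right fun hw => ⟨fun h => ?_, fun h => ?_⟩
        · exact ho.clique hlt (hlt.trans (hmin w hw hwa)) hadj h (Ne.symm hwa)
        · exact hu b hlt hadj w (hmin w hw hwa) h
    by_cases hN : W.filter (G.Adj a) = ∅
    · left
      intro e' he' hae'
      rw [hval e' he' hae', hN]; simp
    · right
      intro e' he' hae'
      have h₁ := (hval e' he' hae').trans (hval e he hae).symm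
      refine Prod.ext h₁ (hc.direction e' he' e he h₁ ?_)
      rw [hval e' he' hae', Finset.card_insert_of_notMem (by simp)]
      have := Finset.card_pos.2 (Finset.nonempty_iff_ne_empty.2 hN)
      omega

/-- One step of the division algorithm at the vertex `a`. -/
lemma exists_mem_sub_eq_lin_mul {n d : ℕ} {c : K} {f : MvPolynomial (V ⊕ V) K}
    (hd : IsHom a d f) (ha : a ∈ W)
    (hg : subst a (C c) 1 f ∈ mixedPower G (W.erase a) (n - min (dropCount a c L) d)
      (restricted G W a c d L)) :
    ∃ h ∈ mixedPower G W n L, ∃ q, IsHom a d h ∧ f - h = lin c a * q := by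
  have h₁ := yv_pow_mul_mem ha d n hg
  have h₂ : f ∈ mixedPower G W n L ⊔ Ideal.span {lin c a} := by
    rw [← sub_add_cancel f (yv K a ^ d * subst a (C c) 1 f)]
    exact Ideal.add_mem _ (Ideal.mem_sup_right (hd.sub_mem_span_lin c)) h₁
  obtain ⟨h, hh, q, hq, hfq⟩ := Submodule.mem_sup.1 h₂
  obtain rfl := eq_sub_of_add_eq' hfq
  have hgr : Graded a (Ideal.span {lin c a}) := by
    apply graded_span
    rintro _ rfl
    exact ⟨Polynomial.X, grade_lin_self _ _⟩
  have hq' := hgr.comp_mem hq d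
  obtain ⟨r, hr⟩ := Ideal.mem_span_singleton.1 hq'
  refine ⟨comp a d h, (graded_mixedPower G W L n a).comp_mem hh d, r, isHom_comp _ _ _, ?_⟩
  rw [← hr, comp_sub, hd.comp_eq]

end

/-- Order conditions characterise mixed powers along a good order. -/
theorem OrderCond.mem_mixedPower [Infinite K] {G : SimpleGraph V} [DecidableRel G.Adj]
    {ord : V → ℕ} (ho : GoodOrder G ord) {W : Finset V} {L : List (Finset V × K)}
    (hc : Compatible G ord W L) {n : ℕ} {f : MvPolynomial (V ⊕ V) K}
    (hf : OrderCond G W n L f) : f ∈ mixedPower G W n L := by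
  induction hW : W.card using Nat.strong_induction_on generalizing W L n f with
  | _ N ihW =>
  rcases W.eq_empty_or_nonempty with rfl | hne
  · have h := hf (fun _ => none) (by intro u hu; simp at hu)
    have hcnt : cnt (fun _ => none) L = 0 := by
      simp [cnt, List.countP_eq_zero, Counted]
    have harc : arc ∅ (fun _ => none) f = Polynomial.C f := by
      have : arc ∅ (fun _ => none) = (Polynomial.C : MvPolynomial (V ⊕ V) K →+* _) := by
        apply ringHom_ext_vertex
        · intro c; rw [arc_C]
        · intro v; rw [arc_xv_of_notMem (by simp)]
        · intro v; rw [arc_yv_of_notMem (by simp)]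
      rw [this]
    rw [hcnt, pow_zero, one_mul, harc] at h
    rcases n with _ | n
    · rw [mixedPower_zero]; trivial
    · have h0 := Polynomial.X_pow_dvd_iff.1 h 0 (Nat.succ_pos n)
      rw [Polynomial.coeff_C_zero] at h0
      rw [h0]; exact Ideal.zero_mem _
  · obtain ⟨a, ha, hmin'⟩ := W.exists_min_image ord hne
    have hmin : ∀ w ∈ W, w ≠ a → ord a < ord w := fun w hw hwa =>
      lt_of_le_of_ne (hmin' w hw) (fun h => hwa (ho.inj h).symm)
    have hcl : ∀ u ∈ W, ∀ v ∈ W, G.Adj a u → G.Adj a v → u ≠ v → G.Adj u v :=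
      fun u hu v hv hau hav huv =>
        ho.clique (hmin u hu hau.ne.symm) (hmin v hv hav.ne.symm) hau hav huv
    suffices hom : ∀ d L n f, Compatible G ord W L → IsHom a d f → OrderCond G W n L f →
        f ∈ mixedPower G W n L from
      mem_of_comp_mem (a := a) fun d => hom d L n _ hc (isHom_comp a d f) (hf.comp a d)
    intro d
    induction d using Nat.strong_induction_on with
    | _ d ihd =>
    intro L n f hc hd hf
    have hsub : ∀ e ∈ L, e.1 ⊆ W := fun e he => by
      obtain ⟨b, -, hb⟩ := hc.nbhd e he
      rw [hb]; exact Finset.filter_subset _ _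
    -- it suffices to choose a direction `c` and to divide by `x_a - c y_a`
    have reduce : ∀ c : K, (∀ e ∈ L, Dropped a c e → e.1 = {a}) →
        (∀ d' < d, ∀ q, IsHom a d' q → OrderCond G W n L (lin c a * q) →
          lin c a * q ∈ mixedPower G W n L) → f ∈ mixedPower G W n L := by
      intro c hdrop hdiv
      have hg := ihW _ (by rw [← hW]; exact Finset.card_erase_lt_of_mem ha)
        (hc.restricted ho ha hmin c d) (hf.restrict ha hdrop hd) rfl
      obtain ⟨h, hh, q, hhd, hq⟩ := exists_mem_sub_eq_lin_mul hd ha hg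
      have hqd := hd.sub hhd
      have hqo := hf.sub (orderCond_of_mem hsub hh)
      rw [hq] at hqd hqo
      rw [← sub_add_cancel f h, hq]
      refine Ideal.add_mem _ ?_ hh
      rcases hqd.of_lin_mul with rfl | ⟨d', rfl, hd'⟩
      · rw [mul_zero]; exact Ideal.zero_mem _
      · exact hdiv d' (Nat.lt_succ_self d') q hd' hqo
    by_cases hex : ∃ e ∈ L, a ∈ e.1
    · obtain ⟨e, he, hae⟩ := hex
      have hdich := hc.eq_or_singleton ho ha hmin he hae
      refine reduce e.2 (fun e' he' hd' => ?_) (fun d' hd' q hq hqo => ?_)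
      · rcases hdich with h | h
        · exact h e' he' hd'.1
        · exact absurd (by rw [h e' he' hd'.1]) hd'.2
      · obtain ⟨L₁, L₂, rfl⟩ := List.append_of_mem he
        have hperm : (L₁ ++ e :: L₂).Perm (e :: (L₁ ++ L₂)) := List.perm_middle
        have hsubL : L₁ ++ L₂ ⊆ L₁ ++ e :: L₂ := fun x hx =>
          hperm.symm.subset (List.mem_cons_of_mem _ hx)
        refine mul_mem_mixedPower hperm hae (ihd d' hd' _ _ q (hc.of_subset hsubL) hq ?_)
        refine hqo.of_lin_mul ha hcl hperm hae (hsub e he) ?_ ?_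
        · intro v hv hva
          obtain ⟨b, hb, hbe⟩ := hc.nbhd e he
          rw [hbe, Finset.mem_filter] at hv hae
          exact ho.clique (hc.lt_of_notMem ho ha hb) (hc.lt_of_notMem ho hv.1 hb) hae.2 hv.2
            (Ne.symm hva)
        · exact hdich.imp (fun h => h e he hae) id
    · classical
      obtain ⟨c, hcL⟩ := Infinite.exists_notMem_finset (L.map Prod.snd).toFinset
      have hfree : ∀ e ∈ L, a ∉ e.1 := fun e he h => hex ⟨e, he, h⟩
      refine reduce c (fun e he hd' => absurd hd'.1 (hfree e he)) (fun d' hd' q hq hqo => ?_)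
      refine Ideal.mul_mem_left _ _ (ihd d' hd' L n q hc hq ?_)
      refine hqo.of_lin_mul_of_fresh ha hcl hfree (fun e he h => hcL ?_)
      rw [List.mem_toFinset, List.mem_map]
      exact ⟨e, he, h⟩

end

section Stratum

variable {V k : Type} [Field k] [Fintype V]

/-- The generic arc through the stratum on which the vertices with `s v = none` vanish, and the
remaining ones have generic directions prescribed by the class `s v`. -/
noncomputable def stratumArc (k : Type) [Field k] (s : V → Option V) :
    MvPolynomial (V ⊕ V) k →+* Polynomial (MvPolynomial ((V ⊕ V) ⊕ V) k) :=
  genArc C (fun v => X (Sum.inl (Sum.inl v))) (fun v => X (Sum.inl (Sum.inr v))) Finset.univ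
    (fun v => (s v).map (fun r => X (Sum.inr r)))

/-- The starting point of the generic arc through a stratum. -/
noncomputable def stratumPoint (k : Type) [Field k] (s : V → Option V) :
    MvPolynomial (V ⊕ V) k →+* MvPolynomial ((V ⊕ V) ⊕ V) k :=
  (Polynomial.evalRingHom 0).comp (stratumArc k s)

/-- The prime ideal of a stratum. -/
noncomputable def stratumPrime (k : Type) [Field k] (s : V → Option V) :
    Ideal (MvPolynomial (V ⊕ V) k) :=
  RingHom.ker (stratumPoint k s)

instance stratumPrime_isPrime (s : V → Option V) : (stratumPrime k s).IsPrime :=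
  RingHom.ker_isPrime _

lemma mem_stratumPrime {s : V → Option V} {f : MvPolynomial (V ⊕ V) k} :
    f ∈ stratumPrime k s ↔ stratumPoint k s f = 0 := RingHom.mem_ker

lemma stratumPoint_C (s : V → Option V) (c : k) : stratumPoint k s (C c) = C c := by
  simp [stratumPoint, stratumArc, genArc]

lemma stratumPoint_xv_some {s : V → Option V} {v r : V} (h : s v = some r) :
    stratumPoint k s (xv k v) = X (Sum.inr r) * X (Sum.inl (Sum.inr v)) := by
  simp [stratumPoint, stratumArc, genArc, xv, h]

lemma stratumPoint_yv_some {s : V → Option V} {v r : V} (h : s v = some r) :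
    stratumPoint k s (yv k v) = X (Sum.inl (Sum.inr v)) := by
  simp [stratumPoint, stratumArc, genArc, yv, h]

lemma stratumPoint_xv_none {s : V → Option V} {v : V} (h : s v = none) :
    stratumPoint k s (xv k v) = 0 := by
  simp [stratumPoint, stratumArc, genArc, xv, h]

lemma stratumPoint_yv_none {s : V → Option V} {v : V} (h : s v = none) :
    stratumPoint k s (yv k v) = 0 := by
  simp [stratumPoint, stratumArc, genArc, yv, h]

lemma yv_notMem_stratumPrime {s : V → Option V} {v r : V} (h : s v = some r) :
    yv k v ∉ stratumPrime k s := by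
  rw [mem_stratumPrime, stratumPoint_yv_some h]
  exact X_ne_zero _

lemma minor_notMem_stratumPrime {s : V → Option V} {u v a b : V} (hu : s u = some a)
    (hv : s v = some b) (hab : a ≠ b) :
    xv k u * yv k v - xv k v * yv k u ∉ stratumPrime k s := by
  rw [mem_stratumPrime, map_sub, map_mul, map_mul, stratumPoint_xv_some hu,
    stratumPoint_xv_some hv, stratumPoint_yv_some hu, stratumPoint_yv_some hv]
  have h : (X (Sum.inr a) * X (Sum.inl (Sum.inr u)) * X (Sum.inl (Sum.inr v)) -
      X (Sum.inr b) * X (Sum.inl (Sum.inr v)) * X (Sum.inl (Sum.inr u)) :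
      MvPolynomial ((V ⊕ V) ⊕ V) k) = (X (Sum.inr a) - X (Sum.inr b)) *
      (X (Sum.inl (Sum.inr u)) * X (Sum.inl (Sum.inr v))) := by ring
  rw [h]
  refine mul_ne_zero (sub_ne_zero.2 fun h => hab ?_) (mul_ne_zero (X_ne_zero _) (X_ne_zero _))
  simpa using X_injective h

lemma minor_mem_binomialEdgeIdeal {G : SimpleGraph V} {u v : V} (h : G.Adj u v) :
    xv k u * yv k v - xv k v * yv k u ∈ binomialEdgeIdeal k G :=
  Ideal.subset_span ⟨u, v, h, rfl⟩

lemma binomialEdgeIdeal_le_stratumPrime {G : SimpleGraph V} {s : V → Option V}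
    (hs : ∀ u v a b, G.Adj u v → s u = some a → s v = some b → a = b) :
    binomialEdgeIdeal k G ≤ stratumPrime k s := by
  refine Ideal.span_le.2 ?_
  rintro _ ⟨u, v, huv, rfl⟩
  change xv k u * yv k v - xv k v * yv k u ∈ stratumPrime k s
  rw [mem_stratumPrime, map_sub, map_mul, map_mul]
  rcases hu : s u with _ | a
  · simp [stratumPoint_xv_none hu, stratumPoint_yv_none hu]
  rcases hv : s v with _ | b
  · simp [stratumPoint_xv_none hv, stratumPoint_yv_none hv]
  rw [stratumPoint_xv_some hu, stratumPoint_xv_some hv, stratumPoint_yv_some hu,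
    stratumPoint_yv_some hv, hs u v a b huv hu hv]
  ring

/-- A stratum is a component of the zero set when its classes are connected and every vanishing
vertex sees two different classes. -/
lemma stratumPrime_mem_minimalPrimes {G : SimpleGraph V} {s : V → Option V}
    (hs : ∀ u v a b, G.Adj u v → s u = some a → s v = some b → a = b)
    (hrep : ∀ v r, s v = some r → s r = some r)
    (hconn : ∀ v r, s v = some r →
      Relation.ReflTransGen (fun a b => G.Adj a b ∧ s a = some r) r v)
    (hcut : ∀ t, s t = none → ∃ u v a b, G.Adj t u ∧ G.Adj t v ∧ s u = some a ∧ s v = some b ∧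
      a ≠ b) :
    stratumPrime k s ∈ (binomialEdgeIdeal k G).minimalPrimes := by
  refine ⟨⟨inferInstance, binomialEdgeIdeal_le_stratumPrime hs⟩, ?_⟩
  rintro Q ⟨hQ, hJQ⟩ hQP
  have hedge : ∀ {u v}, G.Adj u v → xv k u * yv k v - xv k v * yv k u ∈ Q := fun h =>
    hJQ (minor_mem_binomialEdgeIdeal h)
  have hyQ : ∀ {v r}, s v = some r → yv k v ∉ Q := fun h hv =>
    yv_notMem_stratumPrime h (hQP hv)
  have hclass : ∀ v r, s v = some r → xv k r * yv k v - xv k v * yv k r ∈ Q := by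
    intro v r hv
    have := hconn v r hv
    clear hv
    induction this with
    | refl => simp
    | @tail b c _ hbc ih =>
      have h : yv k b * (xv k r * yv k c - xv k c * yv k r) ∈ Q := by
        have e : yv k b * (xv k r * yv k c - xv k c * yv k r) =
          yv k c * (xv k r * yv k b - xv k b * yv k r) +
          yv k r * (xv k b * yv k c - xv k c * yv k b) := by ring
        rw [e]
        exact Q.add_mem (Q.mul_mem_left _ ih) (Q.mul_mem_left _ (hedge hbc.1))
      exact (hQ.mem_or_mem h).resolve_left (hyQ hbc.2)
  have hzero : ∀ t, s t = none → xv k t ∈ Q ∧ yv k t ∈ Q := by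
    intro t ht
    obtain ⟨u, v, a, b, htu, htv, hu, hv, hab⟩ := hcut t ht
    have hm := fun h => minor_notMem_stratumPrime (k := k) hu hv hab (hQP h)
    constructor
    · have h : xv k t * (xv k u * yv k v - xv k v * yv k u) ∈ Q := by
        have e : xv k t * (xv k u * yv k v - xv k v * yv k u) =
          xv k u * (xv k t * yv k v - xv k v * yv k t) -
          xv k v * (xv k t * yv k u - xv k u * yv k t) := by ring
        rw [e]
        exact Q.sub_mem (Q.mul_mem_left _ (hedge htv)) (Q.mul_mem_left _ (hedge htu))
      exact (hQ.mem_or_mem h).resolve_right hm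
    · have h : yv k t * (xv k u * yv k v - xv k v * yv k u) ∈ Q := by
        have e : yv k t * (xv k u * yv k v - xv k v * yv k u) =
          yv k u * (xv k t * yv k v - xv k v * yv k t) -
          yv k v * (xv k t * yv k u - xv k u * yv k t) := by ring
        rw [e]
        exact Q.sub_mem (Q.mul_mem_left _ (hedge htv)) (Q.mul_mem_left _ (hedge htu))
      exact (hQ.mem_or_mem h).resolve_right hm
  let F := FractionRing (MvPolynomial (V ⊕ V) k ⧸ Q)
  let μ : MvPolynomial (V ⊕ V) k →+* F :=
    (algebraMap (MvPolynomial (V ⊕ V) k ⧸ Q) F).comp (Ideal.Quotient.mk Q)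
  have hμ : ∀ f, μ f = 0 ↔ f ∈ Q := by
    intro f
    rw [← Ideal.Quotient.eq_zero_iff_mem]
    exact IsFractionRing.to_map_eq_zero_iff (R := MvPolynomial (V ⊕ V) k ⧸ Q) (K := F)
  let Ψ : MvPolynomial ((V ⊕ V) ⊕ V) k →+* F := eval₂Hom (μ.comp C)
    (Sum.elim (Sum.elim (fun _ => 0) (fun v => μ (yv k v)))
      (fun r => μ (xv k r) / μ (yv k r)))
  have hΨ : Ψ.comp (stratumPoint k s) = μ := by
    apply ringHom_ext_vertex
    · intro c
      simp [stratumPoint_C, Ψ]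
    · intro v
      rcases hv : s v with _ | r
      · rw [RingHom.comp_apply, stratumPoint_xv_none hv, map_zero, (hμ _).2 (hzero v hv).1]
      · rw [RingHom.comp_apply, stratumPoint_xv_some hv, map_mul]
        have h1 : Ψ (X (Sum.inr r)) = μ (xv k r) / μ (yv k r) := by simp [Ψ]
        have h2 : Ψ (X (Sum.inl (Sum.inr v))) = μ (yv k v) := by simp [Ψ]
        have hr : μ (yv k r) ≠ 0 := fun h => hyQ (hrep v r hv) ((hμ _).1 h)
        have h3 := (hμ _).2 (hclass v r hv)
        rw [map_sub, map_mul, map_mul, sub_eq_zero] at h3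
        rw [h1, h2, div_mul_eq_mul_div, h3, mul_div_cancel_right₀ _ hr]
    · intro v
      rcases hv : s v with _ | r
      · rw [RingHom.comp_apply, stratumPoint_yv_none hv, map_zero, (hμ _).2 (hzero v hv).2]
      · rw [RingHom.comp_apply, stratumPoint_yv_some hv]
        simp [Ψ]
  intro f hf
  rw [← hμ, ← hΨ, RingHom.comp_apply, mem_stratumPrime.1 hf, map_zero]

lemma X_dvd_stratumArc_iff {s : V → Option V} {f : MvPolynomial (V ⊕ V) k} :
    Polynomial.X ∣ stratumArc k s f ↔ f ∈ stratumPrime k s := by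
  rw [Polynomial.X_dvd_iff, mem_stratumPrime, stratumPoint, RingHom.comp_apply,
    Polynomial.coe_evalRingHom, Polynomial.coeff_zero_eq_eval_zero]

lemma X_pow_dvd_stratumArc {G : SimpleGraph V} {s : V → Option V}
    (hs : stratumPrime k s ∈ (binomialEdgeIdeal k G).minimalPrimes) {n : ℕ}
    {f : MvPolynomial (V ⊕ V) k} (hf : f ∈ symbolicPower (binomialEdgeIdeal k G) n) :
    Polynomial.X ^ n ∣ stratumArc k s f := by
  have h := (Ideal.mem_iInf.1 ((Ideal.mem_iInf.1 hf) (stratumPrime k s))) hs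
  rw [Ideal.mem_comap,
    IsLocalization.algebraMap_mem_map_algebraMap_iff (stratumPrime k s).primeCompl] at h
  obtain ⟨q, hq, hqf⟩ := h
  have hle : (binomialEdgeIdeal k G ^ n).map (stratumArc k s) ≤
      Ideal.span {Polynomial.X ^ n} := by
    rw [Ideal.map_pow, ← Ideal.span_singleton_pow]
    refine Ideal.pow_right_mono (Ideal.map_le_iff_le_comap.2 fun g hg => ?_) n
    exact Ideal.mem_span_singleton.2 (X_dvd_stratumArc_iff.2 (hs.1.2 hg))
  have h := Ideal.mem_span_singleton.1 (hle (Ideal.mem_map_of_mem _ hqf))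
  rw [map_mul] at h
  refine (Polynomial.prime_X.pow_dvd_of_dvd_mul_left n ?_ h)
  exact fun h => hq (X_dvd_stratumArc_iff.1 h)

end Stratum

section Extension

variable {V k K : Type} [Field k] [Field K] [Algebra k K]

lemma genArc_map {A : Type} [CommRing A] (φ : K →+* A) (x y : V → A) (W : Finset V)
    (κ : V → Option A) (f : MvPolynomial (V ⊕ V) k) :
    genArc φ x y W κ (MvPolynomial.map (algebraMap k K) f) =
      genArc (φ.comp (algebraMap k K)) x y W κ f := by
  rw [genArc, genArc, coe_eval₂Hom, coe_eval₂Hom, eval₂_map, RingHom.comp_assoc]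

variable [Fintype V]

/-- The directions of a labelling specialise the generic arc to the arc of the labelling. -/
lemma map_stratumArc {κ : V → Option K} {s : V → Option V} (hκs : ∀ v, s v = none ↔ κ v = none)
    (hlabel : ∀ v r, s v = some r → κ v = κ r) {n : ℕ} {f : MvPolynomial (V ⊕ V) k}
    (hf : Polynomial.X ^ n ∣ stratumArc k s f) :
    Polynomial.X ^ n ∣ arc Finset.univ κ (MvPolynomial.map (algebraMap k K) f) := by
  let ψ : MvPolynomial ((V ⊕ V) ⊕ V) k →+* MvPolynomial (V ⊕ V) K :=
    eval₂Hom (C.comp (algebraMap k K))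
      (Sum.elim (Sum.elim (xv K) (yv K)) (fun r => C ((κ r).getD 0)))
  have h := map_dvd (Polynomial.mapRingHom ψ) hf
  rw [map_pow, Polynomial.coe_mapRingHom, Polynomial.map_X, stratumArc, map_genArc] at h
  rw [arc_eq_genArc, genArc_map]
  convert h using 2
  congr 1
  · ext c : 1
    simp [ψ]
  · funext v; simp [ψ]
  · funext v; simp [ψ]
  · funext v
    rcases hv : s v with _ | r
    · simp [(hκs v).1 hv]
    · rcases hk : κ v with _ | c
      · rw [(hκs v).2 hk] at hv; cases hv
      · have hr : κ r = some c := by rw [← hlabel v r hv, hk]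
        simp [ψ, hr]

/-- Every element of a symbolic power vanishes to the right order along every arc. -/
lemma dvd_arc_of_mem_symbolicPower {G : SimpleGraph V} {n : ℕ} {f : MvPolynomial (V ⊕ V) k}
    (hf : f ∈ symbolicPower (binomialEdgeIdeal k G) n) {κ : V → Option K}
    (hκ : Admissible G Finset.univ κ) :
    Polynomial.X ^ n ∣ arc Finset.univ κ (MvPolynomial.map (algebraMap k K) f) := by
  classical
  induction hN : (Finset.univ.filter fun v => κ v = none).card using Nat.strong_induction_on
    generalizing κ with
  | _ N ih =>
    by_cases hfill : ∃ t, κ t = none ∧ ∃ c, ∀ v, G.Adj t v → ∀ c', κ v = some c' → c' = c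
    · obtain ⟨t, ht, c, hc⟩ := hfill
      have h := ih _ ?_ (κ := Function.update κ t (some c))
        (Admissible.update (fun u hu v hv => hκ u (Finset.mem_univ u) v (Finset.mem_univ v))
          fun v _ => hc v) rfl
      · have := dvd_arc_of_update (m := 0) (Finset.mem_univ t) ht (c := c) (n := n)
          (f := MvPolynomial.map (algebraMap k K) f) (by simpa using h)
        simpa using this
      · rw [← hN]
        refine Finset.card_lt_card (Finset.ssubset_iff_of_subset ?_ |>.2 ⟨t, ?_, ?_⟩)
        · intro v hv
          by_cases hvt : v = t
          · subst hvt; simpa using ht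
          · simpa [hvt] using hv
        · simpa using ht
        · simp
    · push Not at hfill
      let H : SimpleGraph V :=
        { Adj := fun u v => G.Adj u v ∧ κ u ≠ none ∧ κ v ≠ none
          symm := ⟨fun u v h => ⟨h.1.symm, h.2.2, h.2.1⟩⟩
          loopless := ⟨fun u h => G.loopless.irrefl u h.1⟩ }
      let s : V → Option V := fun v =>
        if κ v = none then none else some (H.connectedComponentMk v).out
      have hnone : ∀ v, s v = none ↔ κ v = none := by
        intro v; by_cases h : κ v = none <;> simp [s, h]
      have hsome : ∀ {v r}, s v = some r → κ v ≠ none ∧ (H.connectedComponentMk v).out = r := by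
        intro v r h
        by_cases h' : κ v = none
        · simp [s, h'] at h
        · exact ⟨h', by simpa [s, h'] using h⟩
      have hreach : ∀ {u v}, H.Reachable u v → κ u = κ v := by
        rintro u v ⟨p⟩
        induction p with
        | nil => rfl
        | cons h p ih' =>
          rw [← ih']
          obtain ⟨c, hc⟩ := Option.ne_none_iff_exists'.1 h.2.1
          obtain ⟨d, hd⟩ := Option.ne_none_iff_exists'.1 h.2.2
          rw [hc, hd, hκ _ (Finset.mem_univ _) _ (Finset.mem_univ _) h.1 c d hc hd]
      have hout : ∀ {v r}, s v = some r → H.Reachable r v := by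
        intro v r h
        apply SimpleGraph.ConnectedComponent.exact
        rw [← (hsome h).2]
        exact Quot.out_eq _
      have hsreach : ∀ {u v}, H.Reachable u v → s u = s v := by
        intro u v h
        have h1 := hreach h
        have h2 := SimpleGraph.ConnectedComponent.sound h
        simp only [s, h1, h2]
      refine map_stratumArc (s := s) hnone (fun v r h => (hreach (hout h)).symm)
        (X_pow_dvd_stratumArc (stratumPrime_mem_minimalPrimes ?_ ?_ ?_ ?_) hf)
      · intro u v a b huv hu hv
        have : H.Adj u v := ⟨huv, (hsome hu).1, (hsome hv).1⟩
        rw [hsreach this.reachable, hv] at hu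
        exact (Option.some.inj hu).symm
      · intro v r h
        rw [hsreach (hout h), h]
      · intro v r h
        obtain ⟨p⟩ := hout h
        have hr : s r = some r := by rw [hsreach (hout h), h]
        have key : ∀ {a b} (p : H.Walk a b), s a = some r →
            Relation.ReflTransGen (fun a b => G.Adj a b ∧ s a = some r) a b := by
          intro a b p
          induction p with
          | nil => exact fun _ => .refl
          | cons e p ih' =>
            intro ha
            exact .head ⟨e.1, ha⟩ (ih' (by rw [← hsreach e.reachable, ha]))
        exact key p hr
      · intro t ht
        have ht' := (hnone t).1 ht
        obtain ⟨u, hu, c, huc, -⟩ := hfill t ht' 0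
        obtain ⟨v, hv, d, hvd, hcd⟩ := hfill t ht' c
        have hu' : s u = some (H.connectedComponentMk u).out := by simp [s, huc]
        have hv' : s v = some (H.connectedComponentMk v).out := by simp [s, hvd]
        refine ⟨u, v, _, _, hu, hv, hu', hv', fun h => hcd ?_⟩
        have h1 := hreach (hout hu')
        have h2 := hreach (hout hv')
        rw [h, h2, hvd, huc] at h1
        exact Option.some.inj h1

lemma edgeIdeal_univ_eq_map (G : SimpleGraph V) :
    edgeIdeal K G Finset.univ =
      (binomialEdgeIdeal k G).map (MvPolynomial.map (algebraMap k K)) := by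
  rw [edgeIdeal, binomialEdgeIdeal, Ideal.map_span]
  congr 1
  ext f
  constructor
  · rintro ⟨i, -, j, -, h, rfl⟩
    exact ⟨_, ⟨i, j, h, rfl⟩, by simp [xv, yv]⟩
  · rintro ⟨_, ⟨i, j, h, rfl⟩, rfl⟩
    exact ⟨i, Finset.mem_univ i, j, Finset.mem_univ j, h, by simp [xv, yv]⟩

end Extension

/-- Ideals of polynomial rings are contracted from field extensions. -/
lemma mem_of_map_mem_map {σ k K : Type} [Field k] [Field K] [Algebra k K]
    {I : Ideal (MvPolynomial σ k)} {f : MvPolynomial σ k}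
    (h : MvPolynomial.map (algebraMap k K) f ∈ I.map (MvPolynomial.map (algebraMap k K))) :
    f ∈ I := by
  let S := MvPolynomial σ k
  let θ : MvPolynomial σ K →+* TensorProduct k S K :=
    ((Algebra.TensorProduct.comm k K S).toRingEquiv.toRingHom).comp
      (algebraTensorAlgEquiv (σ := σ) k K).symm.toRingEquiv.toRingHom
  have hθ : θ.comp (MvPolynomial.map (algebraMap k K)) =
      algebraMap S (TensorProduct k S K) := by
    apply RingHom.ext
    intro x
    have := algebraTensorAlgEquiv_symm_map (σ := σ) (R := k) (A := K) x
    change Algebra.TensorProduct.comm k K S ((algebraTensorAlgEquiv k K).symm _) = _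
    rw [this]
    rfl
  have h' := Ideal.mem_map_of_mem θ h
  rw [Ideal.map_map, hθ, ← RingHom.comp_apply, hθ] at h'
  rw [← Ideal.comap_map_eq_self_of_faithfullyFlat (B := TensorProduct k S K) I]
  exact h'

lemma pow_le_symbolicPower {S : Type} [CommRing S] (I : Ideal S) (n : ℕ) :
    I ^ n ≤ symbolicPower I n :=
  le_iInf fun _ => le_iInf fun _ => Ideal.le_comap_map

/-- Ordinary and symbolic powers of the binomial edge ideal of a graph with a good vertex ordering
coincide. -/
theorem GoodOrder.pow_eq_symbolicPower {V : Type} [Fintype V] {G : SimpleGraph V} {ord : V → ℕ}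
    (ho : GoodOrder G ord) (k : Type) [Field k] (n : ℕ) :
    binomialEdgeIdeal k G ^ n = symbolicPower (binomialEdgeIdeal k G) n := by
  classical
  refine le_antisymm (pow_le_symbolicPower _ n) fun f hf => ?_
  let K := AlgebraicClosure k
  have : Infinite K := IsAlgClosed.instInfinite
  have hord : OrderCond G Finset.univ n ([] : List (Finset V × K))
      (MvPolynomial.map (algebraMap k K) f) := by
    intro κ hκ
    exact Dvd.dvd.mul_left (dvd_arc_of_mem_symbolicPower hf hκ) _
  have hc : Compatible G ord Finset.univ ([] : List (Finset V × K)) :=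
    ⟨fun _ _ w _ => Finset.mem_univ w, by simp, by simp⟩
  have h : MvPolynomial.map (algebraMap k K) f ∈ edgeIdeal K G Finset.univ ^ n :=
    hord.mem_mixedPower ho hc
  rw [edgeIdeal_univ_eq_map (k := k), ← Ideal.map_pow] at h
  exact mem_of_map_mem_map h

/-- A rooted description of a graph: `t` sends a vertex to its parent, and siblings are grouped
into cliques according to `cl`. -/
structure RootedCliques {V γ : Type} (G : SimpleGraph V) (t : V → Option V) (cl : V → γ)
    (δ : V → ℕ) : Prop where
  adj : ∀ {a b}, G.Adj a b ↔ a ≠ b ∧ (t a = some b ∨ t b = some a ∨ cl a = cl b)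
  depth_lt : ∀ {a b}, t a = some b → δ b < δ a
  parent_eq : ∀ {a b}, cl a = cl b → t a = t b
  depth_eq : ∀ {a b}, cl a = cl b → δ a = δ b

/-- No two vertices of a clique of siblings both have children. -/
def SingleBusy {V γ : Type} (t : V → Option V) (cl : V → γ) : Prop :=
  ∀ a b c d, cl a = cl b → a ≠ b → t c = some a → t d = some b → False

lemma exists_order {V : Type} [Fintype V] (δ : V → ℕ) (busy : V → Prop) :
    ∃ ord : V → ℕ, Function.Injective ord ∧ (∀ a b, δ b < δ a → ord a < ord b) ∧
      (∀ a b, δ a = δ b → busy a → ¬ busy b → ord a < ord b) := by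
  classical
  obtain ⟨M, hM⟩ : ∃ M, ∀ v, δ v ≤ M := ⟨Finset.univ.sup δ, fun v => Finset.le_sup (by simp)⟩
  let e := Fintype.equivFin V
  let N := Fintype.card V
  let r : V → ℕ := fun v => 2 * (M - δ v) + if busy v then 0 else 1
  have key : ∀ a b, r a < r b → r a * N + e a < r b * N + e b := by
    intro a b h
    have h1 : (r a + 1) * N ≤ r b * N := Nat.mul_le_mul_right N h
    have h2 : (e a : ℕ) < N := (e a).2
    rw [Nat.add_mul] at h1
    omega
  refine ⟨fun v => r v * N + e v, ?_, fun a b h => key a b ?_, fun a b h ha hb => key a b ?_⟩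
  · intro a b h
    dsimp only at h
    rcases lt_trichotomy (r a) (r b) with h' | h' | h'
    · exact absurd h (key a b h').ne
    · rw [h'] at h
      exact e.injective (Fin.ext (by omega))
    · exact absurd h (key b a h').ne'
  · have := hM a
    dsimp only [r]
    split_ifs <;> omega
  · simp [r, ha, hb, h]

section Rooted

variable {V γ : Type} {G : SimpleGraph V} {t : V → Option V} {cl : V → γ} {δ : V → ℕ}

lemma RootedCliques.exists_goodOrder [Fintype V] (h : RootedCliques G t cl δ)
    (hb : SingleBusy t cl) : ∃ ord, GoodOrder G ord := by
  obtain ⟨ord, hinj, hdepth, hbusy⟩ := exists_order δ (fun v => ∃ c, t c = some v)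
  have later : ∀ {a w}, ord a < ord w → G.Adj a w → t a = some w ∨ (a ≠ w ∧ cl a = cl w) := by
    intro a w haw hadj
    obtain ⟨hne, h1 | h1 | h1⟩ := h.adj.1 hadj
    · exact Or.inl h1
    · exact absurd (hdepth _ _ (h.depth_lt h1)) haw.not_gt
    · exact Or.inr ⟨hne, h1⟩
  have clique_adj : ∀ {a u w}, (t a = some u ∨ cl a = cl u) → (t a = some w ∨ cl a = cl w) →
      u ≠ w → G.Adj u w := by
    intro a u w hu hw huw
    refine h.adj.2 ⟨huw, ?_⟩
    rcases hu with hu | hu <;> rcases hw with hw | hw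
    · rw [hu] at hw; exact absurd (Option.some.inj hw) huw
    · rw [h.parent_eq hw] at hu; exact Or.inr (Or.inl hu)
    · rw [h.parent_eq hu] at hw; exact Or.inl hw
    · exact Or.inr (Or.inr (hu.symm.trans hw))
  refine ⟨ord, hinj, ?_, ?_, ?_⟩
  · intro a u w hau haw hu hw huw
    exact clique_adj ((later hau hu).imp_right And.right) ((later haw hw).imp_right And.right) huw
  · intro a
    by_cases ha : ∃ c, t c = some a
    · left
      intro b hba hadj w haw hbw
      have h1 : t b = some a := by
        refine (later hba hadj).resolve_right fun h1 => ?_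
        have : ¬ ∃ d, t d = some b := by
          rintro ⟨d, hd⟩
          obtain ⟨c, hc⟩ := ha
          exact hb b a d c h1.2 h1.1 hd hc
        exact hba.not_gt (hbusy a b (h.depth_eq h1.2).symm ha this)
      rcases later (hba.trans haw) hbw with h2 | h2
      · rw [h1] at h2; cases h2; exact lt_irrefl _ haw
      · have h3 := h.depth_lt h1
        rw [h.depth_eq h2.2] at h3
        exact haw.not_gt (hdepth _ _ h3)
    · right
      intro b hba hadj w haw hw
      have h1 : cl b = cl a :=
        ((later hba hadj).resolve_left fun h1 => ha ⟨b, h1⟩).2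
      exact clique_adj (Or.inr h1.symm) ((later haw hw).imp_right And.right)
        (fun e => (hba.trans haw).ne (congrArg ord e))
  · intro b a w₁ w₂ hba h₁ h₂ hne ha₁ ha₂ hb₁ hb₂
    have key : ∀ {w w'}, ord a < ord w → ord a < ord w' → w ≠ w' → G.Adj b w → G.Adj b w' →
        cl a = cl w → G.Adj a b := by
      intro w w' hw hw' hne hbw hbw' hcl
      rcases later (hba.trans hw) hbw with h3 | h3
      · rcases later (hba.trans hw') hbw' with h4 | h4
        · rw [h3] at h4; exact absurd (Option.some.inj h4) hne
        · have h5 := h.depth_lt h3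
          rw [h.depth_eq h4.2, ← h.depth_eq hcl] at h5
          exact absurd hw' (hdepth _ _ h5).not_gt
      · exact h.adj.2 ⟨fun e => hba.ne (congrArg ord e.symm),
          Or.inr (Or.inr (hcl.trans h3.2.symm))⟩
    rcases later h₁ ha₁ with h3 | h3
    · rcases later h₂ ha₂ with h4 | h4
      · rw [h3] at h4; exact absurd (Option.some.inj h4) hne
      · exact key h₂ h₁ hne.symm hb₂ hb₁ h4.2
    · exact key h₁ h₂ hne hb₁ hb₂ h3.2

end Rooted

lemma netGraph_adj {a b : Fin 6} : netGraph.Adj a b ↔ a ≠ b ∧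
    (((a = 0 ∧ b = 1) ∨ (a = 1 ∧ b = 2) ∨ (a = 0 ∧ b = 2) ∨
      (a = 0 ∧ b = 3) ∨ (a = 1 ∧ b = 4) ∨ (a = 2 ∧ b = 5)) ∨
     ((b = 0 ∧ a = 1) ∨ (b = 1 ∧ a = 2) ∨ (b = 0 ∧ a = 2) ∨
      (b = 0 ∧ a = 3) ∨ (b = 1 ∧ a = 4) ∨ (b = 2 ∧ a = 5))) := by
  rw [netGraph, SimpleGraph.fromRel_adj]

instance : DecidableRel netGraph.Adj := fun _ _ => decidable_of_iff _ netGraph_adj.symm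

lemma netGraph_eq_of_forall_adj_iff :
    ∀ i j, (∀ k, netGraph.Adj i k ↔ netGraph.Adj j k) → i = j := by
  decide

lemma false_of_net {V : Type} {G : SimpleGraph V} (hG : NetFree G) {a b c a' b' c' : V}
    (hab : G.Adj a b) (hbc : G.Adj b c) (hac : G.Adj a c)
    (ha : G.Adj a a') (hb : G.Adj b b') (hc : G.Adj c c')
    (hab' : ¬ G.Adj a b') (hac' : ¬ G.Adj a c') (hba' : ¬ G.Adj b a') (hbc' : ¬ G.Adj b c')
    (hca' : ¬ G.Adj c a') (hcb' : ¬ G.Adj c b')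
    (h₁ : ¬ G.Adj a' b') (h₂ : ¬ G.Adj b' c') (h₃ : ¬ G.Adj a' c') : False := by
  have hmap : ∀ i j : Fin 6, G.Adj (![a, b, c, a', b', c'] i) (![a, b, c, a', b', c'] j) ↔
      netGraph.Adj i j := by
    have hs : ∀ {u v}, ¬ G.Adj u v → ¬ G.Adj v u := fun h h' => h h'.symm
    intro i j
    rw [netGraph_adj]
    fin_cases i <;> fin_cases j <;>
      simp [hab, hbc, hac, ha, hb, hc, hab.symm, hbc.symm, hac.symm, ha.symm, hb.symm, hc.symm,
        hab', hac', hba', hbc', hca', hcb', h₁, h₂, h₃, hs hab', hs hac', hs hba', hs hbc',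
        hs hca', hs hcb', hs h₁, hs h₂, hs h₃]
  refine hG.false ⟨⟨![a, b, c, a', b', c'], fun i j hij => ?_⟩, hmap _ _⟩
  refine netGraph_eq_of_forall_adj_iff i j fun k => ?_
  rw [← hmap, ← hmap, hij]

section Reroot

variable {V γ : Type} {G : SimpleGraph V} {t : V → Option V} {cl : V → γ} {δ : V → ℕ}

/-- In a net-free graph, a clique with two busy vertices hangs alone below the root. -/
lemma RootedCliques.root_of_two_busy (h : RootedCliques G t cl δ) (hnet : NetFree G)
    (hroot : ∀ a b, t a = none → t b = none → a = b) {a b c d : V} (hab : cl a = cl b)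
    (hne : a ≠ b) (hc : t c = some a) (hd : t d = some b) :
    ∃ u, t a = some u ∧ t u = none ∧ ∀ e, t e = some u → cl e = cl a := by
  have hpar := h.parent_eq hab
  have hdep := h.depth_eq hab
  have hδ : ∀ {a b}, t a = some b → δ b < δ a := h.depth_lt
  obtain ⟨u, hu⟩ : ∃ u, t a = some u := by
    rcases ht : t a with _ | u
    · exact absurd (hroot a b ht (hpar ▸ ht)) hne
    · exact ⟨u, rfl⟩
  have hub : t b = some u := hpar ▸ hu
  have d1 := hδ hc
  have d2 := hδ hd
  have d3 := hδ hu
  have hcl : ∀ {a b}, cl a = cl b → t a = t b ∧ δ a = δ b :=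
    fun e => ⟨h.parent_eq e, h.depth_eq e⟩
  have adj : ∀ {a b}, G.Adj a b ↔ a ≠ b ∧ (t a = some b ∨ t b = some a ∨ cl a = cl b) := h.adj
  have key : ∀ e, G.Adj u e → ¬ G.Adj a e → ¬ G.Adj b e → ¬ G.Adj c e → ¬ G.Adj d e → False := by
    intro e h1 h2 h3 h4 h5
    refine false_of_net hnet (a := a) (b := b) (c := u) (a' := c) (b' := d) (c' := e)
      ?_ ?_ ?_ ?_ ?_ h1 ?_ h2 ?_ h3 ?_ ?_ ?_ h5 h4 <;> rw [adj] <;> grind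
  refine ⟨u, hu, ?_, ?_⟩
  · by_contra hne'
    obtain ⟨e, he⟩ := Option.ne_none_iff_exists'.1 hne'
    have d4 := hδ he
    apply key e <;> rw [adj] <;> grind
  · intro e he
    by_contra hce
    have d4 := hδ he
    apply key e <;> rw [adj] <;> grind

lemma RootedCliques.not_three_busy (h : RootedCliques G t cl δ) (hnet : NetFree G)
    {a b c a' b' c' : V} (hab : cl a = cl b) (hac : cl a = cl c) (h₁ : a ≠ b) (h₂ : a ≠ c)
    (h₃ : b ≠ c) (ha : t a' = some a) (hb : t b' = some b) (hc : t c' = some c) : False := by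
  have hcl : ∀ {a b}, cl a = cl b → t a = t b ∧ δ a = δ b :=
    fun e => ⟨h.parent_eq e, h.depth_eq e⟩
  have hδ : ∀ {a b}, t a = some b → δ b < δ a := h.depth_lt
  have d1 := h.depth_lt ha
  have d2 := h.depth_lt hb
  have d3 := h.depth_lt hc
  have d4 := h.depth_eq hab
  have d5 := h.depth_eq hac
  have adj : ∀ {a b}, G.Adj a b ↔ a ≠ b ∧ (t a = some b ∨ t b = some a ∨ cl a = cl b) := h.adj
  refine false_of_net hnet (a := a) (b := b) (c := c) (a' := a') (b' := b') (c' := c')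
      ?_ ?_ ?_ ?_ ?_ ?_ ?_ ?_ ?_ ?_ ?_ ?_ ?_ ?_ ?_ <;> rw [adj] <;> grind

/-- A net-free graph with a rooted description can be rerooted so that no clique has two busy
vertices. -/
lemma RootedCliques.exists_singleBusy (h : RootedCliques G t cl δ) (hnet : NetFree G)
    (hroot : ∀ a b, t a = none → t b = none → a = b) :
    ∃ (t' : V → Option V) (cl' : V → γ) (δ' : V → ℕ),
      RootedCliques G t' cl' δ' ∧ SingleBusy t' cl' := by
  classical
  by_cases hb : SingleBusy t cl
  · exact ⟨t, cl, δ, h, hb⟩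
  simp only [SingleBusy, not_forall] at hb
  obtain ⟨a, b, c, d, hab, hne, hc, hd, -⟩ := hb
  obtain ⟨u, hu, hu0, hchild⟩ := h.root_of_two_busy hnet hroot hab hne hc hd
  have hδ : ∀ {a b}, t a = some b → δ b < δ a := h.depth_lt
  have hcl : ∀ {a b}, cl a = cl b → t a = t b ∧ δ a = δ b :=
    fun e => ⟨h.parent_eq e, h.depth_eq e⟩
  have d1 := hδ hu
  have hau : a ≠ u := by rintro rfl; exact lt_irrefl _ d1
  have hcau : cl a ≠ cl u := fun e => d1.ne (hcl e).2.symm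
  have hualone : ∀ v, cl v = cl u → v = u := fun v hv => hroot v u ((hcl hv).1.trans hu0) hu0
  have hclass : ∀ v, cl v = cl a → t v = some u := fun v hv => (hcl hv).1.trans hu
  let t' : V → Option V := fun v =>
    if v = a then none else if v = u ∨ cl v = cl a then some a else t v
  let cl' : V → γ := fun v => if v = a then cl u else if v = u then cl a else cl v
  let δ' : V → ℕ := fun v => if v = a then 0 else if v = u then δ a else δ v
  refine ⟨t', cl', δ', ⟨?_, ?_, ?_, ?_⟩, ?_⟩
  · intro p q
    rw [h.adj]
    simp only [t', cl']
    grind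
  · intro p q
    simp only [t', δ']
    grind
  · intro p q
    simp only [t', cl']
    grind
  · intro p q
    simp only [δ', cl']
    grind
  · intro x y p q hxy hne' hp hq
    have hx : x ≠ a := by simp only [cl'] at hxy; grind
    have hy : y ≠ a := by simp only [cl'] at hxy; grind
    have hp' : t p = some x := by simp only [t'] at hp; grind
    have hq' : t q = some y := by simp only [t'] at hq; grind
    have hxu : x ≠ u := by simp only [t'] at hp; grind
    have hyu : y ≠ u := by simp only [t'] at hq; grind
    have hxy' : cl x = cl y := by simpa [cl', hx, hy, hxu, hyu] using hxy
    obtain ⟨u', hu', hu'0, -⟩ := h.root_of_two_busy hnet hroot hxy' hne' hp' hq'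
    have hxa : cl x = cl a := hchild x (hroot u' u hu'0 hu0 ▸ hu')
    exact h.not_three_busy hnet hxa.symm (hxa.symm.trans hxy') hx.symm hy.symm hne' hc hp' hq'

end Reroot

lemma eq_of_isPath {V : Type} {H : SimpleGraph V} (hH : H.IsTree) {u v : V}
    {p q : H.Walk u v} (hp : p.IsPath) (hq : q.IsPath) : p = q :=
  congrArg Subtype.val ((hH.isAcyclic.subsingleton_path u v).elim ⟨p, hp⟩ ⟨q, hq⟩)

lemma length_eq_dist_of_isPath {V : Type} {H : SimpleGraph V} (hH : H.IsTree) {u v : V}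
    {p : H.Walk u v} (hp : p.IsPath) : p.length = H.dist u v := by
  obtain ⟨q, hq, hl⟩ := (hH.connected u v).exists_path_of_dist
  rw [← hl, eq_of_isPath hH hp hq]

/-- The parent function of a tree rooted at `u`. -/
lemma exists_parent {V : Type} {H : SimpleGraph V} (hH : H.IsTree) (u : V) :
    ∃ t : V → Option V, (∀ a b, H.Adj a b ↔ t a = some b ∨ t b = some a) ∧
      (∀ a b, t a = some b → H.dist u a = H.dist u b + 1) ∧ (∀ a, t a = none → a = u) := by
  classical
  choose q hq hl using fun v => (hH.connected u v).exists_path_of_dist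
  have huniq : ∀ {v} (p : H.Walk u v), p.IsPath → p = q v := fun {v} p hp =>
    eq_of_isPath hH hp (hq v)
  let t : V → Option V := fun v => if v = u then none else some (q v).penultimate
  have hfar : ∀ {a b}, H.Adj a b → H.dist u b = H.dist u a + 1 → t b = some a := by
    intro a b hab hd
    have hb : b ∉ (q a).support := by
      intro hb
      have h1 := H.dist_le ((q a).takeUntil b hb)
      have h2 := (q a).length_takeUntil_le_length hb
      rw [hl] at h2
      omega
    have h3 := huniq ((q a).concat hab) ((hq a).concat hb hab)
    have hbu : b ≠ u := by rintro rfl; simp at hd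
    simp only [t, if_neg hbu, ← h3, SimpleGraph.Walk.penultimate_concat]
  have hsome : ∀ {a b}, t a = some b → H.Adj a b ∧ H.dist u a = H.dist u b + 1 := by
    intro a b hab
    by_cases hau : a = u
    · simp [t, hau] at hab
    · simp only [t, if_neg hau, Option.some.injEq] at hab
      subst hab
      have hnil : ¬ (q a).Nil := fun h => hau h.eq.symm
      have hadj := (q a).adj_penultimate hnil
      refine ⟨hadj.symm, ?_⟩
      have h1 := H.dist_le (q a).dropLast
      have h2 : (q a).dropLast.length + 1 = (q a).length := by
        rw [← SimpleGraph.Walk.length_concat _ hadj, SimpleGraph.Walk.concat_dropLast hadj]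
      rw [hl] at h2
      have h3 := hH.dist_eq_dist_add_one_of_adj u hadj
      omega
  refine ⟨t, fun a b => ⟨fun h => ?_, ?_⟩, fun a b h => (hsome h).2, fun a h => ?_⟩
  · rcases hH.dist_eq_dist_add_one_of_adj u h with h' | h'
    · exact Or.inl (hfar h.symm h')
    · exact Or.inr (hfar h h')
  · rintro (h | h)
    · exact (hsome h).1
    · exact (hsome h).1.symm
  · by_contra hau
    simp [t, hau] at h

/-- Generalized caterpillar graphs have a rooted description. -/
lemma exists_rootedCliques_genCatGraph {V₀ C W : Type} {H : SimpleGraph V₀} {u v : V₀}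
    {p : H.Walk u v} {g : C → ℕ} {f : W → V₀ ⊕ C} (hH : H.IsTree) (hp : p.IsPath)
    (hg : ∀ c, g c < p.length) :
    ∃ (t : (V₀ ⊕ C) ⊕ W → Option ((V₀ ⊕ C) ⊕ W)) (cl : (V₀ ⊕ C) ⊕ W → V₀ ⊕ W)
      (δ : (V₀ ⊕ C) ⊕ W → ℕ), RootedCliques (genCatGraph H p g f) t cl δ ∧
      ∀ a b, t a = none → t b = none → a = b := by
  obtain ⟨tH, hadj, hdist, hnone⟩ := exists_parent hH u
  have hpd : ∀ i, i ≤ p.length → H.dist u (p.getVert i) = i := by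
    intro i hi
    rw [← length_eq_dist_of_isPath hH (hp.take i), SimpleGraph.Walk.take_length]
    omega
  have hpt : ∀ c, tH (p.getVert (g c + 1)) = some (p.getVert (g c)) := by
    intro c
    have hc := hg c
    refine ((hadj _ _).1 (p.adj_getVert_succ hc)).resolve_left fun h => ?_
    have := hdist _ _ h
    rw [hpd _ hc.le, hpd _ hc] at this
    omega
  have hinj : ∀ c c', p.getVert (g c + 1) = p.getVert (g c' + 1) → g c = g c' := by
    intro c c' h
    have := congrArg (H.dist u) h
    rw [hpd _ (hg c), hpd _ (hg c')] at this
    omega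
  let δ₀ : V₀ ⊕ C → ℕ := Sum.elim (H.dist u) (fun c => g c + 1)
  let t : (V₀ ⊕ C) ⊕ W → Option ((V₀ ⊕ C) ⊕ W) := Sum.elim
    (Sum.elim (fun a => (tH a).map fun b => .inl (.inl b))
      (fun c => some (.inl (.inl (p.getVert (g c)))))) (fun w => some (.inl (f w)))
  let cl : (V₀ ⊕ C) ⊕ W → V₀ ⊕ W := Sum.elim
    (Sum.elim .inl (fun c => .inl (p.getVert (g c + 1)))) .inr
  let δ : (V₀ ⊕ C) ⊕ W → ℕ := Sum.elim δ₀ (fun w => δ₀ (f w) + 1)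
  refine ⟨t, cl, δ, ⟨?_, ?_, ?_, ?_⟩, ?_⟩
  · rintro ((a | c) | w) ((b | d) | z) <;>
      simp only [genCatGraph, SimpleGraph.fromRel_adj, genCatRel, t, cl, Sum.elim_inl,
        Sum.elim_inr, ne_eq, Sum.inl.injEq, Sum.inr.injEq, Option.map_eq_some_iff,
        Option.some.injEq, reduceCtorEq, and_false, false_and, or_false, false_or,
        exists_false, not_false_eq_true, true_and, exists_eq_right]
    · rw [hadj, hadj]
      tauto
    · tauto
    · tauto
    · tauto
    · refine and_congr_right fun _ => ⟨?_, fun h => Or.inl (hinj _ _ h)⟩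
      rintro (h | h) <;> rw [h]
    · tauto
    · tauto
    · tauto
    · tauto
  · rintro ((a | c) | w) ((b | d) | z) h <;>
      simp [t, δ, δ₀] at h ⊢
    · have := hdist a b h
      omega
    · rw [← h, hpd _ (hg c).le]
    · rw [h]; simp
    · rw [h]; simp
  · rintro ((a | c) | w) ((b | d) | z) h <;>
      simp [t, cl] at h ⊢
    · rw [h]
    · rw [h, hpt]
    · rw [← h, hpt]
    · rw [hinj _ _ h]
    · rw [h]
  · rintro ((a | c) | w) ((b | d) | z) h <;>
      simp [δ, δ₀, cl] at h ⊢
    · rw [h]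
    · rw [h, hpd _ (hg d)]
    · rw [← h, hpd _ (hg c)]
    · rw [hinj _ _ h]
    · rw [h]
  · rintro ((a | c) | w) ((b | d) | z) h h' <;>
      simp [t] at h h' ⊢
    rw [hnone _ h, hnone _ h']

lemma GoodOrder.comap {V V' : Type} {G : SimpleGraph V} {G' : SimpleGraph V'} {ord : V' → ℕ}
    (ho : GoodOrder G' ord) (e : G ≃g G') : GoodOrder G (ord ∘ e) where
  inj := ho.inj.comp e.injective
  clique h₁ h₂ h₃ h₄ h₅ := e.map_adj_iff.1 (ho.clique h₁ h₂ (e.map_adj_iff.2 h₃)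
    (e.map_adj_iff.2 h₄) (e.injective.ne h₅))
  uniform a := by
    refine (ho.uniform (e a)).imp (fun h b h₁ h₂ w h₃ h₄ => ?_) (fun h b h₁ h₂ w h₃ h₄ => ?_)
    · exact h (e b) h₁ (e.map_adj_iff.2 h₂) (e w) h₃ (e.map_adj_iff.2 h₄)
    · exact e.map_adj_iff.1
        (h (e b) h₁ (e.map_adj_iff.2 h₂) (e w) h₃ (e.map_adj_iff.2 h₄))
  adj h₁ h₂ h₃ h₄ h₅ h₆ h₇ h₈ := e.map_adj_iff.1 (ho.adj h₁ h₂ h₃ (e.injective.ne h₄)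
    (e.map_adj_iff.2 h₅) (e.map_adj_iff.2 h₆) (e.map_adj_iff.2 h₇) (e.map_adj_iff.2 h₈))

lemma exists_goodOrder {V : Type} {G : SimpleGraph V} (hG : IsGeneralizedCaterpillar G)
    (hnet : NetFree G) : ∃ ord, GoodOrder G ord := by
  obtain ⟨V₀, C, W, _, _, _, H, u, v, p, g, f, hH, hp, -, hg, ⟨e⟩⟩ := hG
  have hnet' : NetFree (genCatGraph H p g f) :=
    ⟨fun φ => hnet.false (φ.trans e.symm.toEmbedding)⟩
  obtain ⟨t, cl, δ, h, hroot⟩ := exists_rootedCliques_genCatGraph (f := f) hH hp hg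
  obtain ⟨t', cl', δ', h', hb⟩ := h.exists_singleBusy hnet' hroot
  obtain ⟨ord, ho⟩ := h'.exists_goodOrder hb
  exact ⟨_, ho.comap e⟩

end BinomialEdge

/-- If `G` is a net-free generalized caterpillar graph, then `J_G ^ i = J_G ^ (i)`
for every `i ≥ 1`. -/
theorem ordinary_eq_symbolic_of_netFree_generalizedCaterpillar {V : Type} [Fintype V]
    (k : Type) [Field k] (G : SimpleGraph V) (hG : IsGeneralizedCaterpillar G)
    (hnet : NetFree G) :
    ∀ i : ℕ, 1 ≤ i →
      binomialEdgeIdeal k G ^ i = symbolicPower (binomialEdgeIdeal k G) i := by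
  intro i _
  obtain ⟨ord, ho⟩ := BinomialEdge.exists_goodOrder hG hnet
  exact ho.pow_eq_symbolicPower k i
end
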